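/- Let q be an odd prime power and F a finite field with exactly q elements. Then the ratio k(Sp(2n,F))/q^n tends to the infinite product Π_{i=1}^∞ (1 + q^{−i})⁴ / (1 − q^{−i}) as n tends to infinity. -/

import Mathlib

open scoped Matrix

/-- The matrix of the standard symplectic form: `[[0, Iₙ], [-Iₙ, 0]]`. -/
def sympJ (n : ℕ) (F : Type*) [Field F] :
    Matrix (Fin n ⊕ Fin n) (Fin n ⊕ Fin n) F :=
  Matrix.fromBlocks 0 1 (-1) 0

/-- The symplectic group `Sp(2n, F)`: invertible `2n × 2n` matrices `A` with
`Aᵀ * J * A = J`, where `J = [[0, Iₙ], [-Iₙ, 0]]`. -/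
def Sp (n : ℕ) (F : Type*) [Field F] :
    Subgroup (Matrix.GeneralLinearGroup (Fin n ⊕ Fin n) F) where
  carrier := {A | (A : Matrix (Fin n ⊕ Fin n) (Fin n ⊕ Fin n) F)ᵀ * sympJ n F *
      (A : Matrix (Fin n ⊕ Fin n) (Fin n ⊕ Fin n) F) = sympJ n F}
  one_mem' := by simp
  mul_mem' := by
    intro A B hA hB
    simp only [Set.mem_setOf_eq] at hA hB ⊢
    rw [Units.val_mul, Matrix.transpose_mul]
    calc (B : Matrix _ _ F)ᵀ * (A : Matrix _ _ F)ᵀ * sympJ n F *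
          ((A : Matrix _ _ F) * (B : Matrix _ _ F))
        = (B : Matrix _ _ F)ᵀ * ((A : Matrix _ _ F)ᵀ * sympJ n F * (A : Matrix _ _ F)) *
            (B : Matrix _ _ F) := by simp only [mul_assoc]
      _ = sympJ n F := by rw [hA, hB]
  inv_mem' := by
    intro A hA
    simp only [Set.mem_setOf_eq] at hA ⊢
    have h1 : (A : Matrix (Fin n ⊕ Fin n) (Fin n ⊕ Fin n) F) *
        (↑A⁻¹ : Matrix (Fin n ⊕ Fin n) (Fin n ⊕ Fin n) F) = 1 := A.mul_inv
    conv_lhs => rw [← hA]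
    calc (↑A⁻¹ : Matrix _ _ F)ᵀ * ((A : Matrix _ _ F)ᵀ * sympJ n F * (A : Matrix _ _ F)) *
          (↑A⁻¹ : Matrix _ _ F)
        = ((A : Matrix _ _ F) * (↑A⁻¹ : Matrix _ _ F))ᵀ * sympJ n F *
            ((A : Matrix _ _ F) * (↑A⁻¹ : Matrix _ _ F)) := by
          rw [Matrix.transpose_mul]; simp only [mul_assoc]
      _ = sympJ n F := by rw [h1]; simp

universe u

/-! ### Spaces with a form, an isometry and a nilpotent operator -/

section

/-- A finite-dimensional space with an `ε`-symmetric, possibly degenerate, bilinear form `b`,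
together with commuting operators: an isometry `s` whose order is invertible in `F`, and a
nilpotent skew-adjoint operator `X`. -/
structure FormSpace (F : Type u) [Field F] (ε : F) where
  V : Type u
  [addCommGroup : AddCommGroup V]
  [module : Module F V]
  [finite : FiniteDimensional F V]
  b : V →ₗ[F] V →ₗ[F] F
  s : Module.End F V
  X : Module.End F V
  b_symm : ∀ u v, b u v = ε * b v u
  b_s : ∀ u v, b (s u) (s v) = b u v
  b_X : ∀ u v, b (X u) v = -b u (X v)
  s_X : ∀ u, s (X u) = X (s u)
  s_order : ∃ m : ℕ, (m : F) ≠ 0 ∧ s ^ m = 1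
  X_nil : IsNilpotent X

attribute [instance] FormSpace.addCommGroup FormSpace.module FormSpace.finite

namespace FormSpace

variable {F : Type u} [Field F] {ε : F}

/-- The form separates points. -/
def Nondeg (P : FormSpace F ε) : Prop := ∀ u, (∀ v, P.b u v = 0) → u = 0

/-- A linear map preserving the form and commuting with both operators. -/
structure IsHom {P Q : FormSpace F ε} (f : P.V →ₗ[F] Q.V) : Prop where
  b : ∀ u v, Q.b (f u) (f v) = P.b u v
  s : ∀ u, f (P.s u) = Q.s (f u)
  X : ∀ u, f (P.X u) = Q.X (f u)

/-- Isometry of form spaces, compatible with both operators. -/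
def Iso (P Q : FormSpace F ε) : Prop := ∃ f : P.V ≃ₗ[F] Q.V, IsHom (f : P.V →ₗ[F] Q.V)

theorem Iso.refl (P : FormSpace F ε) : Iso P P :=
  ⟨LinearEquiv.refl F P.V, by constructor <;> simp⟩

theorem Iso.symm {P Q : FormSpace F ε} : Iso P Q → Iso Q P := by
  rintro ⟨f, hb, hs, hX⟩
  refine ⟨f.symm, fun u v => ?_, fun u => ?_, fun u => ?_⟩
  · simpa using (hb (f.symm u) (f.symm v)).symm
  · apply f.injective
    simpa using (hs (f.symm u)).symm
  · apply f.injective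
    simpa using (hX (f.symm u)).symm

theorem IsHom.comp {P Q R : FormSpace F ε} {g : Q.V →ₗ[F] R.V} {f : P.V →ₗ[F] Q.V}
    (hg : IsHom g) (hf : IsHom f) : IsHom (P := P) (Q := R) (g ∘ₗ f) :=
  ⟨fun u v => by simp [hg.b, hf.b], fun u => by simp [hg.s, hf.s], fun u => by simp [hg.X, hf.X]⟩

theorem Iso.trans {P Q R : FormSpace F ε} : Iso P Q → Iso Q R → Iso P R := by
  rintro ⟨f, hf⟩ ⟨g, hg⟩
  exact ⟨f.trans g, hg.comp hf⟩

theorem Iso.finrank_eq {P Q : FormSpace F ε} : Iso P Q →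
    Module.finrank F P.V = Module.finrank F Q.V := fun ⟨f, _⟩ => f.finrank_eq

theorem IsHom.injective {P Q : FormSpace F ε} {f : P.V →ₗ[F] Q.V} (hf : IsHom f)
    (hP : P.Nondeg) : Function.Injective f := by
  rw [injective_iff_map_eq_zero]
  intro u hu
  exact hP u fun v => by rw [← hf.b, hu]; simp

/-- A homomorphism out of a nondegenerate space to a space of the same dimension is an isometry. -/
theorem IsHom.iso {P Q : FormSpace F ε} {f : P.V →ₗ[F] Q.V} (hf : IsHom f)
    (hP : P.Nondeg) (h : Module.finrank F P.V = Module.finrank F Q.V) : Iso P Q :=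
  ⟨LinearEquiv.ofInjectiveOfFinrankEq f (hf.injective hP) h, hf⟩

/-- Two nondegenerate images of the same form space are isometric. -/
theorem iso_of_surjective {P Q R : FormSpace F ε} {f : P.V →ₗ[F] Q.V} {g : P.V →ₗ[F] R.V}
    (hf : IsHom f) (hg : IsHom g) (hfs : Function.Surjective f) (hgs : Function.Surjective g)
    (hQ : Q.Nondeg) (hR : R.Nondeg) : Iso Q R := by
  have hk : LinearMap.ker f = LinearMap.ker g := by
    ext u
    simp only [LinearMap.mem_ker]
    constructor
    · intro h
      refine hR _ fun v => ?_
      obtain ⟨v, rfl⟩ := hgs v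
      rw [hg.b, ← hf.b, h]; simp
    · intro h
      refine hQ _ fun v => ?_
      obtain ⟨v, rfl⟩ := hfs v
      rw [hf.b, ← hg.b, h]; simp
  let e : Q.V ≃ₗ[F] R.V := (f.quotKerEquivOfSurjective hfs).symm.trans
    ((Submodule.quotEquivOfEq _ _ hk).trans (g.quotKerEquivOfSurjective hgs))
  have he : ∀ u, e (f u) = g u := by
    intro u
    have : (f.quotKerEquivOfSurjective hfs).symm (f u) = (LinearMap.ker f).mkQ u := by
      rw [LinearEquiv.symm_apply_eq]; simp
    simp [e, this]
  refine ⟨e, fun u v => ?_, fun u => ?_, fun u => ?_⟩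
  · obtain ⟨u, rfl⟩ := hfs u
    obtain ⟨v, rfl⟩ := hfs v
    simp [he, hf.b, hg.b]
  · obtain ⟨u, rfl⟩ := hfs u
    simp [he, ← hf.s, ← hg.s]
  · obtain ⟨u, rfl⟩ := hfs u
    simp [he, ← hf.X, ← hg.X]

theorem s_bijective (P : FormSpace F ε) : Function.Bijective P.s := by
  obtain ⟨m, hm, h⟩ := P.s_order
  have hm0 : m ≠ 0 := by rintro rfl; simp at hm
  rw [← Module.End.isUnit_iff]
  exact IsUnit.of_pow_eq_one h hm0

theorem s_surjective (P : FormSpace F ε) : Function.Surjective P.s := P.s_bijective.2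

/-- Restriction to an invariant subspace. -/
@[reducible]
def restrict (P : FormSpace F ε) (W : Submodule F P.V) (hs : ∀ u ∈ W, P.s u ∈ W)
    (hX : ∀ u ∈ W, P.X u ∈ W) : FormSpace F ε where
  V := W
  b := P.b.domRestrict₁₂ W W
  s := P.s.restrict hs
  X := P.X.restrict hX
  b_symm u v := P.b_symm u v
  b_s u v := P.b_s u v
  b_X u v := P.b_X u v
  s_X u := Subtype.ext (P.s_X u)
  s_order := by
    obtain ⟨m, hm, h⟩ := P.s_order
    refine ⟨m, hm, LinearMap.ext fun u => ?_⟩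
    rw [Module.End.pow_restrict]
    ext
    simp [h]
  X_nil := by
    obtain ⟨k, h⟩ := P.X_nil
    refine ⟨k, LinearMap.ext fun u => ?_⟩
    rw [Module.End.pow_restrict]
    ext
    simp [h]

theorem _root_.LinearMap.prodMap_pow' {V W : Type*} [AddCommGroup V] [Module F V]
    [AddCommGroup W] [Module F W] (f : Module.End F V) (g : Module.End F W) (n : ℕ) :
    (f.prodMap g : Module.End F (V × W)) ^ n = (f ^ n).prodMap (g ^ n) := by
  induction n with
  | zero => exact LinearMap.prodMap_one.symm
  | succ n ih => rw [pow_succ, ih, pow_succ, pow_succ]; rfl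

/-- Orthogonal direct sum. -/
@[reducible]
def sum (P Q : FormSpace F ε) : FormSpace F ε where
  V := P.V × Q.V
  b := P.b.compl₁₂ (LinearMap.fst F P.V Q.V) (LinearMap.fst F P.V Q.V) +
    Q.b.compl₁₂ (LinearMap.snd F P.V Q.V) (LinearMap.snd F P.V Q.V)
  s := P.s.prodMap Q.s
  X := P.X.prodMap Q.X
  b_symm u v := by
    simp only [LinearMap.add_apply, LinearMap.compl₁₂_apply, LinearMap.fst_apply,
      LinearMap.snd_apply]
    rw [P.b_symm, Q.b_symm]; ring
  b_s u v := by simp [P.b_s, Q.b_s]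
  b_X u v := by simp [P.b_X, Q.b_X]; ring
  s_X u := by simp [P.s_X, Q.s_X]
  s_order := by
    obtain ⟨m, hm, h⟩ := P.s_order
    obtain ⟨m', hm', h'⟩ := Q.s_order
    refine ⟨m * m', by simp [hm, hm'], ?_⟩
    rw [LinearMap.prodMap_pow', pow_mul, h, mul_comm m, pow_mul, h', one_pow, one_pow]
    exact LinearMap.prodMap_one
  X_nil := by
    obtain ⟨k, h⟩ := P.X_nil
    obtain ⟨l, h'⟩ := Q.X_nil
    refine ⟨k + l, ?_⟩
    rw [LinearMap.prodMap_pow', pow_add, h, pow_add, h', zero_mul, mul_zero]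
    exact LinearMap.prodMap_zero

theorem sum_b (P Q : FormSpace F ε) (u v : P.V × Q.V) :
    (P.sum Q).b u v = P.b u.1 v.1 + Q.b u.2 v.2 := rfl

theorem sum_s (P Q : FormSpace F ε) (u : P.V × Q.V) :
    (P.sum Q).s u = (P.s u.1, Q.s u.2) := rfl

theorem Nondeg.sum {P Q : FormSpace F ε} (hP : P.Nondeg) (hQ : Q.Nondeg) :
    (P.sum Q).Nondeg := by
  rintro ⟨u, u'⟩ h
  refine Prod.ext (hP u fun v => ?_) (hQ u' fun v => ?_)
  · simpa [sum_b] using h (v, 0)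
  · simpa [sum_b] using h (0, v)

theorem Iso.sum {P P' Q Q' : FormSpace F ε} : Iso P P' → Iso Q Q' →
    Iso (P.sum Q) (P'.sum Q') := by
  rintro ⟨f, hf⟩ ⟨g, hg⟩
  refine ⟨LinearEquiv.prodCongr f g, ?_, ?_, ?_⟩
  · rintro ⟨u, u'⟩ ⟨v, v'⟩
    exact congrArg₂ (· + ·) (hf.b u v) (hg.b u' v')
  · rintro ⟨u, u'⟩
    exact Prod.ext (hf.s u) (hg.s u')
  · rintro ⟨u, v⟩
    exact Prod.ext (hf.X u) (hg.X v)

/-- A nondegenerate subspace splits off. -/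
theorem exists_iso_sum {A P : FormSpace F ε} {i : A.V →ₗ[F] P.V} (hi : IsHom i)
    (hA : A.Nondeg) (hP : P.Nondeg) :
    ∃ W : Submodule F P.V, ∃ hs : ∀ u ∈ W, P.s u ∈ W, ∃ hX : ∀ u ∈ W, P.X u ∈ W,
      (∀ w, w ∈ W ↔ ∀ a, P.b w (i a) = 0) ∧ (P.restrict W hs hX).Nondeg ∧
      Iso (A.sum (P.restrict W hs hX)) P := by
  let W : Submodule F P.V := LinearMap.ker (P.b.compl₂ i)
  have hW : ∀ w, w ∈ W ↔ ∀ a, P.b w (i a) = 0 := fun w => by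
    simp [W, LinearMap.mem_ker, LinearMap.ext_iff]
  have hs : ∀ u ∈ W, P.s u ∈ W := by
    intro u hu
    rw [hW] at hu ⊢
    intro a
    obtain ⟨a, rfl⟩ := A.s_surjective a
    rw [hi.s, P.b_s, hu]
  have hX : ∀ u ∈ W, P.X u ∈ W := by
    intro u hu
    rw [hW] at hu ⊢
    intro a
    rw [P.b_X, ← hi.X, hu, neg_zero]
  have hAinj : Function.Injective A.b := by
    rw [injective_iff_map_eq_zero]
    exact fun u hu => hA u fun v => by simp [hu]
  have hAbij : Function.Surjective A.b :=
    (LinearMap.injective_iff_surjective_of_finrank_eq_finrank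
      (Subspace.dual_finrank_eq (K := F) (V := A.V)).symm).1 hAinj
  have hdec : ∀ v, ∃ a, v - i a ∈ W := by
    intro v
    obtain ⟨a, ha⟩ := hAbij ((P.b v).comp i)
    refine ⟨a, (hW _).2 fun c => ?_⟩
    have := LinearMap.congr_fun ha c
    simp only [LinearMap.comp_apply] at this
    rw [map_sub, LinearMap.sub_apply, hi.b, this, sub_self]
  have horth : ∀ a, ∀ w ∈ W, P.b (i a) w = 0 := fun a w hw => by
    rw [P.b_symm, (hW w).1 hw, mul_zero]
  let f : (A.sum (P.restrict W hs hX)).V →ₗ[F] P.V := i.coprod W.subtype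
  have hf : IsHom f := by
    refine ⟨?_, ?_, ?_⟩
    · rintro ⟨a, w, hw⟩ ⟨a', w', hw'⟩
      change P.b (i a + w) (i a' + w') = A.b a a' + P.b w w'
      simp [hi.b, horth a w' hw', (hW w).1 hw a']
    · rintro ⟨a, w, hw⟩
      change i (A.s a) + P.s w = P.s (i a + w)
      simp [hi.s]
    · rintro ⟨a, w, hw⟩
      change i (A.X a) + P.X w = P.X (i a + w)
      simp [hi.X]
  have hfs : Function.Surjective f := by
    intro v
    obtain ⟨a, ha⟩ := hdec v
    exact ⟨(a, ⟨_, ha⟩), add_sub_cancel _ _⟩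
  have hB : (P.restrict W hs hX).Nondeg := by
    rintro ⟨w, hw⟩ h
    apply Subtype.ext
    refine hP w fun v => ?_
    obtain ⟨a, ha⟩ := hdec v
    have h1 : P.b w (v - i a) = 0 := h ⟨_, ha⟩
    have h2 := (hW w).1 hw a
    rwa [map_sub, h2, sub_zero] at h1
  refine ⟨W, hs, hX, hW, hB, LinearEquiv.ofBijective f ⟨hf.injective (hA.sum hB), hfs⟩, hf⟩

/-- The quotient of a form space by the radical of its form. -/
theorem exists_reduction (P : FormSpace F ε) :
    ∃ Q : FormSpace F ε, Q.Nondeg ∧ ∃ π : P.V →ₗ[F] Q.V, IsHom π ∧ Function.Surjective π := by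
  let R := LinearMap.ker P.b
  have hR : ∀ u, u ∈ R ↔ ∀ v, P.b u v = 0 := fun u => by simp [R, LinearMap.ext_iff]
  have hR' : ∀ v, v ∈ R ↔ ∀ u, P.b u v = 0 := fun v => by
    rw [hR]
    constructor
    · intro h u; rw [P.b_symm, h, mul_zero]
    · intro h u; rw [P.b_symm, h, mul_zero]
  have hs : R ≤ R.comap P.s := by
    intro u hu
    rw [Submodule.mem_comap, hR]
    intro v
    obtain ⟨v, rfl⟩ := P.s_surjective v
    rw [P.b_s, (hR u).1 hu]
  have hX : R ≤ R.comap P.X := by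
    intro u hu
    rw [Submodule.mem_comap, hR]
    intro v
    rw [P.b_X, (hR u).1 hu, neg_zero]
  let b₁ : (P.V ⧸ R) →ₗ[F] P.V →ₗ[F] F := R.liftQ P.b le_rfl
  let b₂ : (P.V ⧸ R) →ₗ[F] (P.V ⧸ R) →ₗ[F] F := LinearMap.flip (R.liftQ b₁.flip (by
    intro v hv
    rw [LinearMap.mem_ker]
    ext u
    simpa [b₁] using (hR' v).1 hv u))
  have hb : ∀ u v, b₂ (R.mkQ u) (R.mkQ v) = P.b u v := fun u v => by simp [b₂, b₁]
  have hsur := R.mkQ_surjective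
  let Q : FormSpace F ε :=
    { V := P.V ⧸ R
      b := b₂
      s := R.mapQ R P.s hs
      X := R.mapQ R P.X hX
      b_symm := fun u v => by
        obtain ⟨u, rfl⟩ := hsur u
        obtain ⟨v, rfl⟩ := hsur v
        rw [hb, hb, P.b_symm]
      b_s := fun u v => by
        obtain ⟨u, rfl⟩ := hsur u
        obtain ⟨v, rfl⟩ := hsur v
        change b₂ (R.mkQ (P.s u)) (R.mkQ (P.s v)) = _
        rw [hb, hb, P.b_s]
      b_X := fun u v => by
        obtain ⟨u, rfl⟩ := hsur u
        obtain ⟨v, rfl⟩ := hsur v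
        change b₂ (R.mkQ (P.X u)) (R.mkQ v) = - b₂ (R.mkQ u) (R.mkQ (P.X v))
        rw [hb, hb, P.b_X]
      s_X := fun u => by
        obtain ⟨u, rfl⟩ := hsur u
        simp [P.s_X]
      s_order := by
        obtain ⟨m, hm, h⟩ := P.s_order
        refine ⟨m, hm, ?_⟩
        rw [← Submodule.mapQ_pow]
        refine LinearMap.ext fun u => ?_
        obtain ⟨u, rfl⟩ := hsur u
        simp [h]
      X_nil := by
        obtain ⟨m, h⟩ := P.X_nil
        refine ⟨m, ?_⟩
        rw [← Submodule.mapQ_pow]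
        refine LinearMap.ext fun u => ?_
        obtain ⟨u, rfl⟩ := hsur u
        simp [h] }
  refine ⟨Q, ?_, R.mkQ, ⟨hb, fun u => by simp [Q], fun u => by simp [Q]⟩, hsur⟩
  intro u hu
  obtain ⟨u, rfl⟩ := hsur u
  have : u ∈ R := (hR u).2 fun v => by rw [← hb]; exact hu _
  exact (Submodule.Quotient.mk_eq_zero R).2 this

end FormSpace

end

/-! ### Layerings -/

section

namespace FormSpace

variable {F : Type u} [Field F] {ε : F}

theorem s_semisimple (P : FormSpace F ε) : P.s.IsSemisimple := by
  obtain ⟨m, hm, h⟩ := P.s_order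
  refine Module.End.isSemisimple_of_squarefree_aeval_eq_zero (p := Polynomial.X ^ m - 1) ?_ ?_
  · exact (Polynomial.X_pow_sub_one_separable_iff.2 hm).squarefree
  · simp [h]

/-- Invariant complements for semisimple operators. -/
theorem exists_complement {V : Type*} [AddCommGroup V] [Module F V] {s : Module.End F V}
    (hs : s.IsSemisimple) (W : Submodule F V) (hW : ∀ u ∈ W, s u ∈ W) :
    ∃ C : Submodule F V, (∀ u ∈ C, s u ∈ C) ∧ IsCompl W C := by
  obtain ⟨C, hC, h⟩ := Module.End.isSemisimple_iff.1 hs W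
    ((Module.End.mem_invtSubmodule_iff_forall_mem_of_mem s).2 hW)
  exact ⟨C, (Module.End.mem_invtSubmodule_iff_forall_mem_of_mem s).1 hC, h⟩

/-- Equivariant lifting along a surjection whose source is semisimple. -/
theorem exists_lift {A B C : Type*} [AddCommGroup A] [Module F A] [AddCommGroup B] [Module F B]
    [AddCommGroup C] [Module F C] {sA : Module.End F A} {sB : Module.End F B}
    {sC : Module.End F C} (hsB : sB.IsSemisimple) {g : B →ₗ[F] C} {φ : A →ₗ[F] C}
    (hg : ∀ x, g (sB x) = sC (g x)) (hφ : ∀ x, φ (sA x) = sC (φ x))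
    (hsur : Function.Surjective g) :
    ∃ f : A →ₗ[F] B, (∀ x, f (sA x) = sB (f x)) ∧ ∀ x, g (f x) = φ x := by
  obtain ⟨D, hD, hc⟩ := exists_complement hsB (LinearMap.ker g) (fun u hu => by
    rw [LinearMap.mem_ker] at hu ⊢
    rw [hg, hu, map_zero])
  have hinj : ∀ x ∈ D, ∀ y ∈ D, g x = g y → x = y := by
    intro x hx y hy h
    have h1 : x - y ∈ LinearMap.ker g ⊓ D :=
      ⟨LinearMap.mem_ker.2 (by rw [map_sub, h, sub_self]), D.sub_mem hx hy⟩
    rw [hc.inf_eq_bot, Submodule.mem_bot] at h1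
    exact sub_eq_zero.1 h1
  have hbij : Function.Bijective (g ∘ₗ D.subtype) := by
    refine ⟨fun x y h => Subtype.ext (hinj _ x.2 _ y.2 h), fun c => ?_⟩
    obtain ⟨b, rfl⟩ := hsur c
    have hb : b ∈ LinearMap.ker g ⊔ D := by rw [hc.sup_eq_top]; trivial
    obtain ⟨k, hk, d, hd, rfl⟩ := Submodule.mem_sup.1 hb
    exact ⟨⟨d, hd⟩, by simp [LinearMap.mem_ker.1 hk]⟩
  let e := LinearEquiv.ofBijective _ hbij
  have he : ∀ c, g (e.symm c) = c := fun c => e.apply_symm_apply c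
  refine ⟨D.subtype ∘ₗ (e.symm : C →ₗ[F] D) ∘ₗ φ, fun x => ?_, fun x => ?_⟩
  · refine hinj _ (e.symm (φ (sA x))).2 _ (hD _ (e.symm (φ x)).2) ?_
    change g (e.symm (φ (sA x))) = g (sB (e.symm (φ x)))
    rw [he, hg, he, hφ]
  · exact he _

theorem exists_factor {A B C : Type*} [AddCommGroup A] [Module F A] [AddCommGroup B] [Module F B]
    [AddCommGroup C] [Module F C] {f : A →ₗ[F] B} {g : A →ₗ[F] C}
    (h : LinearMap.ker f ≤ LinearMap.ker g) : ∃ r : B →ₗ[F] C, ∀ v, r (f v) = g v := by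
  obtain ⟨σ, hσ⟩ := LinearMap.exists_rightInverse_of_surjective f.rangeRestrict
    f.range_rangeRestrict
  obtain ⟨r, hr⟩ := LinearMap.exists_extend (g ∘ₗ σ)
  refine ⟨r, fun v => ?_⟩
  have h1 : r (f v) = g (σ (f.rangeRestrict v)) := LinearMap.congr_fun hr (f.rangeRestrict v)
  have h2 : f (σ (f.rangeRestrict v)) = f v :=
    congrArg Subtype.val (LinearMap.congr_fun hσ (f.rangeRestrict v))
  rw [h1, ← sub_eq_zero, ← map_sub]
  refine h ?_
  rw [LinearMap.mem_ker, map_sub, h2, sub_self]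

theorem Nondeg.eq_zero_right {P : FormSpace F ε} (hP : P.Nondeg) {v : P.V}
    (h : ∀ u, P.b u v = 0) : v = 0 :=
  hP v fun u => by rw [P.b_symm, h, mul_zero]

theorem Nondeg.exists_repr_functional {P : FormSpace F ε} (hP : P.Nondeg) (φ : P.V →ₗ[F] F) :
    ∃ v, ∀ u, P.b v u = φ u := by
  have hinj : Function.Injective P.b := by
    rw [injective_iff_map_eq_zero]
    exact fun u hu => hP u fun v => by simp [hu]
  obtain ⟨v, hv⟩ := (LinearMap.injective_iff_surjective_of_finrank_eq_finrank
      (Subspace.dual_finrank_eq (K := F) (V := P.V)).symm).1 hinj φ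
  exact ⟨v, fun u => LinearMap.congr_fun hv u⟩

/-- Every bilinear form is represented by an operator. -/
theorem Nondeg.exists_repr {P : FormSpace F ε} (hP : P.Nondeg) (β : P.V →ₗ[F] P.V →ₗ[F] F) :
    ∃ D : Module.End F P.V, ∀ u v, P.b u (D v) = β u v := by
  have hinj : Function.Injective P.b.flip := by
    rw [injective_iff_map_eq_zero]
    exact fun u hu => hP.eq_zero_right fun v => by
      rw [← LinearMap.flip_apply, hu, LinearMap.zero_apply]
  let e := LinearEquiv.ofInjectiveOfFinrankEq P.b.flip hinj
    (Subspace.dual_finrank_eq (K := F) (V := P.V)).symm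
  refine ⟨(e.symm : _ →ₗ[F] P.V) ∘ₗ β.flip, fun u v => ?_⟩
  have : e (e.symm (β.flip v)) u = β u v := by rw [e.apply_symm_apply, LinearMap.flip_apply]
  exact this

/-- The orthogonal of the kernel of `X` is its range. -/
theorem Nondeg.mem_range_X {P : FormSpace F ε} (hP : P.Nondeg) {k : P.V}
    (h : ∀ k', P.X k' = 0 → P.b k' k = 0) : ∃ v, P.X v = k := by
  have h1 : P.b k ∈ (LinearMap.ker P.X).dualAnnihilator := by
    rw [Submodule.mem_dualAnnihilator]
    intro w hw
    rw [P.b_symm, h w hw, mul_zero]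
  rw [← LinearMap.range_dualMap_eq_dualAnnihilator_ker] at h1
  obtain ⟨φ, hφ⟩ := h1
  obtain ⟨w, hw⟩ := hP.exists_repr_functional φ
  refine ⟨-w, ?_⟩
  rw [← sub_eq_zero]
  refine hP _ fun u => ?_
  have := LinearMap.congr_fun hφ u
  rw [LinearMap.dualMap_apply] at this
  rw [map_sub, LinearMap.sub_apply, P.b_X, map_neg, LinearMap.neg_apply, hw, ← this]
  simp

/-- `μ` and `π` exhibit `L` as the form induced on `ker X`, and `U` as the form `b (X u) v`
modulo its radical. -/
structure IsLayering {P : FormSpace F ε} {L : FormSpace F ε} {U : FormSpace F (-ε)}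
    (μ : P.V →ₗ[F] L.V) (π : P.V →ₗ[F] U.V) : Prop where
  μ_b : ∀ k k', P.X k = 0 → P.X k' = 0 → L.b (μ k) (μ k') = P.b k k'
  μ_s : ∀ u, μ (P.s u) = L.s (μ u)
  μ_surj : ∀ l, ∃ k, P.X k = 0 ∧ μ k = l
  π_b : ∀ u v, U.b (π u) (π v) = P.b (P.X u) v
  π_s : ∀ u, π (P.s u) = U.s (π u)
  π_X : ∀ u, π (P.X u) = U.X (π u)
  π_surj : ∀ w, ∃ u, π u = w

namespace IsLayering

variable {P : FormSpace F ε} {L : FormSpace F ε} {U : FormSpace F (-ε)}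
  {μ : P.V →ₗ[F] L.V} {π : P.V →ₗ[F] U.V}

theorem π_eq_zero (h : IsLayering μ π) (hP : P.Nondeg) (hU : U.Nondeg) (u : P.V) :
    π u = 0 ↔ P.X u = 0 := by
  constructor
  · intro hu
    refine hP _ fun v => ?_
    rw [← h.π_b, hu]; simp
  · intro hu
    refine hU _ fun v => ?_
    obtain ⟨v, rfl⟩ := h.π_surj v
    rw [h.π_b, hu]; simp

theorem μ_eq_zero (h : IsLayering μ π) (hP : P.Nondeg) (hL : L.Nondeg) {k : P.V}
    (hk : P.X k = 0) : μ k = 0 ↔ ∃ v, P.X v = k := by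
  constructor
  · intro h0
    refine hP.mem_range_X fun k' hk' => ?_
    rw [← h.μ_b k' k hk' hk, h0, map_zero]
  · rintro ⟨v, rfl⟩
    refine hL _ fun l => ?_
    obtain ⟨l, hl, rfl⟩ := h.μ_surj l
    rw [h.μ_b _ _ hk hl, P.b_X, hl]; simp

/-- An equivariant projection onto the range of `X` preserving the kernel of `X`. -/
theorem _root_.FormSpace.exists_projection (P : FormSpace F ε) :
    ∃ p : Module.End F P.V, (∀ u, p (P.s u) = P.s (p u)) ∧ (∀ u, ∃ v, P.X v = p u) ∧
      (∀ v, p (P.X v) = P.X v) ∧ ∀ k, P.X k = 0 → P.X (p k) = 0 := by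
  let K := LinearMap.ker P.X
  let I := LinearMap.range P.X
  have hK : ∀ u ∈ K, P.s u ∈ K := fun u hu => by
    rw [LinearMap.mem_ker] at hu ⊢
    rw [← P.s_X, hu, map_zero]
  have hI : ∀ u ∈ I, P.s u ∈ I := by
    rintro _ ⟨v, rfl⟩
    exact ⟨P.s v, (P.s_X v).symm⟩
  obtain ⟨N, hN, hNc⟩ := exists_complement P.s_semisimple (K ⊓ I)
    fun u hu => ⟨hK u hu.1, hI u hu.2⟩
  obtain ⟨C, hC, hCc⟩ := exists_complement P.s_semisimple (I ⊔ (N ⊓ K)) (by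
    intro u hu
    obtain ⟨a, ha, b, hb, rfl⟩ := Submodule.mem_sup.1 hu
    rw [map_add]
    exact Submodule.add_mem_sup (hI a ha) ⟨hN b hb.1, hK b hb.2⟩)
  let W := (N ⊓ K) ⊔ C
  have hdis : Disjoint I (N ⊓ K) := by
    rw [disjoint_iff, eq_bot_iff]
    intro x hx
    rw [← hNc.inf_eq_bot]
    exact ⟨⟨hx.2.2, hx.1⟩, hx.2.1⟩
  have hWc : IsCompl I W := by
    constructor
    · exact hdis.disjoint_sup_right_of_disjoint_sup_left hCc.disjoint
    · rw [codisjoint_iff, ← sup_assoc]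
      exact hCc.sup_eq_top
  have hW : ∀ u ∈ W, P.s u ∈ W := by
    intro u hu
    obtain ⟨a, ha, b, hb, rfl⟩ := Submodule.mem_sup.1 hu
    rw [map_add]
    exact Submodule.add_mem_sup ⟨hN a ha.1, hK a ha.2⟩ (hC b hb)
  let p : Module.End F P.V := I.subtype ∘ₗ I.projectionOnto W hWc
  have hp : ∀ a ∈ I, ∀ w ∈ W, p (a + w) = a := by
    intro a ha w hw
    have h1 : p a = a := congrArg Subtype.val (Submodule.projectionOnto_apply_left hWc ⟨a, ha⟩)
    have h2 : p w = 0 := congrArg Subtype.val (Submodule.projectionOnto_apply_right hWc ⟨w, hw⟩)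
    rw [map_add, h1, h2, add_zero]
  refine ⟨p, fun u => ?_, fun u => ?_, fun v => ?_, fun k hk => ?_⟩
  · have hu : u ∈ I ⊔ W := by rw [hWc.sup_eq_top]; trivial
    obtain ⟨a, ha, w, hw, rfl⟩ := Submodule.mem_sup.1 hu
    rw [map_add, hp _ (hI a ha) _ (hW w hw), hp a ha w hw]
  · exact (I.projectionOnto W hWc u).2
  · simpa using hp (P.X v) ⟨v, rfl⟩ 0 W.zero_mem
  · have hk' : k ∈ (K ⊓ I) ⊔ N := by rw [hNc.sup_eq_top]; trivial
    obtain ⟨a, ha, w, hw, rfl⟩ := Submodule.mem_sup.1 hk'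
    rw [hp a ha.2 w]
    · exact ha.1
    · refine le_sup_left (a := N ⊓ K) ⟨hw, ?_⟩
      have : a + w - a ∈ K := K.sub_mem hk ha.1
      simpa using this

/-- Two spaces with the same layers admit an equivariant map compatible with the layers. -/
theorem exists_map {Q : FormSpace F ε} {μ' : Q.V →ₗ[F] L.V} {π' : Q.V →ₗ[F] U.V}
    (h : IsLayering μ π) (h' : IsLayering μ' π') (hP : P.Nondeg) (hQ : Q.Nondeg)
    (hL : L.Nondeg) (hU : U.Nondeg) :
    ∃ f : P.V →ₗ[F] Q.V, (∀ u, f (P.s u) = Q.s (f u)) ∧ (∀ u, f (P.X u) = Q.X (f u)) ∧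
      (∀ u, π' (f u) = π u) ∧ ∀ k, P.X k = 0 → μ' (f k) = μ k := by
  obtain ⟨f', hf's, hf'⟩ := exists_lift (sA := P.s) (sC := L.s.prodMap U.s) (φ := μ.prod π)
    Q.s_semisimple (g := μ'.prod π')
    (fun x => Prod.ext (h'.μ_s x) (h'.π_s x)) (fun x => Prod.ext (h.μ_s x) (h.π_s x)) (by
      rintro ⟨l, w⟩
      obtain ⟨v, rfl⟩ := h'.π_surj w
      obtain ⟨k, hk, hk'⟩ := h'.μ_surj (l - μ' v)
      refine ⟨k + v, Prod.ext ?_ ?_⟩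
      · simp [hk']
      · simp [(h'.π_eq_zero hQ hU k).2 hk])
  have hμ : ∀ x, μ' (f' x) = μ x := fun x => congrArg Prod.fst (hf' x)
  have hπ : ∀ x, π' (f' x) = π x := fun x => congrArg Prod.snd (hf' x)
  obtain ⟨p, hps, hpr, hpX, hpK⟩ := P.exists_projection
  have hXker : LinearMap.ker P.X ≤ LinearMap.ker (Q.X ∘ₗ f') := by
    intro k hk
    have : π k = 0 := (h.π_eq_zero hP hU k).2 hk
    rw [← hπ, h'.π_eq_zero hQ hU] at this
    exact this
  obtain ⟨r, hr⟩ : ∃ r : P.V →ₗ[F] Q.V, ∀ v, r (P.X v) = Q.X (f' v) :=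
    exists_factor hXker
  have hπ' : ∀ u, π' (r (p u) + f' (u - p u)) = π u := by
    intro u
    obtain ⟨v, hv⟩ := hpr u
    rw [← hv, hr, map_add, hπ, h'.π_X, hπ, ← h.π_X, ← map_add, add_sub_cancel]
  have hXf : ∀ u v, π' u = π' v → Q.X u = Q.X v := by
    intro u v huv
    rw [← sub_eq_zero, ← map_sub, ← h'.π_eq_zero hQ hU, map_sub, huv, sub_self]
  refine ⟨r ∘ₗ p + f' ∘ₗ (LinearMap.id - p), fun u => ?_, fun u => ?_, hπ', fun k hk => ?_⟩
  · change r (p (P.s u)) + f' (P.s u - p (P.s u)) = Q.s (r (p u) + f' (u - p u))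
    rw [hps, map_add, ← hf's, map_sub P.s]
    congr 1
    obtain ⟨v, hv⟩ := hpr u
    rw [← hv, hr, P.s_X, hr, hf's, Q.s_X]
  · change r (p (P.X u)) + f' (P.X u - p (P.X u)) = Q.X (r (p u) + f' (u - p u))
    rw [hpX, sub_self, map_zero, add_zero, hr]
    exact hXf _ _ (by rw [hπ, hπ'])
  · change μ' (r (p k) + f' (k - p k)) = μ k
    obtain ⟨v, hv⟩ := hpr k
    have hXv : P.X (P.X v) = 0 := by rw [hv]; exact hpK k hk
    have h0 : Q.X (Q.X (f' v)) = 0 := by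
      rw [← h'.π_eq_zero hQ hU, h'.π_X, hπ, ← h.π_X, h.π_eq_zero hP hU, hXv]
    rw [← hv, hr, map_add, hμ, (h'.μ_eq_zero hQ hL h0).2 ⟨_, rfl⟩, map_sub,
      (h.μ_eq_zero hP hL hXv).2 ⟨_, rfl⟩, sub_zero, zero_add]

/-- The dimension of the kernel of `X`. -/
noncomputable def _root_.FormSpace.kdim (P : FormSpace F ε) : ℕ :=
  Module.finrank F (LinearMap.ker P.X)

theorem finrank_upper (h : IsLayering μ π) (hP : P.Nondeg) (hU : U.Nondeg) :
    Module.finrank F P.V = Module.finrank F U.V + P.kdim := by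
  rw [← LinearMap.finrank_range_add_finrank_ker π, LinearMap.range_eq_top.2 h.π_surj, finrank_top,
    kdim, show LinearMap.ker π = LinearMap.ker P.X from Submodule.ext (h.π_eq_zero hP hU)]

theorem kdim_eq (h : IsLayering μ π) (hP : P.Nondeg) (hL : L.Nondeg) (hU : U.Nondeg) :
    P.kdim = Module.finrank F L.V + U.kdim := by
  have h1 := LinearMap.finrank_range_add_finrank_ker (μ ∘ₗ (LinearMap.ker P.X).subtype)
  rw [LinearMap.range_eq_top.2 (fun l => by
    obtain ⟨k, hk, rfl⟩ := h.μ_surj l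
    exact ⟨⟨k, hk⟩, rfl⟩), finrank_top] at h1
  rw [kdim, ← h1]
  refine congrArg _ ?_
  obtain ⟨σ, hσ⟩ :=
    LinearMap.exists_rightInverse_of_surjective π (LinearMap.range_eq_top.2 h.π_surj)
  have hσ : ∀ u, π (σ u) = u := fun u => LinearMap.congr_fun hσ u
  have hXf : ∀ u v, π u = π v ↔ P.X u = P.X v := by
    intro u v
    rw [← sub_eq_zero, ← map_sub, h.π_eq_zero hP hU, map_sub, sub_eq_zero]
  let g : U.V →ₗ[F] P.V := P.X ∘ₗ σ
  have hg : ∀ v, g (π v) = P.X v := fun v => (hXf _ _).1 (hσ _)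
  have hginj : Function.Injective g := fun u v huv => by
    have := (hXf (σ u) (σ v)).2 huv
    rwa [hσ, hσ] at this
  rw [kdim, (Submodule.equivMapOfInjective g hginj (LinearMap.ker U.X)).finrank_eq,
    ← Submodule.finrank_map_subtype_eq]
  suffices Submodule.map (LinearMap.ker P.X).subtype
      (LinearMap.ker (μ ∘ₗ (LinearMap.ker P.X).subtype)) =
      Submodule.map g (LinearMap.ker U.X) by rw [this]
  ext k
  simp only [Submodule.mem_map, LinearMap.mem_ker]
  constructor
  · rintro ⟨⟨k, hk⟩, hμ, rfl⟩
    obtain ⟨v, rfl⟩ := (h.μ_eq_zero hP hL hk).1 hμ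
    refine ⟨π v, ?_, hg v⟩
    rw [← h.π_X, h.π_eq_zero hP hU]
    exact hk
  · rintro ⟨w, hw, rfl⟩
    obtain ⟨v, rfl⟩ := h.π_surj w
    rw [← h.π_X, h.π_eq_zero hP hU] at hw
    refine ⟨⟨P.X v, hw⟩, (h.μ_eq_zero hP hL hw).2 ⟨v, rfl⟩, (hg v).symm⟩

/-- A nondegenerate form space is determined by its layers. -/
theorem iso {Q : FormSpace F ε} {μ' : Q.V →ₗ[F] L.V} {π' : Q.V →ₗ[F] U.V}
    (h2 : (2 : F) ≠ 0) (h : IsLayering μ π) (h' : IsLayering μ' π') (hP : P.Nondeg)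
    (hQ : Q.Nondeg) (hL : L.Nondeg) (hU : U.Nondeg) : Iso P Q := by
  obtain ⟨f, hfs, hfX, hfπ, hfμ⟩ := h.exists_map h' hP hQ hL hU
  obtain ⟨D, hD⟩ := hP.exists_repr (Q.b.compl₁₂ f f - P.b)
  replace hD : ∀ u v, P.b u (D v) = Q.b (f u) (f v) - P.b u v := hD
  have hDs : ∀ u, D (P.s u) = P.s (D u) := by
    intro u
    rw [← sub_eq_zero]
    refine hP.eq_zero_right fun v => ?_
    obtain ⟨v, rfl⟩ := P.s_surjective v
    rw [map_sub, hD, P.b_s, P.b_s, hD, hfs, hfs, Q.b_s, sub_self]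
  have hXD : ∀ u, P.X (D u) = 0 := by
    intro u
    refine hP.eq_zero_right fun v => ?_
    have := hD (P.X v) u
    rw [P.b_X, hfX, ← h'.π_b, hfπ, hfπ, h.π_b, sub_self, neg_eq_zero] at this
    exact this
  have hadj : ∀ u v, P.b (D u) v = P.b u (D v) := by
    intro u v
    rw [P.b_symm, hD, hD, mul_sub, ← P.b_symm, ← Q.b_symm]
  have hDX : ∀ u, D (P.X u) = 0 := by
    intro u
    refine hP _ fun v => ?_
    rw [hadj, P.b_X, hXD]; simp
  have hDD : ∀ u, D (D (D u)) = 0 := by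
    intro u
    obtain ⟨v, hv⟩ : ∃ v, P.X v = D (D u) := hP.mem_range_X fun k hk => by
      rw [hD, ← h'.μ_b, hfμ k hk, hfμ _ (hXD _), h.μ_b _ _ hk (hXD _), sub_self]
      · rw [← hfX, hk, map_zero]
      · rw [← hfX, hXD, map_zero]
    rw [← hv, hDX]
  let g : Module.End F P.V := 1 - (2⁻¹ : F) • D + (3 * 2⁻¹ ^ 3 : F) • D ^ 2
  have hg : ∀ u, g u = u - (2⁻¹ : F) • D u + (3 * 2⁻¹ ^ 3 : F) • D (D u) := fun u => rfl
  refine IsHom.iso (f := f ∘ₗ g) ⟨fun u v => ?_, fun u => ?_, fun u => ?_⟩ hP ?_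
  · change Q.b (f (g u)) (f (g v)) = _
    have e1 : ∀ u v, Q.b (f u) (f v) = P.b u v + P.b u (D v) := fun u v => by rw [hD]; ring
    rw [e1]
    simp only [hg, map_add, map_sub, map_smul, LinearMap.add_apply, LinearMap.sub_apply,
      LinearMap.smul_apply, smul_eq_mul, hadj, hDD, smul_zero, map_zero, add_zero, mul_zero,
      sub_zero]
    field_simp
    ring
  · change f (g (P.s u)) = Q.s (f (g u))
    simp only [hg, hDs, map_add, map_sub, map_smul, hfs]
  · change f (g (P.X u)) = Q.X (f (g u))
    simp only [hg, hDX, hXD, map_add, map_sub, map_smul, map_zero, smul_zero, ← hfX]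
  · rw [h.finrank_upper hP hU, h'.finrank_upper hQ hU, h.kdim_eq hP hL hU, h'.kdim_eq hQ hL hU]

end IsLayering

end FormSpace

end

/-! ### Isometry classes -/

section

namespace FormSpace

variable {F : Type u} [Field F] {ε : F}

/-- The space `V` with the form `b (X u) v`. -/
@[reducible]
def shift (P : FormSpace F ε) : FormSpace F (-ε) where
  V := P.V
  b := P.b ∘ₗ P.X
  s := P.s
  X := P.X
  b_symm u v := by
    change P.b (P.X u) v = -ε * P.b (P.X v) u
    rw [P.b_X, P.b_symm]; ring
  b_s u v := by
    change P.b (P.X (P.s u)) (P.s v) = P.b (P.X u) v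
    rw [← P.s_X, P.b_s]
  b_X u v := P.b_X (P.X u) v
  s_X := P.s_X
  s_order := P.s_order
  X_nil := P.X_nil

/-- The kernel of `X`. -/
@[reducible]
def kerX (P : FormSpace F ε) : FormSpace F ε :=
  P.restrict (LinearMap.ker P.X)
    (fun u hu => by rw [LinearMap.mem_ker] at hu ⊢; rw [← P.s_X, hu, map_zero])
    (fun u hu => by rw [LinearMap.mem_ker] at hu ⊢; rw [hu, map_zero])

theorem exists_isLayering (P : FormSpace F ε) :
    ∃ (L : FormSpace F ε) (U : FormSpace F (-ε)) (μ : P.V →ₗ[F] L.V) (π : P.V →ₗ[F] U.V),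
      L.Nondeg ∧ L.X = 0 ∧ U.Nondeg ∧ IsLayering μ π := by
  obtain ⟨L, hL, μ, hμ, hμs⟩ := exists_reduction P.kerX
  obtain ⟨U, hU, π, hπ, hπs⟩ := exists_reduction P.shift
  obtain ⟨C, hC, hc⟩ := exists_complement P.s_semisimple (LinearMap.ker P.X)
    (fun u hu => by rw [LinearMap.mem_ker] at hu ⊢; rw [← P.s_X, hu, map_zero])
  have hp1 : ∀ k : LinearMap.ker P.X, (LinearMap.ker P.X).projectionOnto C hc k = k :=
    Submodule.projectionOnto_apply_left hc
  have hp2 : ∀ c : C, (LinearMap.ker P.X).projectionOnto C hc c = 0 :=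
    Submodule.projectionOnto_apply_right hc
  refine ⟨L, U, μ ∘ₗ (LinearMap.ker P.X).projectionOnto C hc, π, hL, ?_, hU, ?_⟩
  · ext l
    obtain ⟨⟨k, hk⟩, rfl⟩ := hμs l
    rw [← hμ.X, LinearMap.zero_apply]
    have : P.kerX.X ⟨k, hk⟩ = 0 := Subtype.ext hk
    rw [this, map_zero]
  · refine ⟨fun k k' hk hk' => ?_, fun u => ?_, fun l => ?_, hπ.b, hπ.s, hπ.X, hπs⟩
    · have h1 := hp1 ⟨k, hk⟩
      have h2 := hp1 ⟨k', hk'⟩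
      simp only [LinearMap.comp_apply]
      rw [h1, h2, hμ.b]
      rfl
    · have hu : u ∈ LinearMap.ker P.X ⊔ C := by rw [hc.sup_eq_top]; trivial
      obtain ⟨a, ha, c, hc', rfl⟩ := Submodule.mem_sup.1 hu
      have h1 := hp1 ⟨a, ha⟩
      have h2 := hp2 ⟨c, hc'⟩
      have h3 := hp1 (P.kerX.s ⟨a, ha⟩)
      have h4 := hp2 ⟨_, hC c hc'⟩
      simp only [LinearMap.comp_apply]
      rw [map_add P.s, map_add, map_add ((LinearMap.ker P.X).projectionOnto C hc), h1, h2, h4]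
      change μ ((LinearMap.ker P.X).projectionOnto C hc
        (P.kerX.s ⟨a, ha⟩ : LinearMap.ker P.X) + 0) = _
      rw [h3, add_zero, add_zero, hμ.s]
    · obtain ⟨⟨k, hk⟩, rfl⟩ := hμs l
      exact ⟨k, hk, congrArg μ (hp1 ⟨k, hk⟩)⟩

theorem IsLayering.unique {P L L' : FormSpace F ε} {U U' : FormSpace F (-ε)}
    {μ : P.V →ₗ[F] L.V} {π : P.V →ₗ[F] U.V} {μ' : P.V →ₗ[F] L'.V} {π' : P.V →ₗ[F] U'.V}
    (h : IsLayering μ π) (h' : IsLayering μ' π') (hL : L.Nondeg) (hL' : L'.Nondeg)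
    (hU : U.Nondeg) (hU' : U'.Nondeg) (hX : L.X = 0) (hX' : L'.X = 0) : Iso L L' ∧ Iso U U' := by
  constructor
  · have key : ∀ {M : FormSpace F ε} {V : FormSpace F (-ε)} {ν : P.V →ₗ[F] M.V}
        {ρ : P.V →ₗ[F] V.V}, IsLayering ν ρ → M.X = 0 →
        IsHom (P := P.kerX) (Q := M) (ν ∘ₗ (LinearMap.ker P.X).subtype) ∧
        Function.Surjective (ν ∘ₗ (LinearMap.ker P.X).subtype) := by
      intro M V ν ρ h hM
      refine ⟨⟨?_, ?_, ?_⟩, ?_⟩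
      · rintro ⟨k, hk⟩ ⟨k', hk'⟩
        exact h.μ_b k k' hk hk'
      · rintro ⟨k, hk⟩
        exact h.μ_s k
      · rintro ⟨k, hk⟩
        rw [hM, LinearMap.zero_apply]
        change ν (P.X k) = 0
        rw [LinearMap.mem_ker.1 hk, map_zero]
      · intro l
        obtain ⟨k, hk, hl⟩ := h.μ_surj l
        exact ⟨⟨k, hk⟩, hl⟩
    exact iso_of_surjective (key h hX).1 (key h' hX').1 (key h hX).2 (key h' hX').2 hL hL'
  · have key : ∀ {M : FormSpace F ε} {V : FormSpace F (-ε)} {ν : P.V →ₗ[F] M.V}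
        {ρ : P.V →ₗ[F] V.V}, IsLayering ν ρ → IsHom (P := P.shift) (Q := V) ρ :=
      fun h => ⟨h.π_b, h.π_s, h.π_X⟩
    exact iso_of_surjective (key h) (key h') h.π_surj h'.π_surj hU hU'

theorem IsLayering.comp {P P' L L' : FormSpace F ε} {U U' : FormSpace F (-ε)}
    {μ : P.V →ₗ[F] L.V} {π : P.V →ₗ[F] U.V} (h : IsLayering μ π)
    {e : P'.V ≃ₗ[F] P.V} {f : L.V ≃ₗ[F] L'.V} {g : U.V ≃ₗ[F] U'.V}
    (he : IsHom (e : P'.V →ₗ[F] P.V)) (hf : IsHom (f : L.V →ₗ[F] L'.V))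
    (hg : IsHom (g : U.V →ₗ[F] U'.V)) :
    IsLayering (P := P') ((f : L.V →ₗ[F] L'.V) ∘ₗ μ ∘ₗ (e : P'.V →ₗ[F] P.V))
      ((g : U.V →ₗ[F] U'.V) ∘ₗ π ∘ₗ (e : P'.V →ₗ[F] P.V)) where
  μ_b k k' hk hk' := by
    have h1 := h.μ_b (e k) (e k') ((he.X k).symm.trans (by simp [hk]))
      ((he.X k').symm.trans (by simp [hk']))
    exact (hf.b _ _).trans (h1.trans (he.b k k'))
  μ_s u := (congrArg _ ((congrArg μ (he.s u)).trans (h.μ_s _))).trans (hf.s _)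
  μ_surj l := by
    obtain ⟨k, hk, hl⟩ := h.μ_surj (f.symm l)
    refine ⟨e.symm k, ?_, by simp [hl]⟩
    apply e.injective
    refine (he.X _).trans ?_
    simp [hk]
  π_b u v := (hg.b _ _).trans ((h.π_b _ _).trans (by rw [← he.X, he.b]))
  π_s u := (congrArg _ ((congrArg π (he.s u)).trans (h.π_s _))).trans (hg.s _)
  π_X u := (congrArg _ ((congrArg π (he.X u)).trans (h.π_X _))).trans (hg.X _)
  π_surj w := by
    obtain ⟨u, hu⟩ := h.π_surj (g.symm w)
    exact ⟨e.symm u, by simp [hu]⟩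

theorem exists_of_layers {L : FormSpace F ε} {U : FormSpace F (-ε)} (hL : L.Nondeg)
    (hU : U.Nondeg) : ∃ (P : FormSpace F ε) (μ : P.V →ₗ[F] L.V) (π : P.V →ₗ[F] U.V),
      P.Nondeg ∧ IsLayering μ π := by
  obtain ⟨C, hC, hc⟩ := exists_complement U.s_semisimple (LinearMap.range U.X) (by
    rintro _ ⟨v, rfl⟩
    exact ⟨U.s v, (U.s_X v).symm⟩)
  have hdis : ∀ u, ∀ c : C, U.X u + c = 0 → U.X u = 0 ∧ c = 0 := by
    intro u c h
    have h1 : U.X u ∈ LinearMap.range U.X ⊓ C :=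
      ⟨⟨u, rfl⟩, by rw [eq_neg_of_add_eq_zero_left h]; exact C.neg_mem c.2⟩
    rw [hc.inf_eq_bot, Submodule.mem_bot] at h1
    rw [h1, zero_add] at h
    exact ⟨h1, Subtype.ext h⟩
  have hsur : ∀ w, ∃ u, ∃ c : C, U.X u + c = w := by
    intro w
    have hw : w ∈ LinearMap.range U.X ⊔ C := by rw [hc.sup_eq_top]; trivial
    obtain ⟨_, ⟨u, rfl⟩, c, hc, rfl⟩ := Submodule.mem_sup.1 hw
    exact ⟨u, ⟨c, hc⟩, rfl⟩
  let l : L.V × U.V × C →ₗ[F] L.V := LinearMap.fst F _ _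
  let p : L.V × U.V × C →ₗ[F] U.V := LinearMap.fst F _ _ ∘ₗ LinearMap.snd F _ _
  let c : L.V × U.V × C →ₗ[F] U.V := C.subtype ∘ₗ LinearMap.snd F _ _ ∘ₗ LinearMap.snd F _ _
  let π : L.V × U.V × C →ₗ[F] U.V := U.X ∘ₗ p + c
  let X : Module.End F (L.V × U.V × C) :=
    LinearMap.inr F _ _ ∘ₗ LinearMap.inl F _ _ ∘ₗ π
  let s : Module.End F (L.V × U.V × C) := L.s.prodMap (U.s.prodMap (U.s.restrict hC))
  let b : L.V × U.V × C →ₗ[F] L.V × U.V × C →ₗ[F] F :=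
    L.b.compl₁₂ l l + U.b.compl₁₂ p π - U.b.compl₁₂ c p
  have hb : ∀ x y : L.V × U.V × C, b x y =
      L.b x.1 y.1 + U.b x.2.1 (U.X y.2.1 + y.2.2) - U.b x.2.2 y.2.1 := fun x y => rfl
  have hπ : ∀ x : L.V × U.V × C, π x = U.X x.2.1 + x.2.2 := fun x => rfl
  have hX : ∀ x : L.V × U.V × C, X x = (0, U.X x.2.1 + x.2.2, 0) := fun x => rfl
  have hs : ∀ x : L.V × U.V × C, s x = (L.s x.1, U.s x.2.1, U.s.restrict hC x.2.2) := fun x => rfl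
  have hs' : ∀ x : L.V × U.V × C, ((s x).2.2 : U.V) = U.s x.2.2 := fun x => rfl
  let P : FormSpace F ε :=
    { V := L.V × U.V × C
      b := b
      s := s
      X := X
      b_symm := fun x y => by
        rw [hb, hb, L.b_symm]
        simp only [map_add]
        rw [← neg_eq_iff_eq_neg.2 (U.b_X x.2.1 y.2.1), U.b_symm (U.X x.2.1), U.b_symm x.2.1 y.2.2,
          U.b_symm x.2.2 y.2.1]
        ring
      b_s := fun x y => by
        rw [hb, hb, hs', hs', hs, hs]
        simp only [← U.s_X, ← map_add, L.b_s, U.b_s]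
      b_X := fun x y => by
        rw [hb, hb, hX, hX]
        simp only [map_zero, LinearMap.zero_apply, Submodule.coe_zero, add_zero, zero_add, sub_zero]
        rw [map_add U.b, LinearMap.add_apply, U.b_X]
        ring
      s_X := fun x => by
        rw [hs, hX, hX]
        simp only [map_zero, hs]
        refine Prod.ext rfl (Prod.ext ?_ rfl)
        change U.s (U.X x.2.1 + x.2.2) = U.X (U.s x.2.1) + U.s x.2.2
        rw [map_add, U.s_X]
      s_order := by
        obtain ⟨m, hm, h⟩ := L.s_order
        obtain ⟨m', hm', h'⟩ := U.s_order
        refine ⟨m * m', by simp [hm, hm'], ?_⟩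
        have h1 : U.s.restrict hC ^ m' = 1 := by
          refine LinearMap.ext fun u => ?_
          rw [Module.End.pow_restrict]
          ext
          simp [h']
        rw [LinearMap.prodMap_pow', LinearMap.prodMap_pow', pow_mul, h, mul_comm m, pow_mul, h',
          pow_mul, h1, one_pow, one_pow, one_pow]
        rfl
      X_nil := by
        obtain ⟨k, h⟩ := U.X_nil
        refine ⟨k + 1, LinearMap.ext fun x => ?_⟩
        have : ∀ j : ℕ, (X ^ (j + 1)) x = (0, (U.X ^ j) (π x), 0) := by
          intro j
          induction j with
          | zero => rw [zero_add, pow_one, pow_zero]; rfl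
          | succ j ih =>
            rw [pow_succ', Module.End.mul_apply, ih, hX, pow_succ' U.X, Module.End.mul_apply]
            simp
        rw [this, h]
        rfl }
  refine ⟨P, l, π, ?_, ?_⟩
  · intro x hx
    have hx : ∀ y : L.V × U.V × C,
      L.b x.1 y.1 + U.b x.2.1 (U.X y.2.1 + y.2.2) - U.b x.2.2 y.2.1 = 0 := hx
    have h1 : x.1 = 0 := hL _ fun v => by simpa using hx (v, 0, 0)
    have h2 : U.X x.2.1 + x.2.2 = 0 := hU _ fun v => by
      have := hx (0, v, 0)
      simp only [map_zero, Submodule.coe_zero, add_zero, zero_add] at this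
      rw [← neg_eq_iff_eq_neg.2 (U.b_X x.2.1 v)] at this
      rw [map_add, LinearMap.add_apply]
      linear_combination -this
    obtain ⟨h3, h4⟩ := hdis _ _ h2
    have h5 : x.2.1 = 0 := hU _ fun v => by
      obtain ⟨u, c, rfl⟩ := hsur v
      have := hx (0, u, c)
      simpa [h4] using this
    exact Prod.ext h1 (Prod.ext h5 h4)
  · have hker : ∀ x : L.V × U.V × C, X x = 0 → U.X x.2.1 = 0 ∧ x.2.2 = 0 := by
      intro x hx
      rw [hX] at hx
      exact hdis _ _ (congrArg (fun z => z.2.1) hx)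
    refine ⟨fun x y hx hy => ?_, fun x => rfl, fun v => ⟨(v, 0, 0), ?_, rfl⟩, fun x y => ?_,
      fun x => ?_, fun x => ?_, fun w => ?_⟩
    · change L.b x.1 y.1 = b x y
      obtain ⟨-, h2⟩ := hker x hx
      obtain ⟨h3, h4⟩ := hker y hy
      rw [hb, h2, h3, h4]
      simp
    · change X (v, 0, 0) = 0
      rw [hX]
      simp
    · change U.b (π x) (π y) = b (X x) y
      rw [hb, hX, hπ, hπ]
      simp
    · change π (s x) = U.s (π x)
      rw [hπ, hπ, hs', map_add, U.s_X]
      rfl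
    · change π (X x) = U.X (π x)
      rw [hπ (X x), hX, hπ]
      simp
    · obtain ⟨u, c, rfl⟩ := hsur w
      exact ⟨(0, u, c), rfl⟩

variable (ε) in
/-- Isometry of nondegenerate form spaces. -/
instance isoSetoid : Setoid {P : FormSpace F ε // P.Nondeg} where
  r P Q := Iso P.1 Q.1
  iseqv := ⟨fun P => Iso.refl P.1, Iso.symm, Iso.trans⟩

variable (ε) in
/-- Isometry classes of nondegenerate form spaces. -/
def Cls : Type (u + 1) := Quotient (isoSetoid ε)

/-- The class of a nondegenerate form space. -/
def toCls (P : FormSpace F ε) (hP : P.Nondeg) : Cls ε := Quotient.mk _ ⟨P, hP⟩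

theorem toCls_eq {P Q : FormSpace F ε} {hP : P.Nondeg} {hQ : Q.Nondeg} :
    toCls P hP = toCls Q hQ ↔ Iso P Q := Quotient.eq

theorem Iso.kdim_eq {P Q : FormSpace F ε} : Iso P Q → P.kdim = Q.kdim := by
  rintro ⟨f, hf⟩
  refine LinearEquiv.finrank_eq ((LinearEquiv.submoduleMap f _).trans (LinearEquiv.ofEq _ _ ?_))
  ext q
  rw [Submodule.mem_map]
  constructor
  · rintro ⟨u, hu, rfl⟩
    rw [LinearMap.mem_ker, ← hf.X, LinearMap.mem_ker.1 hu, map_zero]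
  · intro hq
    refine ⟨f.symm q, ?_, by simp⟩
    rw [LinearMap.mem_ker]
    apply f.injective
    refine (hf.X _).trans ?_
    simpa using hq

namespace Cls

theorem exists_rep (c : Cls ε) : ∃ P : FormSpace F ε, ∃ hP, toCls P hP = c := by
  induction c using Quotient.inductionOn with
  | h P => exact ⟨P.1, P.2, rfl⟩

/-- The dimension of the space. -/
noncomputable def dim : Cls ε → ℕ :=
  Quotient.lift (fun P => Module.finrank F P.1.V) fun _ _ h => Iso.finrank_eq h

/-- The dimension of the kernel of `X`. -/
noncomputable def kdim : Cls ε → ℕ :=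
  Quotient.lift (fun P => P.1.kdim) fun _ _ h => Iso.kdim_eq h

theorem dim_toCls (P : FormSpace F ε) (hP : P.Nondeg) :
    (toCls P hP).dim = Module.finrank F P.V := rfl

theorem kdim_toCls (P : FormSpace F ε) (hP : P.Nondeg) : (toCls P hP).kdim = P.kdim := rfl

end Cls

theorem kdim_eq_finrank_iff (P : FormSpace F ε) : P.kdim = Module.finrank F P.V ↔ P.X = 0 := by
  rw [kdim, ← LinearMap.ker_eq_top]
  constructor
  · exact Submodule.eq_top_of_finrank_eq
  · intro h
    rw [h, finrank_top]

variable (ε) in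
/-- Classes of form spaces with `X = 0`. -/
abbrev SSCls : Type (u + 1) := {c : Cls ε // c.kdim = c.dim}

theorem exists_layer_equiv (h2 : (2 : F) ≠ 0) (ε : F) :
    ∃ e : Cls ε ≃ SSCls ε × Cls (-ε), ∀ c,
      c.dim = (e c).1.1.dim + (e c).2.dim + (e c).2.kdim ∧
      c.kdim = (e c).1.1.dim + (e c).2.kdim := by
  have hex : ∀ c : Cls ε, ∃ y : SSCls ε × Cls (-ε), ∃ (P L : FormSpace F ε) (U : FormSpace F (-ε))
      (hP : P.Nondeg) (hL : L.Nondeg) (hU : U.Nondeg) (μ : P.V →ₗ[F] L.V) (π : P.V →ₗ[F] U.V),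
      L.X = 0 ∧ IsLayering μ π ∧ toCls P hP = c ∧ toCls L hL = y.1.1 ∧ toCls U hU = y.2 := by
    intro c
    obtain ⟨P, hP, rfl⟩ := c.exists_rep
    obtain ⟨L, U, μ, π, hL, hX, hU, h⟩ := P.exists_isLayering
    exact ⟨(⟨toCls L hL, (kdim_eq_finrank_iff L).2 hX⟩, toCls U hU), P, L, U, hP, hL, hU, μ, π,
      hX, h, rfl, rfl, rfl⟩
  choose f hf using hex
  have hbij : Function.Bijective f := by
    constructor
    · intro c c' hcc'
      obtain ⟨P, L, U, hP, hL, hU, μ, π, -, h, rfl, h1, h2'⟩ := hf c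
      obtain ⟨P', L', U', hP', hL', hU', μ', π', -, h', rfl, h1', h2''⟩ := hf c'
      rw [hcc', ← h1', toCls_eq] at h1
      rw [hcc', ← h2'', toCls_eq] at h2'
      obtain ⟨g, hg⟩ := h1
      obtain ⟨g', hg'⟩ := h2'
      obtain ⟨e, he⟩ := Iso.refl P
      exact toCls_eq.2 ((h.comp he hg hg').iso h2 h' hP hP' hL' hU')
    · rintro ⟨⟨l, hl⟩, w⟩
      obtain ⟨L, hL, rfl⟩ := l.exists_rep
      obtain ⟨U, hU, rfl⟩ := w.exists_rep
      obtain ⟨P, μ, π, hP, h⟩ := exists_of_layers hL hU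
      refine ⟨toCls P hP, ?_⟩
      obtain ⟨P', L', U', hP', hL', hU', μ', π', hX', h', h0, h1, h2'⟩ := hf (toCls P hP)
      obtain ⟨e, he⟩ := toCls_eq.1 h0.symm
      obtain ⟨g, hg⟩ := Iso.refl L'
      obtain ⟨g', hg'⟩ := Iso.refl U'
      have hu := h.unique (h'.comp he hg hg') hL hL' hU hU' ((kdim_eq_finrank_iff L).1 hl) hX'
      exact Prod.ext (Subtype.ext (h1.symm.trans (toCls_eq.2 hu.1.symm)))
        (h2'.symm.trans (toCls_eq.2 hu.2.symm))
  refine ⟨Equiv.ofBijective f hbij, fun c => ?_⟩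
  obtain ⟨P, L, U, hP, hL, hU, μ, π, -, h, rfl, h1, h2'⟩ := hf c
  rw [Equiv.ofBijective_apply, ← h1, ← h2']
  simp only [Cls.dim_toCls, Cls.kdim_toCls]
  have e1 := h.finrank_upper hP hU
  have e2 := h.kdim_eq hP hL hU
  omega

end FormSpace

end

/-! ### Generating functions -/

section

open scoped ENNReal
open Filter Topology

namespace FormSpace

variable {F : Type u} [Field F] {ε : F}

theorem tendsto_tsum_truncation {α : Type*} (w : α → ℕ) (f : α → ℝ≥0∞) :
    Tendsto (fun N : ℕ => ∑' a, if w a ≤ N then f a else 0) atTop (𝓝 (∑' a, f a)) := by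
  have hmono : Monotone (fun N : ℕ => ∑' a, if w a ≤ N then f a else 0) := by
    intro N M h
    refine ENNReal.tsum_le_tsum fun a => ?_
    split_ifs with h1 h2
    · exact le_rfl
    · exact absurd (h1.trans h) h2
    · exact zero_le
    · exact le_rfl
  have h := tendsto_atTop_iSup hmono
  convert h
  apply le_antisymm
  · rw [ENNReal.tsum_eq_iSup_sum]
    refine iSup_le fun s => ?_
    refine le_iSup_of_le (s.sup w) ((Finset.sum_le_sum fun a ha => ?_).trans
      (ENNReal.sum_le_tsum s))
    rw [if_pos (Finset.le_sup ha)]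
  · refine iSup_le fun N => ENNReal.tsum_le_tsum fun a => ?_
    split_ifs
    · exact le_rfl
    · exact zero_le

variable (ε) in
/-- The zero space. -/
def zero : FormSpace F ε where
  V := PUnit
  b := 0
  s := 1
  X := 0
  b_symm _ _ := by simp
  b_s _ _ := rfl
  b_X _ _ := by simp
  s_X _ := rfl
  s_order := ⟨1, by simp, pow_one 1⟩
  X_nil := IsNilpotent.zero

theorem zero_nondeg : (zero ε).Nondeg := fun _ _ => rfl

theorem Cls.dim_zero : (toCls (zero ε) zero_nondeg).dim = 0 := by
  rw [dim_toCls]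
  exact Module.finrank_zero_of_subsingleton (R := F) (M := PUnit.{u + 1})

theorem Cls.kdim_le (c : Cls ε) : c.kdim ≤ c.dim := by
  obtain ⟨P, hP, rfl⟩ := c.exists_rep
  exact Submodule.finrank_le _

theorem Cls.eq_of_dim_eq_zero {c c' : Cls ε} (h : c.dim = 0) (h' : c'.dim = 0) : c = c' := by
  obtain ⟨P, hP, rfl⟩ := c.exists_rep
  obtain ⟨Q, hQ, rfl⟩ := c'.exists_rep
  rw [dim_toCls] at h h'
  have := Module.finrank_zero_iff.1 h
  have := Module.finrank_zero_iff.1 h'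
  refine toCls_eq.2 (IsHom.iso (f := 0) ⟨fun u v => ?_, fun u => ?_, fun u => ?_⟩ hP
    (h.trans h'.symm))
  · rw [Subsingleton.elim u 0]; simp
  · exact Subsingleton.elim _ _
  · exact Subsingleton.elim _ _

theorem Cls.kdim_pos {c : Cls ε} (h : c.dim ≠ 0) : 0 < c.kdim := by
  obtain ⟨P, hP, rfl⟩ := c.exists_rep
  rw [dim_toCls] at h
  rw [kdim_toCls, Nat.pos_iff_ne_zero]
  intro h0
  apply h
  rw [FormSpace.kdim, Submodule.finrank_eq_zero, LinearMap.ker_eq_bot] at h0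
  obtain ⟨k, hk⟩ := P.X_nil
  rw [Module.finrank_zero_iff]
  refine ⟨fun u v => ?_⟩
  have hinj : Function.Injective (P.X ^ k) := by
    rw [Module.End.coe_pow]
    exact h0.iterate k
  exact hinj (by rw [hk]; rfl)

variable (ε) in
/-- The generating function of all classes. -/
noncomputable def genT (t z : ℝ≥0∞) : ℝ≥0∞ := ∑' c : Cls ε, t ^ c.dim * z ^ c.kdim

variable (ε) in
/-- The part of `genT` coming from dimension at most `N`. -/
noncomputable def genTle (N : ℕ) (t z : ℝ≥0∞) : ℝ≥0∞ :=
  ∑' c : Cls ε, if c.dim ≤ N then t ^ c.dim * z ^ c.kdim else 0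

variable (ε) in
/-- The generating function of classes with `X = 0`. -/
noncomputable def genSS (x : ℝ≥0∞) : ℝ≥0∞ := ∑' c : SSCls ε, x ^ c.1.dim

theorem tsum_mul_tsum {α β : Type*} (f : α → ℝ≥0∞) (g : β → ℝ≥0∞) :
    ∑' p : α × β, f p.1 * g p.2 = (∑' a, f a) * ∑' b, g b := by
  rw [ENNReal.tsum_prod (f := fun a b => f a * g b)]
  simp_rw [ENNReal.tsum_mul_left, ENNReal.tsum_mul_right]

theorem genT_eq (h2 : (2 : F) ≠ 0) (ε : F) (t z : ℝ≥0∞) :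
    genT ε t z = genSS ε (t * z) * genT (-ε) t (t * z) := by
  obtain ⟨e, he⟩ := exists_layer_equiv h2 ε
  rw [genSS, genT, genT, ← tsum_mul_tsum, ← e.tsum_eq]
  refine tsum_congr fun c => ?_
  rw [(he c).1, (he c).2]
  ring

theorem genTle_succ (h2 : (2 : F) ≠ 0) (ε : F) (N : ℕ) (t z : ℝ≥0∞) :
    genTle ε (N + 1) t z ≤ genSS ε (t * z) * genTle (-ε) N t (t * z) := by
  obtain ⟨e, he⟩ := exists_layer_equiv h2 ε
  rw [genSS, genTle, genTle, ← tsum_mul_tsum, ← e.tsum_eq]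
  refine ENNReal.tsum_le_tsum fun c => ?_
  split_ifs with h1 h3
  · rw [(he c).1, (he c).2]
    apply le_of_eq
    ring
  · exfalso
    have h4 := he c
    by_cases h5 : c.dim = 0
    · omega
    · have := Cls.kdim_pos h5
      omega
  · exact zero_le
  · exact zero_le

theorem one_le_genT (t z : ℝ≥0∞) : 1 ≤ genT ε t z := by
  refine le_trans ?_ (ENNReal.le_tsum (toCls (zero ε) zero_nondeg))
  have h1 := Cls.dim_zero (ε := ε)
  have h2 := Cls.kdim_le (toCls (zero ε) zero_nondeg)
  rw [h1] at h2 ⊢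
  rw [Nat.le_zero.1 h2]
  simp

theorem genTle_zero (t z : ℝ≥0∞) : genTle ε 0 t z ≤ 1 := by
  rw [genTle, tsum_eq_single (toCls (zero ε) zero_nondeg)]
  · have h1 := Cls.dim_zero (ε := ε)
    have h2 := Cls.kdim_le (toCls (zero ε) zero_nondeg)
    rw [h1] at h2 ⊢
    rw [Nat.le_zero.1 h2]
    simp
  · intro c hc
    rw [if_neg]
    exact fun h => hc (Cls.eq_of_dim_eq_zero (Nat.le_zero.1 h) Cls.dim_zero)

theorem prod_genSS_le (h2 : (2 : F) ≠ 0) (t : ℝ≥0∞) (N k : ℕ) :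
    ∏ i ∈ Finset.range N, genSS ((-1) ^ i * ε) (t ^ (k + 1 + i)) ≤ genT ε t (t ^ k) := by
  induction N generalizing k ε with
  | zero => simpa using one_le_genT _ _
  | succ N ih =>
    rw [Finset.prod_range_succ', genT_eq h2, mul_comm]
    gcongr
    · simp [pow_succ']
    · rw [← pow_succ']
      refine le_of_eq_of_le (Finset.prod_congr rfl fun i _ => ?_) (ih (ε := -ε) (k + 1))
      rw [show (-1 : F) ^ (i + 1) * ε = (-1) ^ i * -ε by ring,
        show k + 1 + (i + 1) = k + 1 + 1 + i by ring]

theorem genTle_le_prod (h2 : (2 : F) ≠ 0) (t : ℝ≥0∞) (N k : ℕ) :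
    genTle ε N t (t ^ k) ≤ ∏ i ∈ Finset.range N, genSS ((-1) ^ i * ε) (t ^ (k + 1 + i)) := by
  induction N generalizing k ε with
  | zero => simpa using genTle_zero _ _
  | succ N ih =>
    rw [Finset.prod_range_succ', mul_comm]
    refine (genTle_succ h2 ε N t (t ^ k)).trans ?_
    gcongr
    · simp [pow_succ']
    · rw [← pow_succ']
      refine le_of_le_of_eq (ih (ε := -ε) (k + 1)) (Finset.prod_congr rfl fun i _ => ?_)
      rw [show (-1 : F) ^ (i + 1) * ε = (-1) ^ i * -ε by ring,
        show k + 1 + (i + 1) = k + 1 + 1 + i by ring]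

theorem tendsto_prod_genSS (h2 : (2 : F) ≠ 0) (ε : F) (t : ℝ≥0∞) :
    Tendsto (fun N => ∏ i ∈ Finset.range N, genSS ((-1) ^ i * ε) (t ^ (2 + i))) atTop
      (𝓝 (genT ε t t)) := by
  have h1 := tendsto_tsum_truncation (fun c : Cls ε => c.dim) (fun c => t ^ c.dim * t ^ c.kdim)
  refine tendsto_of_tendsto_of_tendsto_of_le_of_le h1 tendsto_const_nhds (fun N => ?_) fun N => ?_
  · simpa [genTle] using genTle_le_prod (ε := ε) h2 t N 1
  · simpa using prod_genSS_le (ε := ε) h2 t N 1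

/-- Number of classes of a given even dimension, normalized. -/
theorem tendsto_count (h2 : (2 : F) ≠ 0) {q : ℕ} (hq : q ≠ 0) {t : ℝ≥0∞} (ht : t ^ 2 = (q : ℝ≥0∞)⁻¹)
    (heven : ∀ c : Cls (-1 : F), Even c.dim)
    (hcount : ∀ j : ℕ, (∑' c : SSCls (-1 : F), if c.1.dim = 2 * j then (1 : ℝ≥0∞) else 0) = q ^ j) :
    Tendsto (fun n : ℕ => (∑' c : Cls (-1 : F), if c.dim = 2 * n then (1 : ℝ≥0∞) else 0) / q ^ n)
      atTop (𝓝 (genT (1 : F) t t)) := by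
  have h1 := (tendsto_tsum_truncation (fun c : Cls (1 : F) => c.dim + c.kdim)
    (fun c => t ^ c.dim * t ^ c.kdim)).comp
    (tendsto_id.const_mul_atTop' (show 0 < 2 by norm_num))
  refine h1.congr fun n => ?_
  have hlayer := exists_layer_equiv h2 (-1 : F)
  rw [neg_neg] at hlayer
  obtain ⟨e, he⟩ := hlayer
  have hw : ∀ U : Cls (1 : F), Even (U.dim + U.kdim) := by
    intro U
    have h0 := Cls.dim_zero (ε := (-1 : F))
    have h3 := Cls.kdim_le (toCls (zero (-1 : F)) zero_nondeg)
    let c := e.symm (⟨toCls (zero (-1 : F)) zero_nondeg, by omega⟩, U)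
    have h4 := (he c).1
    rw [e.apply_symm_apply] at h4
    have h5 := heven c
    rw [h4] at h5
    simpa [h0] using h5
  have hq0 : (q : ℝ≥0∞) ≠ 0 := by exact_mod_cast hq
  have hqt : (q : ℝ≥0∞) ≠ ⊤ := ENNReal.natCast_ne_top q
  rw [← e.symm.tsum_eq, div_eq_mul_inv, ENNReal.tsum_prod', ENNReal.tsum_comm,
    ← ENNReal.tsum_mul_right]
  refine tsum_congr fun U => ?_
  have hdim : ∀ L, (e.symm (L, U)).dim = L.1.dim + (U.dim + U.kdim) := fun L => by
    rw [(he _).1, e.apply_symm_apply, add_assoc]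
  simp only [hdim, id_eq]
  obtain ⟨m, hm⟩ := hw U
  rw [← pow_add, hm, ← two_mul, pow_mul, ht]
  by_cases h : m ≤ n
  · rw [if_pos (by omega)]
    obtain ⟨d, rfl⟩ := Nat.exists_eq_add_of_le h
    have h6 : ∀ L : SSCls (-1 : F), (L.1.dim + 2 * m = 2 * (m + d)) = (L.1.dim = 2 * d) :=
      fun L => propext (by omega)
    simp only [h6]
    rw [hcount d, pow_add, ENNReal.mul_inv (Or.inl (pow_ne_zero _ hq0))
      (Or.inr (pow_ne_zero _ hq0)),
      mul_left_comm, ENNReal.mul_inv_cancel (pow_ne_zero _ hq0) (ENNReal.pow_ne_top hqt), mul_one,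
      ENNReal.inv_pow]
  · rw [if_neg (by omega)]
    have h6 : ∀ L : SSCls (-1 : F), (L.1.dim + 2 * m = 2 * n) = False :=
      fun L => eq_false (by omega)
    simp [h6]

end FormSpace

end

/-! ### The limit -/

section

open scoped ENNReal
open Filter Topology

namespace FormSpace

variable {F : Type u} [Field F]

theorem genSS_neg_one {q : ℕ} (heven : ∀ c : Cls (-1 : F), Even c.dim)
    (hcount : ∀ j : ℕ, (∑' c : SSCls (-1 : F), if c.1.dim = 2 * j then (1 : ℝ≥0∞) else 0) = q ^ j)
    (x : ℝ≥0∞) : genSS (-1 : F) x = (1 - q * x ^ 2)⁻¹ := by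
  rw [← ENNReal.tsum_geometric]
  have h1 : ∀ c : SSCls (-1 : F), x ^ c.1.dim =
      ∑' j : ℕ, x ^ (2 * j) * if c.1.dim = 2 * j then (1 : ℝ≥0∞) else 0 := by
    intro c
    obtain ⟨m, hm⟩ := heven c.1
    rw [tsum_eq_single m]
    · rw [if_pos (by omega), mul_one, hm, two_mul]
    · intro j hj
      rw [if_neg (by omega), mul_zero]
  rw [genSS]
  simp_rw [h1]
  rw [ENNReal.tsum_comm]
  refine tsum_congr fun j => ?_
  rw [ENNReal.tsum_mul_left, hcount, mul_pow, ← pow_mul, mul_comm]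

theorem tendsto_partial_products {q : ℕ} (hq : 2 ≤ q) :
    Tendsto (fun N : ℕ => (∏ i ∈ Finset.range N, (1 + ((q : ℝ) ^ (i + 1))⁻¹) ^ 4) *
      ∏ i ∈ Finset.range (2 * N), (1 - ((q : ℝ) ^ (i + 1))⁻¹)⁻¹) atTop
      (𝓝 (∏' i : ℕ, (1 + ((q : ℝ) ^ (i + 1))⁻¹) ^ 4 / (1 - ((q : ℝ) ^ (i + 1))⁻¹))) := by
  have hq' : (2 : ℝ) ≤ q := by exact_mod_cast hq
  have hx0 : ∀ i : ℕ, 0 < ((q : ℝ) ^ (i + 1))⁻¹ := fun i => by positivity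
  have hx2 : ∀ i : ℕ, ((q : ℝ) ^ (i + 1))⁻¹ ≤ 1 / 2 := fun i => by
    rw [one_div]
    apply inv_anti₀ (by norm_num)
    calc (2 : ℝ) ≤ q := hq'
      _ = q ^ 1 := (pow_one _).symm
      _ ≤ q ^ (i + 1) := pow_le_pow_right₀ (by linarith) (by omega)
  have hs : Summable fun i : ℕ => ((q : ℝ) ^ (i + 1))⁻¹ := by
    have : Summable fun i : ℕ => ((q : ℝ)⁻¹) ^ i :=
      summable_geometric_of_lt_one (by positivity) (inv_lt_one_of_one_lt₀ (by linarith))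
    simpa [inv_pow] using (summable_nat_add_iff 1).2 this
  have ha : Multipliable fun i : ℕ => (1 + ((q : ℝ) ^ (i + 1))⁻¹) ^ 4 := by
    have h0 : Multipliable fun i : ℕ => (1 + ((q : ℝ) ^ (i + 1))⁻¹) :=
      multipliable_one_add_of_summable hs.norm
    have h1 := ((h0.mul h0).mul (h0.mul h0))
    refine h1.congr fun i => ?_
    ring
  have hb : Multipliable fun i : ℕ => (1 - ((q : ℝ) ^ (i + 1))⁻¹)⁻¹ := by
    have h1 : Multipliable fun i : ℕ => 1 + ((1 - ((q : ℝ) ^ (i + 1))⁻¹)⁻¹ - 1) := by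
      refine multipliable_one_add_of_summable (Summable.of_nonneg_of_le (fun i => norm_nonneg _)
        (fun i => ?_) (hs.mul_left 2))
      have h3 := hx0 i
      have h4 := hx2 i
      set x := ((q : ℝ) ^ (i + 1))⁻¹
      have h5 : (1 - x)⁻¹ - 1 = x / (1 - x) := by
        have : 1 - x ≠ 0 := by linarith
        field_simp
        ring
      rw [h5, Real.norm_of_nonneg (div_nonneg h3.le (by linarith)), div_le_iff₀ (by linarith)]
      nlinarith
    simpa using h1
  have h := (ha.tendsto_prod_tprod_nat).mul
    (hb.tendsto_prod_tprod_nat.comp (tendsto_id.const_mul_atTop' (show 0 < 2 by norm_num)))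
  rw [← ha.tprod_mul hb] at h
  simpa only [div_eq_mul_inv, Function.comp_def, id_eq] using h

theorem tendsto_main {q : ℕ} (hq : 2 ≤ q) (h2 : (2 : F) ≠ 0) {k : ℕ → ℕ}
    (hk : ∀ n, (k n : ℝ≥0∞) = ∑' c : Cls (-1 : F), if c.dim = 2 * n then (1 : ℝ≥0∞) else 0)
    (heven : ∀ c : Cls (-1 : F), Even c.dim)
    (hcount : ∀ j : ℕ, (∑' c : SSCls (-1 : F), if c.1.dim = 2 * j then (1 : ℝ≥0∞) else 0) = q ^ j)
    (hpos : ∀ x, genSS (1 : F) x = (1 + x) ^ 4 * genSS (-1 : F) x) :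
    Tendsto (fun n : ℕ => (k n : ℝ) / (q : ℝ) ^ n) atTop
      (𝓝 (∏' i : ℕ, (1 + ((q : ℝ) ^ (i + 1))⁻¹) ^ 4 / (1 - ((q : ℝ) ^ (i + 1))⁻¹))) := by
  have hq0 : (0 : ℝ) < q := by exact_mod_cast (by omega : 0 < q)
  set A := ∏' i : ℕ, (1 + ((q : ℝ) ^ (i + 1))⁻¹) ^ 4 / (1 - ((q : ℝ) ^ (i + 1))⁻¹) with hA
  let t : ℝ≥0∞ := ENNReal.ofReal (√((q : ℝ)⁻¹))
  have ht' : t ^ 2 = ENNReal.ofReal (q : ℝ)⁻¹ := by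
    rw [← ENNReal.ofReal_pow (Real.sqrt_nonneg _), Real.sq_sqrt (by positivity)]
  have ht : t ^ 2 = (q : ℝ≥0∞)⁻¹ := by
    rw [ht', ENNReal.ofReal_inv_of_pos hq0, ENNReal.ofReal_natCast]
  have hpow : ∀ i : ℕ, t ^ (2 * i) = ENNReal.ofReal ((q : ℝ) ^ i)⁻¹ := fun i => by
    rw [pow_mul, ht', ← ENNReal.ofReal_pow (by positivity), inv_pow]
  have hlt : ∀ i : ℕ, ((q : ℝ) ^ (i + 1))⁻¹ < 1 := fun i =>
    inv_lt_one_of_one_lt₀ (one_lt_pow₀ (by exact_mod_cast hq) (by omega))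
  have hsk : ∀ i : ℕ, genSS (-1 : F) (t ^ (2 + i)) =
      ENNReal.ofReal (1 - ((q : ℝ) ^ (i + 1))⁻¹)⁻¹ := fun i => by
    rw [genSS_neg_one heven hcount, ← pow_mul, mul_comm (2 + i), hpow,
      ENNReal.ofReal_inv_of_pos (show 0 < 1 - ((q : ℝ) ^ (i + 1))⁻¹ by linarith [hlt i]),
      ENNReal.ofReal_sub _ (by positivity),
      ENNReal.ofReal_one, ← ENNReal.ofReal_natCast, ← ENNReal.ofReal_mul (by positivity)]
    congr 3
    field_simp
    ring
  have hprod : ∀ N : ℕ, ∏ i ∈ Finset.range (2 * N), genSS ((-1) ^ i * (1 : F)) (t ^ (2 + i)) =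
      ENNReal.ofReal ((∏ i ∈ Finset.range N, (1 + ((q : ℝ) ^ (i + 1))⁻¹) ^ 4) *
      ∏ i ∈ Finset.range (2 * N), (1 - ((q : ℝ) ^ (i + 1))⁻¹)⁻¹) := by
    intro N
    have hnn : ∀ i : ℕ, 0 ≤ (1 - ((q : ℝ) ^ (i + 1))⁻¹)⁻¹ :=
      fun i => inv_nonneg.2 (by linarith [hlt i])
    induction N with
    | zero => simp
    | succ N ih =>
      rw [show 2 * (N + 1) = 2 * N + 1 + 1 by ring, Finset.prod_range_succ, Finset.prod_range_succ,
        ih, Finset.prod_range_succ, Finset.prod_range_succ, Finset.prod_range_succ]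
      have e1 : (-1 : F) ^ (2 * N) * 1 = 1 := by rw [pow_mul]; simp
      have e2 : (-1 : F) ^ (2 * N + 1) * 1 = -1 := by rw [pow_succ, pow_mul]; simp
      have e3 : (1 + t ^ (2 + 2 * N)) ^ 4 = ENNReal.ofReal ((1 + ((q : ℝ) ^ (N + 1))⁻¹) ^ 4) := by
        rw [show 2 + 2 * N = 2 * (N + 1) by ring, hpow, ENNReal.ofReal_pow (by positivity),
          ENNReal.ofReal_add (by positivity) (by positivity), ENNReal.ofReal_one]
      rw [e1, e2, hpos, hsk, hsk, e3, ← ENNReal.ofReal_mul (by positivity),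
        ← ENNReal.ofReal_mul, ← ENNReal.ofReal_mul]
      · congr 1
        ring
      · exact mul_nonneg (mul_nonneg (Finset.prod_nonneg fun i _ => by positivity)
          (Finset.prod_nonneg fun i _ => hnn i)) (mul_nonneg (by positivity) (hnn _))
      · exact mul_nonneg (Finset.prod_nonneg fun i _ => by positivity)
          (Finset.prod_nonneg fun i _ => hnn i)
  have hT : genT (1 : F) t t = ENNReal.ofReal A := by
    refine tendsto_nhds_unique ((tendsto_prod_genSS h2 (1 : F) t).comp
      (tendsto_id.const_mul_atTop' (show 0 < 2 by norm_num)))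
      ((ENNReal.tendsto_ofReal (tendsto_partial_products hq)).congr fun N => ?_)
    exact (hprod N).symm
  have hlim := tendsto_count h2 (by omega) ht heven hcount
  rw [hT] at hlim
  have hA0 : 0 ≤ A := by
    refine ge_of_tendsto' (tendsto_partial_products hq) fun N => ?_
    exact mul_nonneg (Finset.prod_nonneg fun i _ => by positivity)
      (Finset.prod_nonneg fun i _ => inv_nonneg.2 (by linarith [hlt i]))
  have := (ENNReal.tendsto_toReal ENNReal.ofReal_ne_top).comp hlim
  rw [ENNReal.toReal_ofReal hA0] at this
  refine this.congr fun n => ?_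
  rw [Function.comp_apply, ← hk, ENNReal.toReal_div, ENNReal.toReal_pow, ENNReal.toReal_natCast,
    ENNReal.toReal_natCast]

end FormSpace

end

/-! ### Splitting off eigenspaces -/

section

theorem exists_equiv_of_rel {A B α β : Type*} {f : A → α} {g : B → β}
    (hf : Function.Surjective f) (hg : Function.Surjective g) {R : A → B → Prop}
    (h1 : ∀ a, ∃ b, R a b) (h2 : ∀ b, ∃ a, R a b)
    (h : ∀ a b a' b', R a b → R a' b' → (f a = f a' ↔ g b = g b')) :
    ∃ e : α ≃ β, ∀ a b, R a b → e (f a) = g b := by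
  choose i hi using hf
  choose j hj using h1
  have key : ∀ a b, R a b → g (j (i (f a))) = g b := fun a b hab =>
    (h _ _ _ _ (hj _) hab).1 (hi _)
  refine ⟨Equiv.ofBijective (fun x => g (j (i x))) ⟨fun x y hxy => ?_, fun z => ?_⟩, key⟩
  · rw [← hi x, ← hi y]
    exact (h _ _ _ _ (hj _) (hj _)).2 hxy
  · obtain ⟨b, rfl⟩ := hg z
    obtain ⟨a, ha⟩ := h2 b
    exact ⟨f a, key a b ha⟩

namespace FormSpace

open scoped ENNReal

variable {F : Type u} [Field F] {ε : F}

/-- Nondegenerate form spaces with a given property. -/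
abbrev NondegOf (p : FormSpace F ε → Prop) := {P : FormSpace F ε // P.Nondeg ∧ p P}

/-- Isometry classes of nondegenerate form spaces with a given property. -/
abbrev ClsOf (p : FormSpace F ε → Prop) := {c : Cls ε // ∃ P hP, p P ∧ toCls P hP = c}

/-- The class of a nondegenerate form space with a given property. -/
def NondegOf.cls {p : FormSpace F ε → Prop} (P : NondegOf p) : ClsOf p :=
  ⟨toCls P.1 P.2.1, P.1, P.2.1, P.2.2, rfl⟩

theorem NondegOf.cls_surjective {p : FormSpace F ε → Prop} :
    Function.Surjective (NondegOf.cls (p := p)) := by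
  rintro ⟨c, P, hP, hp, rfl⟩
  exact ⟨⟨P, hP, hp⟩, rfl⟩

theorem NondegOf.cls_eq {p : FormSpace F ε → Prop} {P Q : NondegOf p} :
    P.cls = Q.cls ↔ Iso P.1 Q.1 := Subtype.ext_iff.trans toCls_eq

theorem NondegOf.dim_cls {p : FormSpace F ε → Prop} (P : NondegOf p) :
    P.cls.1.dim = Module.finrank F P.1.V := rfl

/-- The generating function of isometry classes with a given property, by dimension. -/
noncomputable def gen (p : FormSpace F ε → Prop) (x : ℝ≥0∞) : ℝ≥0∞ :=
  ∑' c : ClsOf p, x ^ c.1.dim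

theorem gen_congr {ε' : F} {p : FormSpace F ε → Prop} {p' : FormSpace F ε' → Prop}
    (R : NondegOf p → NondegOf p' → Prop) (h1 : ∀ P, ∃ Q, R P Q) (h2 : ∀ Q, ∃ P, R P Q)
    (h : ∀ P Q P' Q', R P Q → R P' Q' → (Iso P.1 P'.1 ↔ Iso Q.1 Q'.1))
    (hd : ∀ P Q, R P Q → Module.finrank F P.1.V = Module.finrank F Q.1.V) (x : ℝ≥0∞) :
    gen p x = gen p' x := by
  obtain ⟨e, he⟩ := exists_equiv_of_rel NondegOf.cls_surjective NondegOf.cls_surjective h1 h2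
    (fun a b a' b' hab hab' => by rw [NondegOf.cls_eq, NondegOf.cls_eq]; exact h a b a' b' hab hab')
  rw [gen, gen, ← e.tsum_eq]
  refine tsum_congr fun c => ?_
  obtain ⟨P, rfl⟩ := NondegOf.cls_surjective c
  obtain ⟨Q, hQ⟩ := h1 P
  rw [he P Q hQ, NondegOf.dim_cls, NondegOf.dim_cls, hd P Q hQ]

theorem gen_mul {p p₁ p₂ : FormSpace F ε → Prop}
    (h1 : ∀ P, P.Nondeg → p P → ∃ P₁ P₂ : FormSpace F ε, P₁.Nondeg ∧ p₁ P₁ ∧ P₂.Nondeg ∧ p₂ P₂ ∧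
      Iso (P₁.sum P₂) P)
    (h2 : ∀ P₁ P₂, p₁ P₁ → p₂ P₂ → p (P₁.sum P₂))
    (h3 : ∀ P₁ P₂ Q₁ Q₂, p₁ P₁ → p₂ P₂ → p₁ Q₁ → p₂ Q₂ → Iso (P₁.sum P₂) (Q₁.sum Q₂) →
      Iso P₁ Q₁ ∧ Iso P₂ Q₂) (x : ℝ≥0∞) :
    gen p x = gen p₁ x * gen p₂ x := by
  obtain ⟨e, he⟩ := exists_equiv_of_rel (f := NondegOf.cls (p := p))
    (g := Prod.map (NondegOf.cls (p := p₁)) (NondegOf.cls (p := p₂)))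
    (R := fun P Q => Iso (Q.1.1.sum Q.2.1) P.1)
    NondegOf.cls_surjective (NondegOf.cls_surjective.prodMap NondegOf.cls_surjective)
    (fun P => by
      obtain ⟨P₁, P₂, h₁, h₁', h₂, h₂', h⟩ := h1 P.1 P.2.1 P.2.2
      exact ⟨(⟨P₁, h₁, h₁'⟩, ⟨P₂, h₂, h₂'⟩), h⟩)
    (fun Q => ⟨⟨Q.1.1.sum Q.2.1, Q.1.2.1.sum Q.2.2.1, h2 _ _ Q.1.2.2 Q.2.2.2⟩, Iso.refl _⟩)
    (fun P Q P' Q' h h' => by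
      rw [Prod.ext_iff, Prod.map_fst, Prod.map_snd, Prod.map_fst, Prod.map_snd, NondegOf.cls_eq,
        NondegOf.cls_eq, NondegOf.cls_eq]
      refine ⟨fun hi => ?_, fun hi => ?_⟩
      · exact h3 _ _ _ _ Q.1.2.2 Q.2.2.2 Q'.1.2.2 Q'.2.2.2 ((h.trans hi).trans h'.symm)
      · exact (h.symm.trans (hi.1.sum hi.2)).trans h')
  rw [gen, gen, gen, ← tsum_mul_tsum, ← e.tsum_eq]
  refine tsum_congr fun c => ?_
  obtain ⟨P, rfl⟩ := NondegOf.cls_surjective c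
  obtain ⟨P₁, P₂, h₁, h₁', h₂, h₂', h⟩ := h1 P.1 P.2.1 P.2.2
  rw [he P (⟨P₁, h₁, h₁'⟩, ⟨P₂, h₂, h₂'⟩) h, ← pow_add, NondegOf.dim_cls, ← h.finrank_eq]
  exact congrArg (x ^ ·) (Module.finrank_prod (R := F) (M := P₁.V) (M' := P₂.V))

theorem genSS_eq (x : ℝ≥0∞) : genSS ε x = gen (fun P : FormSpace F ε => P.X = 0) x := by
  have h : ∀ c : Cls ε, c.kdim = c.dim ↔
      ∃ P hP, P.X = 0 ∧ toCls P hP = c := by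
    intro c
    constructor
    · obtain ⟨P, hP, rfl⟩ := c.exists_rep
      exact fun h => ⟨P, hP, P.kdim_eq_finrank_iff.1 h, rfl⟩
    · rintro ⟨P, hP, h, rfl⟩
      exact P.kdim_eq_finrank_iff.2 h
  rw [genSS, gen, ← (Equiv.subtypeEquivRight h).tsum_eq]
  rfl

/-- `X = 0` and `s` is the scalar `a`. -/
def IsScalar (a : F) (P : FormSpace F ε) : Prop := P.X = 0 ∧ ∀ u, P.s u = a • u

/-- `X = 0` and no element of `T` is an eigenvalue of `s`. -/
def Avoids (T : Set F) (P : FormSpace F ε) : Prop :=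
  P.X = 0 ∧ ∀ a ∈ T, ∀ u, P.s u = a • u → u = 0

theorem exists_split {a : F} (ha : a * a = 1) {T : Set F} {P : FormSpace F ε} (hP : P.Nondeg)
    (h : P.Avoids T) : ∃ P₁ P₂ : FormSpace F ε, P₁.Nondeg ∧ P₁.IsScalar a ∧ P₂.Nondeg ∧
      P₂.Avoids (insert a T) ∧ Iso (P₁.sum P₂) P := by
  let K := LinearMap.ker (P.s - a • 1)
  have hK : ∀ u, u ∈ K ↔ P.s u = a • u := fun u => by
    simp [K, sub_eq_zero]
  have hKs : ∀ u ∈ K, P.s u ∈ K := fun u hu => by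
    rw [(hK u).1 hu]
    exact K.smul_mem _ hu
  have hX : ∀ (W : Submodule F P.V), ∀ u ∈ W, P.X u ∈ W := fun W u hu => by simp [h.1]
  obtain ⟨C, hC, hc⟩ := exists_complement P.s_semisimple K hKs
  have hCK : ∀ u ∈ C, ∃ v, P.s v - a • v = u := by
    let g : Module.End F C := P.s.restrict hC - a • 1
    have hg : Function.Injective g := by
      rw [injective_iff_map_eq_zero]
      intro u hu
      have : (u : P.V) ∈ K := by
        rw [hK, ← sub_eq_zero]
        exact congrArg Subtype.val hu
      exact Subtype.ext (Submodule.disjoint_def.1 hc.disjoint _ this u.2)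
    intro u hu
    obtain ⟨v, hv⟩ := LinearMap.surjective_of_injective hg ⟨u, hu⟩
    exact ⟨v, congrArg Subtype.val hv⟩
  have horth : ∀ u ∈ K, ∀ v ∈ C, P.b u v = 0 := by
    intro u hu v hv
    obtain ⟨w, rfl⟩ := hCK v hv
    have h1 := P.b_s u w
    rw [(hK u).1 hu, map_smul, LinearMap.smul_apply, smul_eq_mul] at h1
    rw [map_sub, map_smul, smul_eq_mul, ← h1, ← mul_assoc, ha, one_mul, sub_self]
  let A := P.restrict K hKs (hX K)
  have hA : A.Nondeg := by
    intro u hu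
    refine Subtype.ext (hP _ fun v => ?_)
    obtain ⟨k, hk, c, hc, rfl⟩ := Submodule.mem_sup.1
      (show v ∈ K ⊔ C by rw [hc.sup_eq_top]; trivial)
    rw [map_add, horth _ u.2 _ hc, add_zero]
    exact hu ⟨k, hk⟩
  have hi : IsHom (P := A) (Q := P) K.subtype := ⟨fun _ _ => rfl, fun _ => rfl, fun _ => rfl⟩
  obtain ⟨W, hs, hX', hW, hn, hiso⟩ := exists_iso_sum hi hA hP
  refine ⟨A, P.restrict W hs hX', hA, ⟨?_, fun u => Subtype.ext ((hK _).1 u.2)⟩, hn, ⟨?_, ?_⟩, hiso⟩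
  · ext u
    simp [A, h.1]
  · ext u
    simp [h.1]
  · rintro c hc ⟨u, hu⟩ hsu
    have hsu : P.s u = c • u := congrArg Subtype.val hsu
    rcases hc with rfl | hc
    · have h0 : (⟨u, (hK u).2 hsu⟩ : K) = 0 := hA _ fun v => (hW u).1 hu v
      exact Subtype.ext (congrArg (fun w : K => (w : P.V)) h0)
    · exact Subtype.ext (h.2 c hc u hsu)

theorem split_unique {a : F} {T : Set F} {P₁ P₂ Q₁ Q₂ : FormSpace F ε} (hP₁ : P₁.IsScalar a)
    (hP₂ : P₂.Avoids (insert a T)) (hQ₁ : Q₁.IsScalar a) (hQ₂ : Q₂.Avoids (insert a T))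
    (f : (P₁.V × P₂.V) ≃ₗ[F] (Q₁.V × Q₂.V))
    (hf : ∀ u, f ((P₁.sum P₂).s u) = (Q₁.sum Q₂).s (f u)) :
    ∃ (f₁ : P₁.V ≃ₗ[F] Q₁.V) (f₂ : P₂.V ≃ₗ[F] Q₂.V), ∀ u v, f (u, v) = (f₁ u, f₂ v) := by
  have key : ∀ {P₁ P₂ Q₁ Q₂ : FormSpace F ε}, P₁.IsScalar a → P₂.Avoids (insert a T) →
      Q₁.IsScalar a → Q₂.Avoids (insert a T) → ∀ f : (P₁.V × P₂.V) ≃ₗ[F] (Q₁.V × Q₂.V),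
      (∀ u, f ((P₁.sum P₂).s u) = (Q₁.sum Q₂).s (f u)) →
      (∀ u, (f (u, 0)).2 = 0) ∧ ∀ v, (f (0, v)).1 = 0 := by
    intro P₁ P₂ Q₁ Q₂ hP₁ hP₂ hQ₁ hQ₂ f hf
    constructor
    · intro u
      refine hQ₂.2 a (Set.mem_insert _ _) _ ?_
      have h1 := hf (u, 0)
      rw [sum_s, sum_s] at h1
      simp only [map_zero, hP₁.2] at h1
      rw [show ((a • u, 0) : P₁.V × P₂.V) = a • (u, 0) by simp, map_smul] at h1
      exact (congrArg Prod.snd h1).symm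
    · intro v
      have hinj : Function.Injective (P₂.s - a • 1 : Module.End F P₂.V) := by
        rw [injective_iff_map_eq_zero]
        intro u hu
        exact hP₂.2 a (Set.mem_insert _ _) u (sub_eq_zero.1 hu)
      obtain ⟨w, rfl⟩ := LinearMap.surjective_of_injective hinj v
      have h1 := hf (0, w)
      rw [sum_s, sum_s] at h1
      simp only [map_zero, hQ₁.2] at h1
      rw [show ((0, (P₂.s - a • 1) w) : P₁.V × P₂.V) = (0, P₂.s w) - a • (0, w) by simp,
        map_sub, map_smul, h1]
      simp
  have hf' : ∀ u, f.symm ((Q₁.sum Q₂).s u) = (P₁.sum P₂).s (f.symm u) := by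
    intro u
    rw [LinearEquiv.symm_apply_eq, hf, LinearEquiv.apply_symm_apply]
  obtain ⟨h1, h2⟩ := key hP₁ hP₂ hQ₁ hQ₂ f hf
  obtain ⟨h3, h4⟩ := key hQ₁ hQ₂ hP₁ hP₂ f.symm hf'
  have h1' : ∀ u, f (u, 0) = ((f (u, 0)).1, 0) := fun u => Prod.ext rfl (h1 u)
  have h2' : ∀ u, f (0, u) = (0, (f (0, u)).2) := fun u => Prod.ext (h2 u) rfl
  have h3' : ∀ u, f.symm (u, 0) = ((f.symm (u, 0)).1, 0) := fun u => Prod.ext rfl (h3 u)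
  have h4' : ∀ u, f.symm (0, u) = (0, (f.symm (0, u)).2) := fun u => Prod.ext (h4 u) rfl
  refine ⟨LinearEquiv.ofLinearMap
      (LinearMap.fst F _ _ ∘ₗ f.toLinearMap ∘ₗ LinearMap.inl F _ _)
      (LinearMap.fst F _ _ ∘ₗ f.symm.toLinearMap ∘ₗ LinearMap.inl F _ _) ?_ ?_,
    LinearEquiv.ofLinearMap
      (LinearMap.snd F _ _ ∘ₗ f.toLinearMap ∘ₗ LinearMap.inr F _ _)
      (LinearMap.snd F _ _ ∘ₗ f.symm.toLinearMap ∘ₗ LinearMap.inr F _ _) ?_ ?_, fun u v => ?_⟩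
  · ext u
    simp [← h3']
  · ext u
    simp [← h1']
  · ext u
    simp [← h4']
  · ext u
    simp [← h2']
  · change f (u, v) = ((f (u, 0)).1, (f (0, v)).2)
    rw [show (u, v) = ((u, 0) + (0, v) : P₁.V × P₂.V) by simp, map_add]
    ext <;> simp [h1, h2]

theorem gen_avoids {a : F} (ha : a * a = 1) {T : Set F} (haT : a ∉ T) (x : ℝ≥0∞) :
    gen (Avoids (ε := ε) T) x = gen (IsScalar (ε := ε) a) x *
      gen (Avoids (ε := ε) (insert a T)) x := by
  refine gen_mul (fun P hP h => exists_split ha hP h) ?_ ?_ x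
  · intro P₁ P₂ h₁ h₂
    refine ⟨?_, fun c hc u hu => ?_⟩
    · change P₁.X.prodMap P₂.X = 0
      rw [h₁.1, h₂.1]
      exact LinearMap.prodMap_zero
    · have e1 : P₁.s u.1 = c • u.1 := congrArg Prod.fst hu
      have e2 : P₂.s u.2 = c • u.2 := congrArg Prod.snd hu
      refine Prod.ext ?_ (h₂.2 c (Set.mem_insert_of_mem _ hc) _ e2)
      rw [h₁.2, ← sub_eq_zero, ← sub_smul, smul_eq_zero, sub_eq_zero] at e1
      exact e1.resolve_left fun h => haT (h ▸ hc)
  · rintro P₁ P₂ Q₁ Q₂ hP₁ hP₂ hQ₁ hQ₂ ⟨f, hf⟩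
    obtain ⟨f₁, f₂, h⟩ := split_unique hP₁ hP₂ hQ₁ hQ₂ f hf.s
    have hb := hf.b
    have hs := hf.s
    refine ⟨⟨f₁, fun u v => ?_, fun u => ?_, fun u => ?_⟩,
      ⟨f₂, fun u v => ?_, fun u => ?_, fun u => ?_⟩⟩
    · have : (Q₁.sum Q₂).b (f (u, 0)) (f (v, 0)) = (P₁.sum P₂).b (u, 0) (v, 0) := hb _ _
      rw [h, h, sum_b, sum_b] at this
      simpa using this
    · simp [hP₁.2, hQ₁.2]
    · simp [hP₁.1, hQ₁.1]
    · have : (Q₁.sum Q₂).b (f (0, u)) (f (0, v)) = (P₁.sum P₂).b (0, u) (0, v) := hb _ _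
      rw [h, h, sum_b, sum_b] at this
      simpa using this
    · have : f ((P₁.sum P₂).s (0, u)) = (Q₁.sum Q₂).s (f (0, u)) := hs _
      rw [sum_s, h, h, sum_s] at this
      exact congrArg Prod.snd this
    · simp [hP₂.1, hQ₂.1]

theorem genSS_split (h2 : (2 : F) ≠ 0) (x : ℝ≥0∞) : genSS ε x = gen (IsScalar (ε := ε) 1) x *
    (gen (IsScalar (ε := ε) (-1)) x * gen (Avoids (ε := ε) {-1, 1}) x) := by
  have h : (-1 : F) ∉ ({1} : Set F) := by
    rw [Set.mem_singleton_iff]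
    intro h
    apply h2
    linear_combination -h
  rw [genSS_eq, ← gen_avoids (by ring) h, ← insert_empty_eq, ← gen_avoids (by ring) (by simp)]
  congr 1
  ext P
  simp [Avoids]

end FormSpace

end

/-! ### Changing the sign of the form -/

section

namespace FormSpace

open scoped ENNReal

variable {F : Type u} [Field F] {ε : F}

theorem gen_of_family {p : FormSpace F ε → Prop} {I : Type*} (A : I → FormSpace F ε)
    (hn : ∀ i, (A i).Nondeg) (hp : ∀ i, p (A i)) (h1 : ∀ P, P.Nondeg → p P → ∃ i, Iso (A i) P)
    (h2 : ∀ i j, Iso (A i) (A j) → i = j) (x : ℝ≥0∞) :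
    gen p x = ∑' i, x ^ Module.finrank F (A i).V := by
  let e : I ≃ ClsOf p := Equiv.ofBijective (fun i => NondegOf.cls ⟨A i, hn i, hp i⟩)
    ⟨fun i j h => h2 i j (NondegOf.cls_eq.1 h), fun c => by
      obtain ⟨P, rfl⟩ := NondegOf.cls_surjective c
      obtain ⟨i, hi⟩ := h1 P.1 P.2.1 P.2.2
      exact ⟨i, NondegOf.cls_eq.2 hi⟩⟩
  rw [gen, ← e.tsum_eq]
  rfl

/-- Replacing `s` by `-s`. -/
@[reducible]
def negS (P : FormSpace F ε) : FormSpace F ε where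
  V := P.V
  b := P.b
  s := -P.s
  X := P.X
  b_symm := P.b_symm
  b_s := by simp [P.b_s]
  b_X := P.b_X
  s_X := by simp [P.s_X]
  s_order := by
    obtain ⟨m, hm, h⟩ := P.s_order
    by_cases h2 : (2 : F) = 0
    · refine ⟨m, hm, ?_⟩
      have : -P.s = P.s := by
        ext u
        rw [LinearMap.neg_apply, ← sub_eq_zero, ← neg_add', neg_eq_zero, ← two_smul F,
          h2, zero_smul]
      rw [this, h]
    · refine ⟨2 * m, by simp [h2, hm], ?_⟩
      rw [pow_mul, neg_sq, ← pow_mul, mul_comm, pow_mul, h, one_pow]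
  X_nil := P.X_nil

theorem gen_isScalar_neg (a : F) (x : ℝ≥0∞) :
    gen (IsScalar (ε := ε) (-a)) x = gen (IsScalar (ε := ε) a) x := by
  refine gen_congr (fun P Q => Iso P.1.negS Q.1) ?_ ?_ ?_ ?_ x
  · intro P
    exact ⟨⟨P.1.negS, P.2.1, P.2.2.1, fun u => by simp [P.2.2.2]⟩, Iso.refl _⟩
  · intro P
    exact ⟨⟨P.1.negS, P.2.1, P.2.2.1, fun u => by simp [P.2.2.2]⟩,
      LinearEquiv.refl F _, fun _ _ => rfl, fun u => by simp, fun _ => rfl⟩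
  · intro P Q P' Q' h h'
    constructor
    · rintro ⟨f, hf⟩
      have hi : Iso P.1.negS P'.1.negS := ⟨f, hf.b, fun u => by simpa using hf.s u, hf.X⟩
      exact (h.symm.trans hi).trans h'
    · intro hi
      obtain ⟨f, hf⟩ := (h.trans hi).trans h'.symm
      exact ⟨f, hf.b, fun u => by simpa using hf.s u, hf.X⟩
  · intro P Q h
    exact h.finrank_eq

theorem Avoids.sq_bijective {P : FormSpace F ε} (h : P.Avoids {-1, 1}) :
    Function.Bijective (P.s * P.s - 1 : Module.End F P.V) := by
  have hi : Function.Injective (P.s * P.s - 1 : Module.End F P.V) := by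
    rw [injective_iff_map_eq_zero]
    intro u hu
    have hu : P.s (P.s u) = u := sub_eq_zero.1 hu
    have h1 := h.2 1 (by simp) (P.s u + u) (by rw [map_add, hu, one_smul, add_comm])
    exact h.2 (-1) (by simp) u (by rw [neg_one_smul]; exact eq_neg_of_add_eq_zero_left h1)
  exact ⟨hi, LinearMap.surjective_of_injective hi⟩

/-- The form `b (s u) v - b u (s v)`, which has the opposite symmetry. -/
@[reducible]
def twist (P : FormSpace F ε) : FormSpace F (-ε) where
  V := P.V
  b := P.b.compl₁₂ P.s LinearMap.id - P.b.compl₁₂ LinearMap.id P.s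
  s := P.s
  X := P.X
  b_symm u v := by
    simp only [LinearMap.sub_apply, LinearMap.compl₁₂_apply, LinearMap.id_apply]
    rw [P.b_symm (P.s u), P.b_symm u]
    ring
  b_s u v := by simp [P.b_s]
  b_X u v := by
    simp only [LinearMap.sub_apply, LinearMap.compl₁₂_apply, LinearMap.id_apply]
    rw [P.s_X, P.b_X, P.b_X, ← P.s_X v]
    ring
  s_X := P.s_X
  s_order := P.s_order
  X_nil := P.X_nil

theorem twist_b (P : FormSpace F ε) (u v : P.V) : P.twist.b u v = P.b (P.s u) v - P.b u (P.s v) :=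
  rfl

theorem twist_b' (P : FormSpace F ε) (u v : P.V) :
    P.twist.b u v = P.b ((P.s * P.s - 1 : Module.End F P.V) u) (P.s v) := by
  rw [twist_b, ← P.b_s (P.s u)]
  simp

theorem Nondeg.twist {P : FormSpace F ε} (hP : P.Nondeg) (h : P.Avoids {-1, 1}) :
    P.twist.Nondeg := by
  intro u hu
  apply h.sq_bijective.1
  rw [map_zero]
  refine hP _ fun v => ?_
  obtain ⟨v, rfl⟩ := P.s_surjective v
  rw [← twist_b', hu]

theorem exists_untwist (hε : ε * ε = 1) {Q : FormSpace F (-ε)} (hQ : Q.Nondeg)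
    (h : Q.Avoids {-1, 1}) :
    ∃ P : FormSpace F ε, P.Nondeg ∧ P.Avoids {-1, 1} ∧ Iso P.twist Q := by
  let e : Q.V ≃ₗ[F] Q.V := LinearEquiv.ofBijective (Q.s * Q.s - 1 : Module.End F Q.V)
    h.sq_bijective
  have he : ∀ u, e u = Q.s (Q.s u) - u := fun u => rfl
  have hes : ∀ u, e.symm (Q.s u) = Q.s (e.symm u) := by
    intro u
    rw [LinearEquiv.symm_apply_eq, he, ← map_sub, ← he, e.apply_symm_apply]
  let b : Q.V →ₗ[F] Q.V →ₗ[F] F := Q.b.compl₁₂ (e.symm.toLinearMap ∘ₗ Q.s) LinearMap.id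
  have hb : ∀ u v, b u v = Q.b (e.symm (Q.s u)) v := fun _ _ => rfl
  let P : FormSpace F ε :=
    { V := Q.V
      b := b
      s := Q.s
      X := Q.X
      b_symm := fun u v => by
        obtain ⟨x, rfl⟩ := e.surjective u
        obtain ⟨y, rfl⟩ := e.surjective v
        rw [hb, hb, hes, hes, e.symm_apply_apply, e.symm_apply_apply, he, he, map_sub, map_sub,
          Q.b_s, Q.b_s, Q.b_symm y, Q.b_symm (Q.s y) x]
        linear_combination (Q.b (Q.s x) y - Q.b x (Q.s y)) * hε
      b_s := fun u v => by rw [hb, hb, hes, Q.b_s]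
      b_X := by simp [h.1]
      s_X := Q.s_X
      s_order := Q.s_order
      X_nil := Q.X_nil }
  refine ⟨P, ?_, h, LinearEquiv.refl F _, fun u v => ?_, fun _ => rfl, fun _ => rfl⟩
  · intro u hu
    apply Q.s_bijective.1
    apply e.symm.injective
    rw [map_zero, map_zero]
    exact hQ _ hu
  · rw [twist_b']
    change Q.b u v = Q.b (e.symm (Q.s (e u))) (Q.s v)
    rw [hes, e.symm_apply_apply, Q.b_s]

theorem gen_avoids_neg (hε : ε * ε = 1) (x : ℝ≥0∞) :
    gen (Avoids (ε := ε) {-1, 1}) x = gen (Avoids (ε := -ε) {-1, 1}) x := by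
  refine gen_congr (fun P Q => Iso P.1.twist Q.1) ?_ ?_ ?_ ?_ x
  · exact fun P => ⟨⟨P.1.twist, P.2.1.twist P.2.2, P.2.2⟩, Iso.refl _⟩
  · intro Q
    obtain ⟨P, h1, h2, h3⟩ := exists_untwist hε Q.2.1 Q.2.2
    exact ⟨⟨P, h1, h2⟩, h3⟩
  · intro P Q P' Q' h h'
    constructor
    · rintro ⟨f, hf⟩
      refine (h.symm.trans ⟨f, fun u v => ?_, hf.s, hf.X⟩).trans h'
      have e1 := hf.s u
      have e2 := hf.s v
      simp only [LinearEquiv.coe_coe] at e1 e2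
      rw [twist_b, twist_b, ← hf.b (P.1.s u) v, ← hf.b u]
      simp only [LinearEquiv.coe_coe]
      rw [e1, e2]
    · intro hi
      obtain ⟨f, hf⟩ := (h.trans hi).trans h'.symm
      have hs : ∀ u, f (P.1.s u) = P'.1.s (f u) := hf.s
      refine ⟨f, fun u v => ?_, hf.s, hf.X⟩
      obtain ⟨u, rfl⟩ := P.2.2.sq_bijective.2 u
      obtain ⟨v, rfl⟩ := P.1.s_surjective v
      rw [← twist_b', ← hf.b, twist_b']
      simp [hs]
  · intro P Q h
    exact h.finrank_eq

/-- A bilinear form, with trivial operators. -/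
@[reducible]
def bare (V : Type u) [AddCommGroup V] [Module F V] [FiniteDimensional F V] (b : V →ₗ[F] V →ₗ[F] F)
    (hb : ∀ u v, b u v = ε * b v u) : FormSpace F ε where
  V := V
  b := b
  s := 1
  X := 0
  b_symm := hb
  b_s _ _ := rfl
  b_X := by simp
  s_X := by simp
  s_order := ⟨1, by simp⟩
  X_nil := IsNilpotent.zero

theorem isScalar_bare {V : Type u} [AddCommGroup V] [Module F V] [FiniteDimensional F V]
    {b : V →ₗ[F] V →ₗ[F] F} (hb : ∀ u v, b u v = ε * b v u) : (bare V b hb).IsScalar 1 :=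
  ⟨rfl, by simp⟩

theorem IsScalar.restrict {P : FormSpace F ε} {a : F} (h : P.IsScalar a) (W : Submodule F P.V)
    (hs : ∀ u ∈ W, P.s u ∈ W) (hX : ∀ u ∈ W, P.X u ∈ W) : (P.restrict W hs hX).IsScalar a := by
  refine ⟨?_, fun u => Subtype.ext (h.2 u)⟩
  ext u
  simp [h.1]

theorem IsScalar.sum {P Q : FormSpace F ε} {a : F} (hP : P.IsScalar a) (hQ : Q.IsScalar a) :
    (P.sum Q).IsScalar a :=
  ⟨by change P.X.prodMap Q.X = 0; rw [hP.1, hQ.1]; exact LinearMap.prodMap_zero,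
    fun u => Prod.ext (hP.2 _) (hQ.2 _)⟩

theorem IsScalar.isHom {P Q : FormSpace F ε} {a : F} (hP : P.IsScalar a) (hQ : Q.IsScalar a)
    {f : P.V →ₗ[F] Q.V} (hf : ∀ u v, Q.b (f u) (f v) = P.b u v) : IsHom f :=
  ⟨hf, fun u => by rw [hP.2, hQ.2, map_smul], fun u => by simp [hP.1, hQ.1]⟩

end FormSpace

end

/-! ### Spaces on which the isometry is scalar -/

section

namespace FormSpace

open scoped ENNReal

variable {F : Type u} [Field F]

variable (F) in
/-- The hyperbolic plane. -/
@[reducible]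
def hyp : FormSpace F (-1) :=
  bare (F × F) (LinearMap.mk₂ F (fun u v => u.1 * v.2 - u.2 * v.1)
    (fun u v w => by simp; ring) (fun c u v => by simp; ring)
    (fun u v w => by simp; ring) (fun c u v => by simp; ring)) (fun u v => by simp; ring)

theorem hyp_b (u v : F × F) : (hyp F).b u v = u.1 * v.2 - u.2 * v.1 := rfl

theorem hyp_nondeg : (hyp F).Nondeg := by
  intro u hu
  refine Prod.ext ?_ ?_
  · simpa [hyp_b] using (hyp_b u (0, 1)).symm.trans (hu (0, 1))
  · simpa [hyp_b] using (hyp_b u (1, 0)).symm.trans (hu (1, 0))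

variable (F) in
/-- A sum of hyperbolic planes. -/
noncomputable def hypPow : ℕ → FormSpace F (-1)
  | 0 => zero (-1)
  | n + 1 => (hyp F).sum (hypPow n)

theorem hypPow_nondeg (n : ℕ) : (hypPow F n).Nondeg := by
  induction n with
  | zero => exact zero_nondeg
  | succ n ih => exact hyp_nondeg.sum ih

theorem hypPow_isScalar (n : ℕ) : (hypPow F n).IsScalar 1 := by
  induction n with
  | zero => exact ⟨rfl, fun u => rfl⟩
  | succ n ih => exact (isScalar_bare _).sum ih

theorem finrank_hypPow (n : ℕ) : Module.finrank F (hypPow F n).V = 2 * n := by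
  induction n with
  | zero => exact Module.finrank_zero_of_subsingleton (R := F) (M := PUnit.{u + 1})
  | succ n ih =>
    have h1 : Module.finrank F (hypPow F (n + 1)).V =
      Module.finrank F (F × F) + Module.finrank F (hypPow F n).V :=
      Module.finrank_prod (R := F) (M := F × F) (M' := (hypPow F n).V)
    rw [h1, ih, Module.finrank_prod, Module.finrank_self]
    ring

theorem b_self {P : FormSpace F (-1)} (h2 : (2 : F) ≠ 0) (u : P.V) : P.b u u = 0 := by
  have h := P.b_symm u u
  have : (2 : F) * P.b u u = 0 := by linear_combination h
  exact (mul_eq_zero.1 this).resolve_left h2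

theorem exists_iso_hypPow (h2 : (2 : F) ≠ 0) {P : FormSpace F (-1)} (hP : P.Nondeg)
    (hs : P.IsScalar 1) : ∃ n, Iso (hypPow F n) P := by
  induction hd : Module.finrank F P.V using Nat.strong_induction_on generalizing P with
  | _ d ih =>
    by_cases h0 : ∀ u : P.V, u = 0
    · refine ⟨0, toCls_eq (hP := hypPow_nondeg 0) (hQ := hP) |>.1 (Cls.eq_of_dim_eq_zero ?_ ?_)⟩
      · exact finrank_hypPow 0
      · exact Module.finrank_zero_iff.2 ⟨fun u v => by rw [h0 u, h0 v]⟩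
    · push Not at h0
      obtain ⟨u, hu⟩ := h0
      obtain ⟨v, hv⟩ : ∃ v, P.b u v = 1 := by
        by_contra! h
        refine hu (hP u fun v => ?_)
        by_contra hv
        refine h ((P.b u v)⁻¹ • v) ?_
        rw [map_smul, smul_eq_mul, inv_mul_cancel₀ hv]
      let i : (F × F) →ₗ[F] P.V :=
        (LinearMap.toSpanSingleton F P.V u).coprod (LinearMap.toSpanSingleton F P.V v)
      have hi : IsHom (P := hyp F) (Q := P) i := by
        refine (isScalar_bare _).isHom hs ?_
        rintro ⟨a, b⟩ ⟨c, d⟩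
        change P.b (a • u + b • v) (c • u + d • v) = a * d - b * c
        simp only [map_add, map_smul, LinearMap.add_apply, LinearMap.smul_apply, smul_eq_mul,
          b_self h2, hv, P.b_symm v u]
        ring
      obtain ⟨W, hWs, hWX, -, hn, hiso⟩ := exists_iso_sum hi hyp_nondeg hP
      have hfin : Module.finrank F (F × F) + Module.finrank F W = Module.finrank F P.V := by
        rw [← hiso.finrank_eq, ← Module.finrank_prod (R := F) (M := F × F) (M' := W)]
      rw [Module.finrank_prod, Module.finrank_self] at hfin
      obtain ⟨n, hn⟩ := ih _ (show Module.finrank F W < d by omega) hn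
        (hs.restrict W hWs hWX) rfl
      exact ⟨n + 1, ((Iso.refl _).sum hn).trans hiso⟩

theorem iso_of_skew (h2 : (2 : F) ≠ 0) {P Q : FormSpace F (-1)} (hP : P.Nondeg)
    (hPs : P.IsScalar 1) (hQ : Q.Nondeg) (hQs : Q.IsScalar 1)
    (h : Module.finrank F P.V = Module.finrank F Q.V) : Iso P Q := by
  obtain ⟨n, hn⟩ := exists_iso_hypPow h2 hP hPs
  obtain ⟨m, hm⟩ := exists_iso_hypPow h2 hQ hQs
  have h3 := hn.finrank_eq
  have h4 := hm.finrank_eq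
  rw [finrank_hypPow] at h3 h4
  obtain rfl : n = m := by omega
  exact hn.symm.trans hm

theorem even_finrank (h2 : (2 : F) ≠ 0) {P : FormSpace F (-1)} (hP : P.Nondeg) :
    Even (Module.finrank F P.V) := by
  obtain ⟨n, hn⟩ := exists_iso_hypPow h2 (P := bare P.V P.b P.b_symm) hP (isScalar_bare _)
  have := hn.finrank_eq
  rw [finrank_hypPow] at this
  exact ⟨n, by rw [← two_mul]; exact this.symm⟩

theorem Cls.even_dim (h2 : (2 : F) ≠ 0) (c : Cls (-1 : F)) : Even c.dim := by
  obtain ⟨P, hP, rfl⟩ := c.exists_rep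
  exact even_finrank h2 hP

theorem gen_skew (h2 : (2 : F) ≠ 0) (x : ℝ≥0∞) :
    gen (IsScalar (ε := (-1 : F)) 1) x = ∑' n : ℕ, x ^ (2 * n) := by
  rw [gen_of_family (hypPow F) hypPow_nondeg hypPow_isScalar
    (fun P hP hs => exists_iso_hypPow h2 hP hs) (fun i j h => ?_)]
  · simp_rw [finrank_hypPow]
  · have := h.finrank_eq
    rw [finrank_hypPow, finrank_hypPow] at this
    omega

/-- The diagonal form with entries `1, …, 1, c`. -/
@[reducible]
noncomputable def diag (n : ℕ) (c : F) : FormSpace F 1 :=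
  bare (Fin (n + 1) → F)
    (Matrix.toLinearMap₂' F (Matrix.diagonal fun i => if i = Fin.last n then c else 1))
    (fun u v => by
      simp only [Matrix.toLinearMap₂'_apply', Matrix.mulVec_diagonal, dotProduct]
      rw [one_mul]
      exact Finset.sum_congr rfl fun i _ => by ring)

theorem diag_b (n : ℕ) (c : F) (u v : Fin (n + 1) → F) :
    (diag n c).b u v = ∑ i, (if i = Fin.last n then c else 1) * (u i * v i) := by
  change Matrix.toLinearMap₂' F (Matrix.diagonal fun i => if i = Fin.last n then c else 1) u v = _
  simp only [Matrix.toLinearMap₂'_apply', Matrix.mulVec_diagonal, dotProduct]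
  exact Finset.sum_congr rfl fun i _ => by ring

theorem diag_nondeg (n : ℕ) {c : F} (hc : c ≠ 0) : (diag n c).Nondeg := by
  intro u hu
  funext i
  have h := (diag_b n c u (Pi.single i 1)).symm.trans (hu (Pi.single i 1))
  rw [Finset.sum_eq_single i] at h
  · rw [Pi.single_eq_same, mul_one, mul_eq_zero] at h
    refine h.resolve_left ?_
    split_ifs <;> simp [hc]
  · intro j _ hj
    rw [Pi.single_eq_of_ne hj, mul_zero, mul_zero]
  · simp

theorem finrank_diag (n : ℕ) (c : F) : Module.finrank F (diag n c).V = n + 1 :=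
  Module.finrank_fin_fun F

theorem diag_unique {n : ℕ} {c d : F} (h : Iso (diag n c) (diag n d)) : ∃ t, c = d * (t * t) := by
  obtain ⟨f, hf⟩ := h
  let f' : (Fin (n + 1) → F) →ₗ[F] (Fin (n + 1) → F) := f.toLinearMap
  let D (a : F) : Matrix (Fin (n + 1)) (Fin (n + 1)) F :=
    Matrix.diagonal fun i => if i = Fin.last n then a else 1
  have hD : ∀ a, (D a).det = a := fun a => by
    rw [Matrix.det_diagonal, Finset.prod_ite_eq' Finset.univ (Fin.last n) fun _ => a]
    simp
  have h1 : (Matrix.toLinearMap₂' F (D d)).compl₁₂ f' f' = Matrix.toLinearMap₂' F (D c) :=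
    LinearMap.ext₂ fun u v => hf.b u v
  have h2 := congrArg (fun B => (LinearMap.toMatrix₂' F B).det) h1
  simp only [LinearMap.toMatrix₂'_compl₁₂, LinearMap.toMatrix'_toLinearMap₂', Matrix.det_mul,
    Matrix.det_transpose, hD] at h2
  exact ⟨_, by rw [← h2]; ring⟩

variable (F) in
/-- The form `x * y` on the line, scaled. -/
@[reducible]
noncomputable def line (c : F) : FormSpace F 1 :=
  bare F (c • LinearMap.mul F F) (fun u v => by simp [mul_comm u v])

theorem line_b (c : F) (u v : F) : (line F c).b u v = c * (u * v) := rfl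

theorem line_nondeg {c : F} (hc : c ≠ 0) : (line F c).Nondeg := by
  intro u hu
  simpa [hc] using (line_b c u (1 : F)).symm.trans (hu (1 : F))

theorem iso_diag_succ (n : ℕ) (c : F) : Iso ((line F 1).sum (diag n c)) (diag (n + 1) c) := by
  let f : (F × (Fin (n + 1) → F)) ≃ₗ[F] (Fin (n + 2) → F) := Fin.consLinearEquiv F fun _ => F
  refine ⟨f, ((isScalar_bare _).sum (isScalar_bare _)).isHom (isScalar_bare _) ?_⟩
  rintro ⟨a, u⟩ ⟨b, v⟩
  change (diag (n + 1) c).b (Fin.cons a u : Fin (n + 2) → F) (Fin.cons b v : Fin (n + 2) → F) =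
    (line F 1).b a b + (diag n c).b u v
  rw [diag_b, diag_b, line_b, Fin.sum_univ_succ]
  congr 1
  simp [Fin.ext_iff]

theorem exists_sum_line {P : FormSpace F 1} (hP : P.Nondeg) (hs : P.IsScalar 1) {u : P.V} {c : F}
    (hc : c ≠ 0) (hu : P.b u u = c) : ∃ Q : FormSpace F 1, Q.Nondeg ∧ Q.IsScalar 1 ∧
      Iso ((line F c).sum Q) P ∧ Module.finrank F P.V = Module.finrank F Q.V + 1 ∧
      ∃ i : Q.V →ₗ[F] P.V, (∀ v w, P.b (i v) (i w) = Q.b v w) ∧ ∀ v, P.b u (i v) = 0 := by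
  have hi : IsHom (P := line F c) (Q := P) (LinearMap.toSpanSingleton F P.V u) := by
    refine (isScalar_bare _).isHom hs fun a b => ?_
    change P.b ((a : F) • u) ((b : F) • u) = c * (a * b)
    simp only [map_smul, LinearMap.smul_apply, smul_eq_mul, hu]
    ring
  obtain ⟨W, hWs, hWX, hW, hn, hiso⟩ := exists_iso_sum hi (line_nondeg hc) hP
  refine ⟨_, hn, hs.restrict _ _ _, hiso, ?_, W.subtype, fun _ _ => rfl, fun v => ?_⟩
  · rw [← hiso.finrank_eq]
    refine (Module.finrank_prod (R := F) (M := F) (M' := W)).trans ?_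
    rw [Module.finrank_self, add_comm]
  · have := (hW v.1).1 v.2 (1 : F)
    rw [P.b_symm, one_mul]
    simpa using this

theorem exists_anisotropic (h2 : (2 : F) ≠ 0) {P : FormSpace F 1} (hP : P.Nondeg)
    (hd : 0 < Module.finrank F P.V) : ∃ u, P.b u u ≠ 0 := by
  by_contra! h
  have : Nontrivial P.V := Module.finrank_pos_iff.1 hd
  obtain ⟨u, hu⟩ := exists_ne (0 : P.V)
  refine hu (hP u fun v => ?_)
  have h1 := h (u + v)
  simp only [map_add, LinearMap.add_apply, h, P.b_symm v u] at h1
  have : 2 * P.b u v = 0 := by linear_combination h1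
  exact (mul_eq_zero.1 this).resolve_left h2

theorem ringChar_ne_two (h2 : (2 : F) ≠ 0) : ringChar F ≠ 2 := by
  intro h
  have h1 := ringChar.Nat.cast_ringChar (R := F)
  rw [h] at h1
  exact h2 (by exact_mod_cast h1)

theorem exists_b_eq_one [Finite F] (h2 : (2 : F) ≠ 0) {P : FormSpace F 1} (hP : P.Nondeg)
    (hs : P.IsScalar 1) (hd : 1 < Module.finrank F P.V) : ∃ u, P.b u u = 1 := by
  have := Fintype.ofFinite F
  obtain ⟨u, hu⟩ := exists_anisotropic h2 hP (by omega)
  obtain ⟨Q, hQ, -, -, hfin, i, hi, horth⟩ := exists_sum_line hP hs hu rfl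
  obtain ⟨w, hw⟩ := exists_anisotropic h2 hQ (by omega)
  obtain ⟨a, b, hab⟩ := FiniteField.exists_root_sum_quadratic
    (f := Polynomial.C (P.b u u) * Polynomial.X ^ 2 + Polynomial.C 0 * Polynomial.X +
      Polynomial.C (-1))
    (g := Polynomial.C (Q.b w w) * Polynomial.X ^ 2 + Polynomial.C 0 * Polynomial.X +
      Polynomial.C 0) (Polynomial.degree_quadratic hu) (Polynomial.degree_quadratic hw)
    (FiniteField.odd_card_of_char_ne_two (ringChar_ne_two h2))
  refine ⟨a • u + b • i w, ?_⟩
  have h3 : P.b (i w) u = 0 := by rw [P.b_symm, horth, mul_zero]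
  simp only [map_add, map_smul, LinearMap.add_apply, LinearMap.smul_apply, smul_eq_mul,
    hi, horth, h3]
  simp at hab
  linear_combination hab

theorem exists_iso_diag [Finite F] (h2 : (2 : F) ≠ 0) {ζ : F} (hζ : ¬IsSquare ζ)
    {P : FormSpace F 1} (hP : P.Nondeg) (hs : P.IsScalar 1) {n : ℕ}
    (hn : Module.finrank F P.V = n + 1) : ∃ i : Bool, Iso (diag n (if i then ζ else 1)) P := by
  have := Fintype.ofFinite F
  induction n generalizing P with
  | zero =>
    obtain ⟨u, hu⟩ := exists_anisotropic h2 hP (by omega)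
    obtain ⟨i, t, ht⟩ : ∃ i : Bool, ∃ t, P.b u u * (t * t) = if i then ζ else 1 := by
      have hc := ringChar_ne_two h2
      by_cases h : IsSquare (P.b u u)
      · obtain ⟨t, ht⟩ := h
        have ht0 : t ≠ 0 := by
          rintro rfl
          exact hu (by simpa using ht)
        refine ⟨false, t⁻¹, ?_⟩
        rw [ht]
        field_simp
        simp
      · have hζ0 : ζ ≠ 0 := by
          rintro rfl
          exact hζ (IsSquare.zero)
        have h3 : IsSquare (P.b u u * ζ) := by
          rw [FiniteField.isSquare_iff hc (mul_ne_zero hu hζ0), mul_pow,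
            (FiniteField.pow_dichotomy hc hu).resolve_left
              (fun h' => h ((FiniteField.isSquare_iff hc hu).2 h')),
            (FiniteField.pow_dichotomy hc hζ0).resolve_left
              (fun h' => hζ ((FiniteField.isSquare_iff hc hζ0).2 h'))]
          ring
        obtain ⟨t, ht⟩ := h3
        refine ⟨true, t * (P.b u u)⁻¹, ?_⟩
        rw [mul_mul_mul_comm, ← ht]
        field_simp
        simp
    refine ⟨i, IsHom.iso (f := LinearMap.toSpanSingleton F P.V (t • u) ∘ₗ LinearMap.proj 0)
      ((isScalar_bare _).isHom hs ?_) (diag_nondeg _ ?_) (by rw [finrank_diag, hn])⟩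
    · intro v w
      refine Eq.trans ?_ (diag_b 0 _ v w).symm
      simp [← ht]
      ring
    · cases i
      · simp
      · rintro h
        simp only [if_true] at h
        exact hζ (h ▸ IsSquare.zero)
  | succ n ih =>
    obtain ⟨u, hu⟩ := exists_b_eq_one h2 hP hs (by omega)
    obtain ⟨Q, hQ, hQs, hiso, hfin, -⟩ := exists_sum_line hP hs one_ne_zero hu
    obtain ⟨i, hi⟩ := ih hQ hQs (by omega)
    exact ⟨i, (iso_diag_succ n _).symm.trans (((Iso.refl _).sum hi).trans hiso)⟩

theorem gen_symm [Finite F] (h2 : (2 : F) ≠ 0) (x : ℝ≥0∞) :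
    gen (IsScalar (ε := (1 : F)) 1) x = 1 + ∑' n : ℕ, (x ^ (n + 1) + x ^ (n + 1)) := by
  obtain ⟨ζ, hζ⟩ := FiniteField.exists_nonsquare (ringChar_ne_two h2)
  have hζ0 : ζ ≠ 0 := by
    rintro rfl
    exact hζ IsSquare.zero
  let A : Unit ⊕ ℕ × Bool → FormSpace F 1 :=
    Sum.elim (fun _ => zero 1) fun i => diag i.1 (if i.2 then ζ else 1)
  have hA : ∀ i, (A i).Nondeg := by
    rintro (_ | ⟨n, i⟩)
    · exact zero_nondeg
    · cases i <;> exact diag_nondeg _ (by simp [hζ0])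
  have hz : Module.finrank F (zero (1 : F)).V = 0 :=
    Module.finrank_zero_of_subsingleton (R := F) (M := PUnit.{u + 1})
  rw [gen_of_family A hA]
  · rw [Summable.tsum_sum ENNReal.summable ENNReal.summable,
      ENNReal.tsum_prod (f := fun n i => x ^ Module.finrank F (A (Sum.inr (n, i))).V)]
    change ∑' i : Unit, x ^ Module.finrank F (zero (1 : F)).V +
      ∑' (n : ℕ) (i : Bool), x ^ Module.finrank F (diag n (if i then ζ else 1)).V = _
    rw [hz]
    simp [two_mul]
  · rintro (_ | ⟨n, i⟩)
    · exact ⟨rfl, fun u => rfl⟩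
    · exact isScalar_bare _
  · intro P hP hs
    rcases hd : Module.finrank F P.V with _ | n
    · exact ⟨Sum.inl (), toCls_eq (hP := zero_nondeg) (hQ := hP) |>.1
        (Cls.eq_of_dim_eq_zero Cls.dim_zero hd)⟩
    · obtain ⟨i, hi⟩ := exists_iso_diag h2 hζ hP hs hd
      exact ⟨Sum.inr (n, i), hi⟩
  · rintro (_ | ⟨n, i⟩) (_ | ⟨m, j⟩) h
    · rfl
    · exact absurd (hz.symm.trans (h.finrank_eq.trans (finrank_diag _ _))) (by omega)
    · exact absurd ((finrank_diag _ _).symm.trans (h.finrank_eq.trans hz)) (by omega)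
    · obtain rfl : n = m := by
        have h1 := (finrank_diag _ _).symm.trans (h.finrank_eq.trans (finrank_diag _ _))
        omega
      obtain ⟨t, ht⟩ := diag_unique h
      obtain ⟨t', ht'⟩ := diag_unique h.symm
      rcases i with _ | _ <;> rcases j with _ | _
      · rfl
      · exact absurd ⟨t', by simpa using ht'⟩ hζ
      · exact absurd ⟨t, by simpa using ht⟩ hζ
      · rfl

theorem genSS_one [Finite F] (h2 : (2 : F) ≠ 0) (x : ℝ≥0∞) :
    genSS (1 : F) x = (1 + x) ^ 4 * genSS (-1 : F) x := by
  have h : gen (IsScalar (ε := (1 : F)) 1) x =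
      (1 + x) ^ 2 * gen (IsScalar (ε := (-1 : F)) 1) x := by
    have h1 : ∑' n : ℕ, x ^ n = 1 + ∑' n : ℕ, x ^ (n + 1) := by
      rw [tsum_eq_zero_add' ENNReal.summable, pow_zero]
    have h3 : ∑' n : ℕ, x ^ (n + 1) = x * ∑' n : ℕ, x ^ n := by
      rw [← ENNReal.tsum_mul_left]
      exact tsum_congr fun n => pow_succ' x n
    have h4 : ∑' n : ℕ, x ^ n = (1 + x) * ∑' n : ℕ, x ^ (2 * n) := by
      rw [← tsum_even_add_odd ENNReal.summable ENNReal.summable, add_mul, one_mul,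
        ← ENNReal.tsum_mul_left]
      exact congrArg _ (tsum_congr fun n => pow_succ' x _)
    rw [gen_symm h2, gen_skew h2, Summable.tsum_add ENNReal.summable ENNReal.summable, ← add_assoc,
      ← h1, h3, sq, mul_assoc, ← h4, add_mul, one_mul]
  rw [genSS_split h2, genSS_split h2, gen_isScalar_neg, gen_isScalar_neg, h,
    gen_avoids_neg (one_mul 1)]
  ring

end FormSpace

end

/-! ### Symplectic coordinates -/

section

open scoped Matrix

namespace FormSpace

variable {F : Type u} [Field F]

theorem neg_J_eq_sympJ (n : ℕ) : -Matrix.J (Fin n) F = sympJ n F := by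
  simp [Matrix.J, sympJ, Matrix.fromBlocks_neg]

theorem sympJ_mul_self (n : ℕ) : sympJ n F * sympJ n F = -1 := by
  rw [← neg_J_eq_sympJ, neg_mul_neg, Matrix.J_squared]

theorem sympJ_transpose (n : ℕ) : (sympJ n F)ᵀ = -sympJ n F := by
  rw [← neg_J_eq_sympJ, Matrix.transpose_neg, Matrix.J_transpose]

/-- The standard symplectic form. -/
noncomputable def sympForm (n : ℕ) : (Fin n ⊕ Fin n → F) →ₗ[F] (Fin n ⊕ Fin n → F) →ₗ[F] F :=
  Matrix.toLinearMap₂' F (sympJ n F)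

theorem sympForm_apply (n : ℕ) (u v : Fin n ⊕ Fin n → F) :
    sympForm n u v = u ⬝ᵥ (sympJ n F).mulVec v := Matrix.toLinearMap₂'_apply' _ _ _

theorem sympForm_symm (n : ℕ) (u v : Fin n ⊕ Fin n → F) :
    sympForm n u v = -1 * sympForm n v u := by
  rw [sympForm_apply, sympForm_apply, Matrix.dotProduct_mulVec, dotProduct_comm,
    ← Matrix.mulVec_transpose, sympJ_transpose, Matrix.neg_mulVec, dotProduct_neg, neg_one_mul]

theorem sympForm_nondeg (n : ℕ) (u : Fin n ⊕ Fin n → F) (h : ∀ v, sympForm n u v = 0) : u = 0 := by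
  have h1 := h ((sympJ n F).mulVec u)
  have h2 : Matrix.vecMul u (sympJ n F) = 0 := by
    funext i
    have := h (Pi.single i 1)
    rw [sympForm_apply, Matrix.dotProduct_mulVec, dotProduct_single_one] at this
    exact this
  have h3 := congrArg (fun w => Matrix.vecMul w (sympJ n F)) h2
  simpa [Matrix.vecMul_vecMul, sympJ_mul_self, Matrix.vecMul_neg] using h3

theorem sympForm_preserved_iff (n : ℕ) (M : Matrix (Fin n ⊕ Fin n) (Fin n ⊕ Fin n) F) :
    Mᵀ * sympJ n F * M = sympJ n F ↔
      ∀ u v, sympForm n (M.mulVec u) (M.mulVec v) = sympForm n u v := by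
  have h : LinearMap.compl₁₂ (sympForm n) (Matrix.toLin' M) (Matrix.toLin' M) =
      Matrix.toLinearMap₂' F (Mᵀ * sympJ n F * M) := Matrix.toLinearMap₂'_comp _ _ _
  constructor
  · intro hM
    rw [hM] at h
    exact LinearMap.ext_iff₂.1 h
  · intro hM
    have h' : LinearMap.compl₁₂ (sympForm n) (Matrix.toLin' M) (Matrix.toLin' M) = sympForm n :=
      LinearMap.ext_iff₂.2 hM
    rw [h] at h'
    exact LinearEquiv.injective _ h'

theorem exists_symplectic_coordinates (h2 : (2 : F) ≠ 0) {P : FormSpace F (-1)} (hP : P.Nondeg)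
    {n : ℕ} (hn : Module.finrank F P.V = 2 * n) :
    ∃ f : P.V ≃ₗ[F] (Fin n ⊕ Fin n → F), ∀ u v, sympForm n (f u) (f v) = P.b u v := by
  obtain ⟨f, hf⟩ := iso_of_skew h2 (P := bare P.V P.b P.b_symm)
    (Q := bare (Fin n ⊕ Fin n → F) (sympForm n) (sympForm_symm n)) hP (isScalar_bare _)
    (sympForm_nondeg n) (isScalar_bare _) (by simp [hn, two_mul])
  exact ⟨f, hf.b⟩

theorem reverse_charpoly_of_symplectic {n : ℕ} {M : Matrix (Fin n ⊕ Fin n) (Fin n ⊕ Fin n) F}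
    (hM : Mᵀ * sympJ n F * M = sympJ n F) : M.charpoly.reverse = M.charpoly := by
  have hM' : M ∈ Matrix.symplecticGroup (Fin n) F := by
    rw [SymplecticGroup.mem_iff']
    rw [← neg_J_eq_sympJ] at hM
    simpa using hM
  have hdet := SymplecticGroup.det_eq_one hM'
  have hunit : IsUnit M := (Matrix.isUnit_iff_isUnit_det M).2 (by rw [hdet]; exact isUnit_one)
  have hinv : M⁻¹ = -sympJ n F * (Mᵀ * sympJ n F) := by
    refine Matrix.inv_eq_left_inv ?_
    rw [mul_assoc, hM, neg_mul, sympJ_mul_self, neg_neg]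
  rw [Matrix.reverse_charpoly]
  have h1 := Matrix.charpoly_inv M hunit
  rw [hinv, Matrix.charpoly_mul_comm, mul_assoc, mul_neg, sympJ_mul_self, neg_neg, mul_one,
    Matrix.charpoly_transpose, hdet] at h1
  rw [h1]
  simp [← two_mul]

theorem reverse_charpoly_s (h2 : (2 : F) ≠ 0) {P : FormSpace F (-1)} (hP : P.Nondeg) :
    (LinearMap.charpoly P.s).reverse = LinearMap.charpoly P.s := by
  obtain ⟨n, hn⟩ := even_finrank h2 hP
  obtain ⟨f, hf⟩ := exists_symplectic_coordinates h2 hP (n := n) (by omega)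
  have h1 : (LinearMap.toMatrix' (f.conj P.s)).charpoly = LinearMap.charpoly P.s := by
    rw [← LinearEquiv.charpoly_conj f P.s,
      ← LinearMap.charpoly_toMatrix (f.conj P.s) (Pi.basisFun F _),
      LinearMap.toMatrix_eq_toMatrix']
  rw [← h1]
  refine reverse_charpoly_of_symplectic ((sympForm_preserved_iff n _).2 fun u v => ?_)
  rw [← Matrix.toLin'_apply, ← Matrix.toLin'_apply, Matrix.toLin'_toMatrix']
  obtain ⟨u, rfl⟩ := f.surjective u
  obtain ⟨v, rfl⟩ := f.surjective v
  simp [LinearEquiv.conj_apply, hf, P.b_s]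

theorem charpoly_s_ext (h2 : (2 : F) ≠ 0) {P Q : FormSpace F (-1)} (hP : P.Nondeg) (hQ : Q.Nondeg)
    {j : ℕ} (hPj : Module.finrank F P.V = 2 * j) (hQj : Module.finrank F Q.V = 2 * j)
    (h : ∀ i < j, (LinearMap.charpoly P.s).coeff (i + 1) = (LinearMap.charpoly Q.s).coeff (i + 1)) :
    LinearMap.charpoly P.s = LinearMap.charpoly Q.s := by
  have key : ∀ {P : FormSpace F (-1)}, P.Nondeg → Module.finrank F P.V = 2 * j → ∀ i ≤ 2 * j,
      (LinearMap.charpoly P.s).coeff (2 * j - i) = (LinearMap.charpoly P.s).coeff i := by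
    intro P hP hj i hi
    conv_rhs => rw [← reverse_charpoly_s h2 hP, Polynomial.coeff_reverse,
      LinearMap.charpoly_natDegree, hj, Polynomial.revAt_le hi]
  have htop : ∀ P : FormSpace F (-1), Module.finrank F P.V = 2 * j →
      (LinearMap.charpoly P.s).coeff (2 * j) = 1 := by
    intro P hj
    rw [← hj, ← LinearMap.charpoly_natDegree P.s]
    exact LinearMap.charpoly_monic P.s
  have hle : ∀ i ≤ j, (LinearMap.charpoly P.s).coeff i = (LinearMap.charpoly Q.s).coeff i := by
    rintro (_ | i) hi
    · rw [← key hP hPj 0 (by omega), ← key hQ hQj 0 (by omega), Nat.sub_zero,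
      htop P hPj, htop Q hQj]
    · exact h i (by omega)
  ext i
  rcases le_total i j with hi | hi
  · exact hle i hi
  · rcases le_or_gt i (2 * j) with hi' | hi'
    · rw [← key hP hPj i hi', ← key hQ hQj i hi']
      exact hle _ (by omega)
    · rw [Polynomial.coeff_eq_zero_of_natDegree_lt, Polynomial.coeff_eq_zero_of_natDegree_lt] <;>
        rwa [LinearMap.charpoly_natDegree, ‹Module.finrank F _ = _›]

end FormSpace

end

/-! ### Modules with the same characteristic polynomial -/

section

open Polynomial

namespace FormSpace

variable {F : Type u} [Field F]

/-- An irreducible factor of the characteristic polynomial kills a nonzero vector. -/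
theorem exists_aeval_apply_eq_zero {V : Type*} [AddCommGroup V] [Module F V]
    [FiniteDimensional F V] {s : Module.End F V} {φ : F[X]} (hφ : Irreducible φ)
    (h : φ ∣ LinearMap.charpoly s) : ∃ v ≠ 0, aeval s φ v = 0 := by
  let B := Module.finBasis F V
  let M := LinearMap.toMatrix B B s
  let K := AlgebraicClosure F
  obtain ⟨α, hα⟩ := IsAlgClosed.exists_root (φ.map (algebraMap F K))
    (by simpa using (degree_pos_of_irreducible hφ).ne')
  have h1 : (M.map (algebraMap F K)).charpoly.IsRoot α := by
    rw [Matrix.charpoly_map, LinearMap.charpoly_toMatrix]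
    exact hα.dvd (Polynomial.map_dvd _ h)
  have h2 := spectrum.subset_polynomial_aeval (𝕜 := K) (M.map (algebraMap F K))
    ((minpoly F M).map (algebraMap F K))
    ⟨α, Matrix.mem_spectrum_of_isRoot_charpoly h1, rfl⟩
  have h3 : aeval (M.map (algebraMap F K)) ((minpoly F M).map (algebraMap F K)) = 0 := by
    have := congrArg (Algebra.ofId F K).mapMatrix (minpoly.aeval F M)
    rw [← aeval_algHom_apply, map_zero] at this
    rw [aeval_map_algebraMap]
    exact this
  have hne : Nonempty (Fin (Module.finrank F V)) := by
    by_contra hempty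
    rw [not_nonempty_iff] at hempty
    have : (M.map (algebraMap F K)).charpoly = 1 := Matrix.det_isEmpty
    rw [this] at h1
    simp at h1
  rw [h3, spectrum.zero_eq, Set.mem_singleton_iff] at h2
  simp only [eval_map_algebraMap] at h2
  have h4 : φ ∣ minpoly F s := by
    rw [← LinearMap.minpoly_toMatrix B s]
    have hφα : aeval α φ = 0 := by rwa [IsRoot, eval_map_algebraMap] at hα
    have hαint : IsIntegral F α := Algebra.IsIntegral.isIntegral α
    exact ((minpoly.irreducible hαint).associated_of_dvd hφ (minpoly.dvd F α hφα)).dvd'.trans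
      (minpoly.dvd F α h2)
  obtain ⟨r, hr⟩ := h4
  by_contra! hcon
  have hr0 : aeval s r = 0 := by
    ext u
    by_contra hu
    refine hcon _ hu ?_
    rw [← Module.End.mul_apply, ← map_mul, ← hr, minpoly.aeval]
    rfl
  have hs0 : minpoly F s ≠ 0 := minpoly.ne_zero (Algebra.IsIntegral.isIntegral s)
  have hdvd := minpoly.dvd F s hr0
  rw [hr] at hdvd hs0
  refine hφ.not_isUnit (isUnit_of_dvd_one ?_)
  rwa [← mul_dvd_mul_iff_right (right_ne_zero_of_mul hs0), one_mul]

theorem aeval_apply_eq_zero_iff {V : Type*} [AddCommGroup V] [Module F V] {s : Module.End F V}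
    {φ : F[X]} (hφ : Irreducible φ) {v : V} (hv : v ≠ 0) (h : aeval s φ v = 0) (p : F[X]) :
    aeval s p v = 0 ↔ φ ∣ p := by
  constructor
  · intro hp
    by_contra hd
    obtain ⟨a, b, hab⟩ := (hφ.coprime_iff_not_dvd).2 hd
    have := congrArg (fun f => aeval s f v) hab
    simp [h, hp] at this
    exact hv this.symm
  · rintro ⟨r, rfl⟩
    rw [mul_comm, map_mul, Module.End.mul_apply, h, map_zero]

theorem exists_equiv_span {V W : Type*} [AddCommGroup V] [Module F V] [AddCommGroup W] [Module F W]
    {s : Module.End F V} {t : Module.End F W} {φ : F[X]} (hφ : Irreducible φ) {v : V} {w : W}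
    (hv : v ≠ 0) (hw : w ≠ 0) (hsv : aeval s φ v = 0) (htw : aeval t φ w = 0) :
    ∃ (A : Submodule F V) (B : Submodule F W), v ∈ A ∧ (∀ u ∈ A, s u ∈ A) ∧ (∀ u ∈ B, t u ∈ B) ∧
      ∃ e : A ≃ₗ[F] B, ∀ (u : V) (hu : u ∈ A) (hu' : s u ∈ A),
        (e ⟨s u, hu'⟩ : W) = t (e ⟨u, hu⟩) := by
  let f : F[X] →ₗ[F] V := LinearMap.applyₗ v ∘ₗ (aeval s).toLinearMap
  let g : F[X] →ₗ[F] W := LinearMap.applyₗ w ∘ₗ (aeval t).toLinearMap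
  have hfs : ∀ p, f (Polynomial.X * p) = s (f p) := fun p => by simp [f]
  have hgt : ∀ p, g (Polynomial.X * p) = t (g p) := fun p => by simp [g]
  have hk : LinearMap.ker f = LinearMap.ker g := by
    ext p
    exact (aeval_apply_eq_zero_iff hφ hv hsv p).trans (aeval_apply_eq_zero_iff hφ hw htw p).symm
  let e : LinearMap.range f ≃ₗ[F] LinearMap.range g := f.quotKerEquivRange.symm.trans
    ((Submodule.quotEquivOfEq _ _ hk).trans g.quotKerEquivRange)
  have he : ∀ p (hp : f p ∈ LinearMap.range f), (e ⟨f p, hp⟩ : W) = g p := by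
    intro p hp
    have : f.quotKerEquivRange.symm ⟨f p, hp⟩ = (LinearMap.ker f).mkQ p := by
      rw [LinearEquiv.symm_apply_eq]; rfl
    simp only [e, LinearEquiv.trans_apply, this]
    rfl
  refine ⟨LinearMap.range f, LinearMap.range g, ⟨1, by simp [f]⟩, ?_, ?_, e, ?_⟩
  · rintro _ ⟨p, rfl⟩
    exact ⟨Polynomial.X * p, hfs p⟩
  · rintro _ ⟨p, rfl⟩
    exact ⟨Polynomial.X * p, hgt p⟩
  · intro u hu hu'
    obtain ⟨p, rfl⟩ := LinearMap.mem_range.1 hu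
    rw [he p]
    have : (⟨s (f p), hu'⟩ : LinearMap.range f) = ⟨f (Polynomial.X * p), hfs p ▸ hu'⟩ :=
      Subtype.ext (hfs p).symm
    rw [this, he, hgt]

theorem charpoly_eq_of_equiv {V W : Type*} [AddCommGroup V] [Module F V] [FiniteDimensional F V]
    [AddCommGroup W] [Module F W] [FiniteDimensional F W] {s : Module.End F V}
    {t : Module.End F W} (e : V ≃ₗ[F] W) (he : ∀ u, e (s u) = t (e u)) :
    LinearMap.charpoly s = LinearMap.charpoly t := by
  rw [← LinearEquiv.charpoly_conj e s]
  congr 1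
  ext u
  simp [LinearEquiv.conj_apply, he]

theorem charpoly_eq_mul_of_isCompl {V : Type*} [AddCommGroup V] [Module F V]
    [FiniteDimensional F V] {s : Module.End F V} {A C : Submodule F V} (hA : ∀ u ∈ A, s u ∈ A)
    (hC : ∀ u ∈ C, s u ∈ C) (h : IsCompl A C) :
    LinearMap.charpoly s =
      LinearMap.charpoly (s.restrict hA) * LinearMap.charpoly (s.restrict hC) := by
  rw [← LinearMap.charpoly_prodMap]
  refine (charpoly_eq_of_equiv (Submodule.prodEquivOfIsCompl A C h) fun u => ?_).symm
  simp

/-- Semisimple operators are determined by their characteristic polynomial. -/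
theorem exists_equiv_of_charpoly_eq {V W : Type*} [AddCommGroup V] [Module F V]
    [FiniteDimensional F V] [AddCommGroup W] [Module F W] [FiniteDimensional F W]
    {s : Module.End F V} {t : Module.End F W} (hs : s.IsSemisimple) (ht : t.IsSemisimple)
    (h : LinearMap.charpoly s = LinearMap.charpoly t) :
    ∃ e : V ≃ₗ[F] W, ∀ u, e (s u) = t (e u) := by
  obtain ⟨n, hn⟩ : ∃ n, Module.finrank F V < n := ⟨_, Nat.lt_succ_self _⟩
  induction n generalizing V W with
  | zero => omega
  | succ n ih =>
    by_cases hunit : IsUnit (LinearMap.charpoly s)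
    · have hV : Module.finrank F V = 0 := by
        rw [← LinearMap.charpoly_natDegree s]; exact natDegree_eq_zero_of_isUnit hunit
      have hW : Module.finrank F W = 0 := by
        rw [← LinearMap.charpoly_natDegree t, ← h]; exact natDegree_eq_zero_of_isUnit hunit
      have := Module.finrank_zero_iff.1 hV
      exact ⟨LinearEquiv.ofFinrankEq V W (hV.trans hW.symm), fun u => by
        rw [Subsingleton.elim (s u) 0, Subsingleton.elim u 0]; simp⟩
    · obtain ⟨φ, hφ, hd⟩ := WfDvdMonoid.exists_irreducible_factor hunit
        (LinearMap.charpoly_monic s).ne_zero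
      obtain ⟨v, hv, hsv⟩ := exists_aeval_apply_eq_zero hφ hd
      obtain ⟨w, hw, htw⟩ := exists_aeval_apply_eq_zero hφ (h ▸ hd)
      obtain ⟨A, B, hvA, hA, hB, e, he⟩ := exists_equiv_span hφ hv hw hsv htw
      obtain ⟨C, hC, hAC⟩ := exists_complement hs A hA
      obtain ⟨D, hD, hBD⟩ := exists_complement ht B hB
      have hcp : LinearMap.charpoly (s.restrict hC) = LinearMap.charpoly (t.restrict hD) := by
        rw [charpoly_eq_mul_of_isCompl hA hC hAC, charpoly_eq_mul_of_isCompl hB hD hBD,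
          ← charpoly_eq_of_equiv (s := s.restrict hA) (t := t.restrict hB) e
            fun u => Subtype.ext (he u u.2 (hA u u.2))] at h
        exact mul_left_cancel₀ (LinearMap.charpoly_monic _).ne_zero h
      have hdim : Module.finrank F C < n := by
        have h1 := Submodule.finrank_add_eq_of_isCompl hAC
        have h2 : 0 < Module.finrank F A := Module.finrank_pos_iff_exists_ne_zero.2
          ⟨⟨v, hvA⟩, fun h => hv (congrArg Subtype.val h)⟩
        omega
      obtain ⟨e', he'⟩ := ih (hs.restrict (p := C)
        ((Module.End.mem_invtSubmodule_iff_forall_mem_of_mem s).2 hC))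
        (ht.restrict (p := D)
          ((Module.End.mem_invtSubmodule_iff_forall_mem_of_mem t).2 hD)) hcp hdim
      let E := (Submodule.prodEquivOfIsCompl A C hAC).symm.trans
        ((e.prodCongr e').trans (Submodule.prodEquivOfIsCompl B D hBD))
      refine ⟨E, fun u => ?_⟩
      obtain ⟨⟨a, c⟩, rfl⟩ := (Submodule.prodEquivOfIsCompl A C hAC).surjective u
      have h1 : s (Submodule.prodEquivOfIsCompl A C hAC (a, c)) =
          Submodule.prodEquivOfIsCompl A C hAC (s.restrict hA a, s.restrict hC c) := by simp
      have h2 := he' c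
      have h3 : e (s.restrict hA a) = t.restrict hB (e a) := Subtype.ext (he a a.2 (hA a a.2))
      rw [h1]
      simp only [E, LinearEquiv.trans_apply, LinearEquiv.symm_apply_apply,
        LinearEquiv.prodCongr_apply, h2, h3]
      simp
      rfl

end FormSpace

end

/-! ### Existence of equivariant isometries -/

section

open Polynomial

namespace FormSpace

theorem exists_sq_sub_mul_sq_of_field {K : Type*} [Field K] [Finite K] (h2 : (2 : K) ≠ 0) {d : K}
    (hd : d ≠ 0) (h : K) : ∃ x y, x ^ 2 - d * y ^ 2 = h := by
  have := Fintype.ofFinite K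
  obtain ⟨x, y, hxy⟩ := FiniteField.exists_root_sum_quadratic
    (f := C 1 * Polynomial.X ^ 2 + C 0 * Polynomial.X + C (-h))
    (g := C (-d) * Polynomial.X ^ 2 + C 0 * Polynomial.X + C 0)
    (degree_quadratic one_ne_zero) (degree_quadratic (neg_ne_zero.2 hd))
    (FiniteField.odd_card_of_char_ne_two (ringChar_ne_two h2))
  refine ⟨x, y, ?_⟩
  simp only [eval_add, eval_mul, eval_C, eval_pow, eval_X] at hxy
  linear_combination hxy

theorem exists_sq_eq_one_add {R : Type*} [CommRing R] {p : ℕ} [Fact p.Prime] [CharP R p]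
    (hp : Odd p) {n : R} (hn : IsNilpotent n) : ∃ c, IsUnit c ∧ c ^ 2 = 1 + n := by
  obtain ⟨k, hk⟩ := hn
  obtain ⟨r, hr⟩ := hp.pow (n := k)
  have h1 : (1 + n) ^ p ^ k = 1 := by
    rw [add_pow_char_pow, one_pow,
      pow_eq_zero_of_le (Nat.lt_pow_self (Fact.out : p.Prime).one_lt).le hk, add_zero]
  refine ⟨(1 + n) ^ (r + 1), (IsNilpotent.isUnit_one_add ⟨k, hk⟩).pow _, ?_⟩
  rw [← pow_mul, show (r + 1) * 2 = p ^ k + 1 by omega, pow_succ, h1, one_mul]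

/-- Binary quadratic forms over finite rings of odd characteristic represent all units. -/
theorem exists_sq_sub_mul_sq {R : Type*} [CommRing R] [Finite R] {p : ℕ} [Fact p.Prime] [CharP R p]
    (hp : Odd p) (h2 : IsUnit (2 : R)) {d h : R} (hd : IsUnit d) (hh : IsUnit h) :
    ∃ x y, x ^ 2 - d * y ^ 2 = h := by
  let N := nilradical R
  have : IsReduced (R ⧸ N) := (Ideal.isRadical_iff_quotient_reduced N).1 (Ideal.radical_isRadical _)
  have : Finite (R ⧸ N) := Quotient.finite _
  let e := IsArtinianRing.equivPi (R ⧸ N)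
  let π : ∀ m : MaximalSpectrum (R ⧸ N), R →+* (R ⧸ N) ⧸ m.asIdeal := fun m =>
    (Ideal.Quotient.mk m.asIdeal).comp (Ideal.Quotient.mk N)
  have key : ∀ m : MaximalSpectrum (R ⧸ N), ∃ x y : (R ⧸ N) ⧸ m.asIdeal,
      x ^ 2 - π m d * y ^ 2 = π m h := by
    intro m
    let _ : Field ((R ⧸ N) ⧸ m.asIdeal) := Ideal.Quotient.field m.asIdeal
    have : Finite ((R ⧸ N) ⧸ m.asIdeal) := Quotient.finite _
    have h2' : (2 : (R ⧸ N) ⧸ m.asIdeal) ≠ 0 := by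
      have := (h2.map (π m)).ne_zero
      rwa [map_ofNat] at this
    exact exists_sq_sub_mul_sq_of_field h2' (hd.map (π m)).ne_zero _
  choose x y hxy using key
  obtain ⟨x', hx'⟩ := Ideal.Quotient.mk_surjective (e.symm x)
  obtain ⟨y', hy'⟩ := Ideal.Quotient.mk_surjective (e.symm y)
  have h3 : Ideal.Quotient.mk N (x' ^ 2 - d * y' ^ 2) = Ideal.Quotient.mk N h := by
    apply e.injective
    rw [map_sub, map_mul, map_pow, map_pow, hx', hy']
    simp only [map_sub, map_mul, map_pow, AlgEquiv.apply_symm_apply]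
    funext m
    exact hxy m
  obtain ⟨h', hh'⟩ := hh.exists_right_inv
  have h4 : IsNilpotent (h' * (x' ^ 2 - d * y' ^ 2 - h)) :=
    (Commute.all _ _).isNilpotent_mul_left (mem_nilradical.1 (Ideal.Quotient.eq.1 h3))
  obtain ⟨c, hc, hc2⟩ := exists_sq_eq_one_add hp h4
  obtain ⟨c', hcc'⟩ := hc.exists_right_inv
  refine ⟨x' * c', y' * c', ?_⟩
  have h5 : x' ^ 2 - d * y' ^ 2 = h * c ^ 2 := by
    rw [hc2]
    linear_combination (-(x' ^ 2 - d * y' ^ 2 - h)) * hh'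
  linear_combination c' ^ 2 * h5 + h * (c * c' + 1) * hcc'

variable {F : Type u} [Field F] {ε : F}

theorem commute_of_mem_adjoin_pair {E : Type*} [Ring E] [Algebra F E] {D d : E}
    (h : Commute D d) : ∀ x ∈ Algebra.adjoin F {D, d}, ∀ y ∈ Algebra.adjoin F {D, d},
      x * y = y * x := by
  have hcomm : ∀ a ∈ ({D, d} : Set E), ∀ b ∈ ({D, d} : Set E), a * b = b * a := by
    rintro a (rfl | rfl) b (rfl | rfl)
    exacts [rfl, h.eq, h.eq.symm, rfl]
  have := Algebra.isMulCommutative_adjoin F hcomm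
  exact fun x hx y hy => congrArg Subtype.val
    (mul_comm' (⟨x, hx⟩ : Algebra.adjoin F {D, d}) ⟨y, hy⟩)

theorem exists_sq_sub_mul_sq_adjoin [Finite F] (h2 : (2 : F) ≠ 0) {E : Type*} [Ring E]
    [Algebra F E] [Finite E] {D d : E} (h : Commute D d) (hD : IsUnit D) (hd : IsUnit d) :
    ∃ x ∈ Algebra.adjoin F {D, d}, ∃ y ∈ Algebra.adjoin F {D, d}, x * x - d * (y * y) = D := by
  rcases subsingleton_or_nontrivial E with _ | _
  · exact ⟨0, zero_mem _, 0, zero_mem _, Subsingleton.elim _ _⟩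
  let R := Algebra.adjoin F {D, d}
  let _ : CommRing R := { (inferInstance : Ring R) with
    mul_comm := fun x y => Subtype.ext (commute_of_mem_adjoin_pair h x x.2 y y.2) }
  have : Finite R := Subtype.finite
  have hunit : ∀ a : R, IsUnit (a : E) → IsUnit a := by
    intro a ha
    refine IsArtinianRing.isUnit_of_mem_nonZeroDivisors (mem_nonZeroDivisors_iff_right.2 ?_)
    intro b hb
    exact Subtype.ext (ha.mul_left_eq_zero.1 (congrArg Subtype.val hb))
  obtain ⟨p, hp⟩ := CharP.exists F
  have := charP_of_injective_algebraMap (FaithfulSMul.algebraMap_injective F E) p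
  have : Fact p.Prime := ⟨CharP.char_is_prime F p⟩
  have hodd : Odd p := by
    refine (Fact.out : p.Prime).odd_of_ne_two ?_
    rintro rfl
    exact h2 (by exact_mod_cast CharP.cast_eq_zero F 2)
  have : CharP R p := charP_of_injective_algebraMap (FaithfulSMul.algebraMap_injective F R) p
  have h2' : IsUnit (2 : R) := by
    have := (IsUnit.mk0 _ h2).map (algebraMap F R)
    rwa [map_ofNat] at this
  obtain ⟨x, y, hxy⟩ := exists_sq_sub_mul_sq hodd h2'
    (hunit ⟨d, Algebra.subset_adjoin (by simp)⟩ hd) (hunit ⟨D, Algebra.subset_adjoin (by simp)⟩ hD)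
  refine ⟨x, x.2, y, y.2, ?_⟩
  have := congrArg Subtype.val hxy
  simpa [sq] using this

/-- Away from the eigenvalues `±1`, an isometry and the dimension determine the form. -/
theorem iso_of_equivariant [Finite F] (h2 : (2 : F) ≠ 0) {P Q : FormSpace F ε} (hP : P.Nondeg)
    (hQ : Q.Nondeg) (hPa : P.Avoids {-1, 1}) (hQX : Q.X = 0) (e : P.V ≃ₗ[F] Q.V)
    (he : ∀ u, e (P.s u) = Q.s (e u)) : Iso P Q := by
  obtain ⟨D, hD⟩ := hP.exists_repr (Q.b.compl₁₂ e.toLinearMap e.toLinearMap)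
  have hD : ∀ u v, P.b u (D v) = Q.b (e u) (e v) := hD
  have hDs : ∀ v, D (P.s v) = P.s (D v) := by
    intro v
    refine sub_eq_zero.1 (hP.eq_zero_right fun u => ?_)
    obtain ⟨u, rfl⟩ := P.s_surjective u
    rw [map_sub, hD, P.b_s, hD, he, he, Q.b_s, sub_self]
  have hDadj : ∀ u v, P.b (D u) v = P.b u (D v) := fun u v => by
    rw [P.b_symm, hD, hD, ← Q.b_symm]
  have hDinj : Function.Injective D := by
    rw [injective_iff_map_eq_zero]
    intro v hv
    apply e.injective
    rw [map_zero]
    refine hQ.eq_zero_right fun u => ?_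
    obtain ⟨u, rfl⟩ := e.surjective u
    rw [← hD, hv, map_zero]
  obtain ⟨m, hm, hsm⟩ := P.s_order
  obtain ⟨m, rfl⟩ : ∃ k, m = k + 1 := Nat.exists_eq_succ_of_ne_zero (by rintro rfl; simp at hm)
  let s := P.s
  let t := P.s ^ m
  have hst : s * t = 1 := by rw [← hsm, pow_succ']
  have hts : t * s = 1 := by rw [← hsm, pow_succ]
  have hts' : ∀ u, s (t u) = u := fun u => congrArg (fun f => f u) hst
  have hst' : ∀ u, t (s u) = u := fun u => congrArg (fun f => f u) hts
  let A : Module.End F P.V := s - t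
  have hAadj : ∀ u v, P.b (A u) v = -P.b u (A v) := by
    intro u v
    have e1 : P.b (s u) v = P.b u (t v) := by rw [← P.b_s u (t v)]; exact congrArg _ (hts' v).symm
    have e2 : P.b (t u) v = P.b u (s v) := by
      rw [← P.b_s (t u) v]; exact congrArg (fun w => P.b w (s v)) (hts' u)
    simp only [A, LinearMap.sub_apply, map_sub, e1, e2]
    ring
  have hAinj : Function.Injective A := by
    rw [injective_iff_map_eq_zero]
    intro u hu
    refine (injective_iff_map_eq_zero _).1 hPa.sq_bijective.1 u ?_
    have : (P.s * P.s - 1 : Module.End F P.V) = s * A := by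
      rw [← hst, mul_sub]
    rw [this, Module.End.mul_apply, hu, map_zero]
  have hDs' : Commute D s := LinearMap.ext hDs
  have hDA : Commute D A := hDs'.sub_right (hDs'.pow_right m)
  let d := A * A
  let S : Set (Module.End F P.V) := {D, d}
  have hunit : ∀ {f : Module.End F P.V}, Function.Injective f → IsUnit f := fun hf =>
    (Module.End.isUnit_iff _).2 ⟨hf, LinearMap.surjective_of_injective hf⟩
  have hAs : Commute A s := by
    change (s - t) * s = s * (s - t)
    rw [sub_mul, mul_sub, hst, hts]
  have hcomm := commute_of_mem_adjoin_pair (F := F) (hDA.mul_right hDA)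
  have hcommA : ∀ x ∈ Algebra.adjoin F S, Commute x A := by
    intro x hx
    induction hx using Algebra.adjoin_induction with
    | mem x hx =>
      rcases hx with rfl | rfl
      · exact hDA
      · exact (Commute.refl A).mul_left (Commute.refl A)
    | algebraMap r => exact Algebra.commutes r A
    | add x y _ _ hx hy => exact hx.add_left hy
    | mul x y _ _ hx hy => exact hx.mul_left hy
  have hcommS : ∀ x ∈ Algebra.adjoin F S, Commute x s := by
    intro x hx
    induction hx using Algebra.adjoin_induction with
    | mem x hx =>
      rcases hx with rfl | rfl
      · exact hDs'
      · exact hAs.mul_left hAs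
    | algebraMap r => exact Algebra.commutes r s
    | add x y _ _ hx hy => exact hx.add_left hy
    | mul x y _ _ hx hy => exact hx.mul_left hy
  have hadj : ∀ x ∈ Algebra.adjoin F S, ∀ u v, P.b (x u) v = P.b u (x v) := by
    intro x hx
    induction hx using Algebra.adjoin_induction with
    | mem x hx =>
      rcases hx with rfl | rfl
      · exact hDadj
      · intro u v
        rw [Module.End.mul_apply, Module.End.mul_apply, hAadj, hAadj, neg_neg]
    | algebraMap r => intro u v; simp
    | add x y _ _ hx hy => intro u v; simp [hx, hy]
    | mul x y hx' hy' hx hy =>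
      intro u v
      rw [Module.End.mul_apply, hx, hy, ← Module.End.mul_apply, ← hcomm x hx' y hy']
  have : Finite P.V := Module.finite_of_finite F
  have : Finite (Module.End F P.V) := Module.finite_of_finite F
  obtain ⟨x, hx, y, hy, hxy⟩ := exists_sq_sub_mul_sq_adjoin h2 (hDA.mul_right hDA)
    (hunit hDinj) ((hunit hAinj).mul (hunit hAinj))
  have hyA := (hcommA y hy).eq
  have hadjm : x * y = y * x := hcomm x hx y hy
  let a := x + y * A
  have ha : (x - y * A) * a = D := by
    rw [← hxy]
    change (x - y * A) * (x + y * A) = _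
    have e1 : y * A * (y * A) = A * A * (y * y) := by
      rw [hyA, mul_assoc, ← mul_assoc y A y, hyA, mul_assoc A y y, ← mul_assoc]
    have e2 : x * (y * A) = y * A * x := by
      rw [← mul_assoc, hadjm, mul_assoc, mul_assoc, (hcommA x hx).eq]
    rw [sub_mul, mul_add, mul_add, e1, e2]
    abel
  have hab : ∀ u v, P.b (a u) (a v) = Q.b (e u) (e v) := by
    intro u v
    rw [← hD, ← ha, Module.End.mul_apply]
    generalize a v = w
    simp only [a, LinearMap.add_apply, LinearMap.sub_apply, Module.End.mul_apply, map_add, map_sub,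
      hadj x hx, hadj y hy, hAadj]
    have : A (y w) = y (A w) := (congrArg (fun f => f w) hyA).symm
    rw [this]
    ring
  have has : ∀ u, a (P.s u) = P.s (a u) := by
    intro u
    have : Commute a s := (hcommS x hx).add_left ((hcommS y hy).mul_left hAs)
    exact congrArg (fun f => f u) this.eq
  have hf : IsHom (P := Q) (Q := P) (a ∘ₗ e.symm.toLinearMap) := by
    refine ⟨fun u v => ?_, fun u => ?_, fun u => ?_⟩
    · simp [hab]
    · obtain ⟨u, rfl⟩ := e.surjective u
      simp [← he, has]
    · rw [hQX, hPa.1]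
      simp
  exact (hf.iso hQ e.finrank_eq.symm).symm

end FormSpace

end

/-! ### Semisimple isometries are classified by their characteristic polynomial -/

section

namespace FormSpace

variable {F : Type u} [Field F] {ε : F}

theorem iso_of_skew_scalar (h2 : (2 : F) ≠ 0) {P Q : FormSpace F (-1)} {a : F} (hP : P.Nondeg)
    (hPs : P.IsScalar a) (hQ : Q.Nondeg) (hQs : Q.IsScalar a)
    (h : Module.finrank F P.V = Module.finrank F Q.V) : Iso P Q := by
  obtain ⟨f, hf⟩ := iso_of_skew h2 (P := bare P.V P.b P.b_symm) (Q := bare Q.V Q.b Q.b_symm)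
    hP (isScalar_bare _) hQ (isScalar_bare _) h
  exact ⟨f, hPs.isHom hQs hf.b⟩

/-- A linear isomorphism commuting with the isometries. -/
def Equivariant (P Q : FormSpace F ε) : Prop :=
  ∃ e : P.V ≃ₗ[F] Q.V, ∀ u, e (P.s u) = Q.s (e u)

theorem Iso.equivariant {P Q : FormSpace F ε} : Iso P Q → Equivariant P Q :=
  fun ⟨f, hf⟩ => ⟨f, hf.s⟩

theorem Equivariant.trans {P Q R : FormSpace F ε} :
    Equivariant P Q → Equivariant Q R → Equivariant P R :=
  fun ⟨e, he⟩ ⟨f, hf⟩ => ⟨e.trans f, fun u => by simp [he, hf]⟩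

theorem Equivariant.split {a : F} {T : Set F} {P₁ P₂ Q₁ Q₂ : FormSpace F ε} (hP₁ : P₁.IsScalar a)
    (hP₂ : P₂.Avoids (insert a T)) (hQ₁ : Q₁.IsScalar a) (hQ₂ : Q₂.Avoids (insert a T)) :
    Equivariant (P₁.sum P₂) (Q₁.sum Q₂) →
      Module.finrank F P₁.V = Module.finrank F Q₁.V ∧ Equivariant P₂ Q₂ := by
  rintro ⟨f, hf⟩
  obtain ⟨f₁, f₂, h⟩ := split_unique hP₁ hP₂ hQ₁ hQ₂ f hf
  refine ⟨f₁.finrank_eq, f₂, fun v => ?_⟩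
  have h1 := hf (0, v)
  rw [h, h] at h1
  exact congrArg Prod.snd h1

theorem Equivariant.iso [Finite F] (h2 : (2 : F) ≠ 0) {P Q : FormSpace F (-1)} (hP : P.Nondeg)
    (hQ : Q.Nondeg) (hPX : P.X = 0) (hQX : Q.X = 0) (h : Equivariant P Q) : Iso P Q := by
  obtain ⟨P₁, P₂, hP₁, hP₁s, hP₂, hP₂s, hPi⟩ := exists_split (a := 1) (by simp) hP
    (T := ∅) ⟨hPX, by simp⟩
  obtain ⟨P₃, P₄, hP₃, hP₃s, hP₄, hP₄s, hPi'⟩ := exists_split (a := -1) (by simp) hP₂ hP₂s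
  obtain ⟨Q₁, Q₂, hQ₁, hQ₁s, hQ₂, hQ₂s, hQi⟩ := exists_split (a := 1) (by simp) hQ
    (T := ∅) ⟨hQX, by simp⟩
  obtain ⟨Q₃, Q₄, hQ₃, hQ₃s, hQ₄, hQ₄s, hQi'⟩ := exists_split (a := -1) (by simp) hQ₂ hQ₂s
  obtain ⟨hd, h'⟩ := Equivariant.split hP₁s hP₂s hQ₁s hQ₂s
    ((hPi.equivariant.trans h).trans hQi.symm.equivariant)
  obtain ⟨hd', e, he⟩ := Equivariant.split hP₃s hP₄s hQ₃s hQ₄s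
    ((hPi'.equivariant.trans h').trans hQi'.symm.equivariant)
  rw [insert_empty_eq] at hP₄s
  have i1 := iso_of_skew_scalar h2 hP₁ hP₁s hQ₁ hQ₁s hd
  have i2 := iso_of_skew_scalar h2 hP₃ hP₃s hQ₃ hQ₃s hd'
  have i3 := iso_of_equivariant h2 hP₄ hQ₄ hP₄s hQ₄s.1 e he
  exact hPi.symm.trans ((i1.sum (hPi'.symm.trans ((i2.sum i3).trans hQi'))).trans hQi)

theorem iso_of_charpoly_eq [Finite F] (h2 : (2 : F) ≠ 0) {P Q : FormSpace F (-1)} (hP : P.Nondeg)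
    (hQ : Q.Nondeg) (hPX : P.X = 0) (hQX : Q.X = 0)
    (h : LinearMap.charpoly P.s = LinearMap.charpoly Q.s) : Iso P Q :=
  Equivariant.iso h2 hP hQ hPX hQX (exists_equiv_of_charpoly_eq P.s_semisimple Q.s_semisimple h)

end FormSpace

end

/-! ### Construction of semisimple isometries -/

section

open Polynomial
open scoped ENNReal

namespace FormSpace

variable {F : Type u} [Field F] {ε : F}

theorem charpoly_pow_card_pow [Fintype F] {V : Type*} [AddCommGroup V] [Module F V]
    [FiniteDimensional F V] (f : Module.End F V) (n : ℕ) :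
    LinearMap.charpoly (f ^ Fintype.card F ^ n) = LinearMap.charpoly f := by
  induction n with
  | zero => simp
  | succ n ih =>
    rw [pow_succ, pow_mul, ← ih, ← LinearMap.charpoly_toMatrix _ (Module.finBasis F V),
      ← LinearMap.toMatrix_pow, FiniteField.Matrix.charpoly_pow_card, LinearMap.charpoly_toMatrix]

section Double

variable {W : Type u} [CommRing W] [Algebra F W]

/-- The alternating form on `W × W` attached to a linear form on the algebra `W`. -/
def doubleForm (l : W →ₗ[F] F) : (W × W) →ₗ[F] (W × W) →ₗ[F] F :=
  LinearMap.mk₂ F (fun u v => l (u.1 * v.2 - u.2 * v.1))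
    (fun u u' v => by rw [← map_add]; congr 1; simp only [Prod.fst_add, Prod.snd_add]; ring)
    (fun c u v => by rw [← map_smul, smul_sub]; simp)
    (fun u v v' => by rw [← map_add]; congr 1; simp only [Prod.fst_add, Prod.snd_add]; ring)
    (fun c u v => by rw [← map_smul, smul_sub]; simp)

theorem doubleForm_apply (l : W →ₗ[F] F) (u v : W × W) :
    doubleForm l u v = l (u.1 * v.2 - u.2 * v.1) := rfl

/-- An isometry of `doubleForm` whose sum with its inverse is multiplication by `w`. -/
def doubleIsometry (F : Type u) [Field F] {W : Type u} [CommRing W] [Algebra F W] (w : W) :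
    Module.End F (W × W) :=
  (-LinearMap.snd F W W).prod (LinearMap.fst F W W + LinearMap.mulLeft F w ∘ₗ LinearMap.snd F W W)

/-- The inverse of `doubleIsometry`. -/
def doubleIsometryInv (F : Type u) [Field F] {W : Type u} [CommRing W] [Algebra F W] (w : W) :
    Module.End F (W × W) :=
  (LinearMap.mulLeft F w ∘ₗ LinearMap.fst F W W + LinearMap.snd F W W).prod (-LinearMap.fst F W W)

theorem doubleIsometry_mul_inv (w : W) : doubleIsometry F w * doubleIsometryInv F w = 1 := by
  refine LinearMap.ext fun u => Prod.ext ?_ ?_ <;>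
    simp [doubleIsometry, doubleIsometryInv]

theorem doubleIsometryInv_mul (w : W) : doubleIsometryInv F w * doubleIsometry F w = 1 := by
  refine LinearMap.ext fun u => Prod.ext ?_ ?_ <;>
    simp [doubleIsometry, doubleIsometryInv]

theorem doubleIsometry_add_inv (w : W) : doubleIsometry F w + doubleIsometryInv F w =
    (LinearMap.mulLeft F w).prodMap (LinearMap.mulLeft F w) := by
  refine LinearMap.ext fun u => Prod.ext ?_ ?_ <;>
    simp [doubleIsometry, doubleIsometryInv]

theorem doubleForm_doubleIsometry (l : W →ₗ[F] F) (w : W) (u v : W × W) :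
    doubleForm l (doubleIsometry F w u) (doubleIsometry F w v) = doubleForm l u v := by
  simp only [doubleForm_apply, doubleIsometry]
  congr 1
  simp
  ring

theorem exists_charpoly_eq_sq [Fintype F] [FiniteDimensional F W] {l : W →ₗ[F] F}
    (hl : ∀ u, (∀ v, l (u * v) = 0) → u = 0) (w : W) : ∃ P : FormSpace F (-1), P.Nondeg ∧ P.X = 0 ∧
      Module.finrank F P.V = 2 * Module.finrank F W ∧ ∃ t, P.s * t = 1 ∧
        LinearMap.charpoly (P.s + t) = LinearMap.charpoly (LinearMap.mulLeft F w) ^ 2 := by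
  obtain ⟨p, hp⟩ := CharP.exists F
  obtain ⟨k, hprime, hk⟩ := FiniteField.card F p
  have : Fact p.Prime := ⟨hprime⟩
  have : Finite W := Module.finite_of_finite F
  have : Finite (Module.End F (W × W)) := Module.finite_of_finite F
  obtain ⟨N, hN, hsN⟩ : ∃ N ≠ 0, doubleIsometry F w ^ N = 1 := by
    let u : (Module.End F (W × W))ˣ :=
      ⟨doubleIsometry F w, doubleIsometryInv F w, doubleIsometry_mul_inv w, doubleIsometryInv_mul w⟩
    exact ⟨Nat.card (Module.End F (W × W))ˣ, Nat.card_pos.ne',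
      congrArg Units.val (pow_card_eq_one' (x := u))⟩
  obtain ⟨a, N', hN', rfl⟩ := Nat.exists_eq_pow_mul_and_not_dvd hN p hprime.ne_one
  let Q := Fintype.card F ^ a
  have hQ : Q = p ^ (k * a) := by simp only [Q, hk, pow_mul]
  have hb : ∀ n u v, doubleForm l ((doubleIsometry F w ^ n) u) ((doubleIsometry F w ^ n) v) =
      doubleForm l u v := by
    intro n u v
    induction n with
    | zero => rfl
    | succ n ih =>
      rw [pow_succ', Module.End.mul_apply, Module.End.mul_apply, doubleForm_doubleIsometry, ih]
  let P : FormSpace F (-1) :=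
    { V := W × W
      b := doubleForm l
      s := doubleIsometry F w ^ Q
      X := 0
      b_symm := fun u v => by
        rw [doubleForm_apply, doubleForm_apply, neg_one_mul, ← map_neg]
        congr 1
        ring
      b_s := hb Q
      b_X := by simp
      s_X := by simp
      s_order := by
        refine ⟨N', fun h => hN' ((CharP.cast_eq_zero_iff F p N').1 h), ?_⟩
        obtain ⟨c, hc⟩ := pow_dvd_pow p (Nat.le_mul_of_pos_left a k.pos)
        rw [← pow_mul, hQ, hc, mul_right_comm, pow_mul, hsN, one_pow]
      X_nil := IsNilpotent.zero }
  have hcomm : Commute (doubleIsometry F w) (doubleIsometryInv F w) := by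
    rw [Commute, SemiconjBy, doubleIsometry_mul_inv, doubleIsometryInv_mul]
  refine ⟨P, fun u hu => ?_, rfl, ?_, doubleIsometryInv F w ^ Q, ?_, ?_⟩
  · refine Prod.ext (hl _ fun v => ?_) (hl _ fun v => ?_)
    · have := hu (0, v)
      change l (u.1 * v - u.2 * 0) = 0 at this
      simpa using this
    · have := hu (-v, 0)
      change l (u.1 * 0 - u.2 * -v) = 0 at this
      simpa using this
  · rw [Module.finrank_prod, two_mul]
  · change doubleIsometry F w ^ Q * doubleIsometryInv F w ^ Q = 1
    rw [← hcomm.mul_pow, doubleIsometry_mul_inv, one_pow]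
  · change LinearMap.charpoly (doubleIsometry F w ^ Q + doubleIsometryInv F w ^ Q) = _
    have h1 : (doubleIsometry F w + doubleIsometryInv F w) ^ Q =
        doubleIsometry F w ^ Q + doubleIsometryInv F w ^ Q := by
      rcases subsingleton_or_nontrivial W with _ | _
      · exact Subsingleton.elim _ _
      · have := charP_of_injective_algebraMap
          (FaithfulSMul.algebraMap_injective F (Module.End F (W × W))) p
        rw [hQ]
        exact add_pow_char_pow_of_commute p _ hcomm
    rw [← h1, charpoly_pow_card_pow, doubleIsometry_add_inv, LinearMap.charpoly_prodMap, sq]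

end Double

theorem Iso.charpoly_eq {P Q : FormSpace F ε} {t : Module.End F P.V} {t' : Module.End F Q.V}
    (ht : P.s * t = 1) (ht' : Q.s * t' = 1) :
    Iso P Q → LinearMap.charpoly (P.s + t) = LinearMap.charpoly (Q.s + t') := by
  rintro ⟨f, hf⟩
  refine charpoly_eq_of_equiv f fun u => ?_
  have h1 : f (t u) = t' (f u) := by
    apply Q.s_bijective.1
    have e1 : P.s (t u) = u := congrArg (fun g => g u) ht
    have e2 : Q.s (t' (f u)) = f u := congrArg (fun g => g (f u)) ht'
    rw [e2]
    exact (hf.s (t u)).symm.trans (congrArg f e1)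
  have h2 : f (P.s u) = Q.s (f u) := hf.s u
  rw [LinearMap.add_apply, map_add, h1, h2, LinearMap.add_apply]

theorem exists_linearForm {f : F[X]} (hf : f.Monic) :
    ∃ l : AdjoinRoot f →ₗ[F] F, ∀ u, (∀ v, l (u * v) = 0) → u = 0 := by
  refine ⟨lcoeff F (f.natDegree - 1) ∘ₗ AdjoinRoot.modByMonicHom hf, fun u hu => ?_⟩
  obtain ⟨p, rfl⟩ := AdjoinRoot.mk_surjective u
  by_contra h0
  let r := p %ₘ f
  have hr : AdjoinRoot.mk f p = AdjoinRoot.mk f r := by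
    change _ = AdjoinRoot.mk f (p %ₘ f)
    rw [← AdjoinRoot.modByMonicHom_mk hf p, AdjoinRoot.mk_leftInverse hf]
  have hr0 : r ≠ 0 := fun h => h0 (by rw [hr, h, map_zero])
  have hlt : r.natDegree < f.natDegree := natDegree_lt_natDegree hr0 (degree_modByMonic_lt p hf)
  have h1 := hu (AdjoinRoot.mk f (Polynomial.X ^ (f.natDegree - 1 - r.natDegree)))
  rw [hr, ← map_mul, LinearMap.comp_apply, AdjoinRoot.modByMonicHom_mk,
    (modByMonic_eq_self_iff hf).2, lcoeff_apply] at h1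
  · have h2 : f.natDegree - 1 = r.natDegree + (f.natDegree - 1 - r.natDegree) := by omega
    rw [h2] at h1
    simp [coeff_mul_X_pow] at h1
    exact hr0 h1
  · apply degree_lt_degree
    rw [natDegree_mul_X_pow _ hr0]
    omega

theorem charpoly_mulLeft_root {f : F[X]} (hf : f.Monic) [FiniteDimensional F (AdjoinRoot f)] :
    LinearMap.charpoly (LinearMap.mulLeft F (AdjoinRoot.root f)) = f := by
  rw [← LinearMap.charpoly_toMatrix _ (AdjoinRoot.powerBasis' hf).basis, Algebra.toMatrix_lmul_eq,
    ← AdjoinRoot.powerBasis'_gen hf, charpoly_leftMulMatrix, AdjoinRoot.powerBasis'_gen,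
    AdjoinRoot.minpoly_root hf.ne_zero, hf.leadingCoeff]
  simp

end FormSpace

end

/-! ### Counting semisimple isometries -/

section

open Polynomial
open scoped ENNReal

theorem tsum_ite_eq_card {α : Type*} (p : α → Prop) [DecidablePred p] :
    ∑' x, (if p x then (1 : ℝ≥0∞) else 0) = ENat.card {x // p x} := by
  rw [← ENNReal.tsum_one]
  refine Eq.trans (tsum_congr fun x => ?_) (tsum_subtype {x | p x} fun _ => (1 : ℝ≥0∞)).symm
  simp only [Set.indicator_apply, Set.mem_ofPred_eq]

namespace FormSpace

variable {F : Type u} [Field F] {ε : F}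

theorem exists_charpoly_s_add_inv_eq [Fintype F] {f : F[X]} (hf : f.Monic) :
    ∃ P : FormSpace F (-1), P.Nondeg ∧ P.X = 0 ∧ Module.finrank F P.V = 2 * f.natDegree ∧
      ∃ t, P.s * t = 1 ∧ LinearMap.charpoly (P.s + t) = f ^ 2 := by
  have := (AdjoinRoot.powerBasis' hf).finite
  obtain ⟨l, hl⟩ := exists_linearForm hf
  obtain ⟨P, hP, hX, hdim, t, ht, hc⟩ := exists_charpoly_eq_sq hl (AdjoinRoot.root f)
  refine ⟨P, hP, hX, ?_, t, ht, ?_⟩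
  · rw [hdim, (AdjoinRoot.powerBasis' hf).finrank, AdjoinRoot.powerBasis'_dim]
  · rw [hc, charpoly_mulLeft_root hf]

theorem card_ssCls [Fintype F] (h2 : (2 : F) ≠ 0) (j : ℕ) :
    ENat.card {c : SSCls (-1 : F) // c.1.dim = 2 * j} = (Fintype.card F : ℕ∞) ^ j := by
  have hrep : ∀ c : {c : SSCls (-1 : F) // c.1.dim = 2 * j}, ∃ P : FormSpace F (-1), ∃ hP,
      P.X = 0 ∧ Module.finrank F P.V = 2 * j ∧ toCls P hP = c.1.1 := by
    rintro ⟨⟨c, hc⟩, hj⟩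
    obtain ⟨P, hP, rfl⟩ := c.exists_rep
    exact ⟨P, hP, (kdim_eq_finrank_iff P).1 hc, hj, rfl⟩
  choose P hP hX hdim hcls using hrep
  let φ : {c : SSCls (-1 : F) // c.1.dim = 2 * j} → Fin j → F :=
    fun c i => (LinearMap.charpoly (P c).s).coeff (i + 1)
  have hφ : Function.Injective φ := fun c c' h => by
    apply Subtype.ext
    apply Subtype.ext
    rw [← hcls c, ← hcls c', toCls_eq]
    refine iso_of_charpoly_eq h2 (hP c) (hP c') (hX c) (hX c') ?_
    exact charpoly_s_ext h2 (hP c) (hP c') (hdim c) (hdim c') fun i hi => congrFun h ⟨i, hi⟩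
  let g : (Fin j → F) → F[X] := fun a => Polynomial.X ^ j + ((degreeLTEquiv F j).symm a : F[X])
  have hlt : ∀ a, (((degreeLTEquiv F j).symm a : F[X])).degree < j := fun a =>
    mem_degreeLT.1 (Subtype.prop _)
  have hg : ∀ a, (g a).Monic := fun a => monic_X_pow_add (hlt a)
  have hgdeg : ∀ a, (g a).natDegree = j := fun a => by
    refine natDegree_eq_of_degree_eq_some ?_
    rw [degree_add_eq_left_of_degree_lt, degree_X_pow]
    rw [degree_X_pow]
    exact hlt a
  have hginj : Function.Injective g := fun a a' h =>
    (degreeLTEquiv F j).symm.injective (Subtype.ext (add_left_cancel h))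
  choose Q hQ hQX hQdim t ht hQt using fun a => exists_charpoly_s_add_inv_eq (hg a)
  let ψ : (Fin j → F) → {c : SSCls (-1 : F) // c.1.dim = 2 * j} := fun a =>
    ⟨⟨toCls (Q a) (hQ a), (kdim_eq_finrank_iff _).2 (hQX a)⟩, (hQdim a).trans (by rw [hgdeg])⟩
  have hψ : Function.Injective ψ := fun a a' h => by
    have h1 : Iso (Q a) (Q a') := toCls_eq.1 (congrArg (fun c => c.1.1) h)
    have h3 := h1.charpoly_eq (ht a) (ht a')
    rw [hQt, hQt, (Commute.all _ _).sq_eq_sq_iff_eq_or_eq_neg] at h3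
    apply hginj
    rcases h3 with h3 | h3
    · exact h3
    · have h4 := congrArg leadingCoeff h3
      rw [leadingCoeff_neg, (hg a).leadingCoeff, (hg a').leadingCoeff] at h4
      exact absurd (by linear_combination h4) h2
  obtain ⟨e, he⟩ := Function.Embedding.schroeder_bernstein hφ hψ
  rw [ENat.card_congr (Equiv.ofBijective e he), ENat.card_eq_coe_fintype_card]
  simp

end FormSpace

end

/-! ### The Cayley transform -/

section

open scoped ENNReal Matrix

theorem pow_char_pow_eq_self {A : Type*} [Monoid A] {p m : ℕ} (hp : p.Prime) (hm : ¬ p ∣ m) {s : A}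
    (hs : s ^ m = 1) (k : ℕ) : s ^ p ^ (m.totient * k) = s := by
  rw [pow_mul]
  conv_rhs => rw [← pow_one s, ← one_pow k]
  exact pow_eq_pow_of_modEq ((Nat.ModEq.pow_totient ((hp.coprime_iff_not_dvd).2 hm)).pow k) hs

/-- The semisimple part `s` of `G = s (1 + X) (1 - X)⁻¹` is a power of `G`. -/
theorem exists_pow_eq_semisimple {A : Type*} [Ring A] {p m : ℕ} [CharP A p] [Fact p.Prime]
    {s X G : A} (hsX : Commute s X) (hX : IsNilpotent X) (hs : s ^ m = 1) (hm : ¬ p ∣ m)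
    (hG : G * (1 - X) = s * (1 + X)) : ∃ a ≠ 0, ∀ k ≠ 0, G ^ p ^ (a * k) = s := by
  have hp : p.Prime := Fact.out
  obtain ⟨N, hN⟩ := hX
  have hm0 : m ≠ 0 := by
    rintro rfl
    exact hm (dvd_zero p)
  have hGX : Commute G X := by
    have h1 : Commute (1 - X) X := (Commute.one_left X).sub_left (Commute.refl X)
    have h2 : Commute (1 + X) X := (Commute.one_left X).add_left (Commute.refl X)
    apply (IsNilpotent.isUnit_one_sub ⟨N, hN⟩).mul_right_cancel
    rw [mul_assoc, ← h1.eq, ← mul_assoc, hG, mul_assoc X, hG]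
    exact (hsX.mul_left h2).eq
  refine ⟨m.totient * (N + 1), mul_ne_zero (by simpa using hm0) (Nat.succ_ne_zero N),
    fun k hk => ?_⟩
  rw [mul_assoc]
  have hle : N ≤ p ^ (m.totient * ((N + 1) * k)) := calc
    N ≤ m.totient * ((N + 1) * k) := by
      have h1 : 1 ≤ m.totient := Nat.totient_pos.2 (Nat.pos_of_ne_zero hm0)
      have h2 : 1 ≤ k := Nat.pos_of_ne_zero hk
      nlinarith [Nat.mul_le_mul h1 (Nat.mul_le_mul (Nat.le_succ N) h2)]
    _ ≤ _ := (Nat.lt_pow_self hp.one_lt).le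
  have key := congrArg (· ^ p ^ (m.totient * ((N + 1) * k))) hG
  rwa [((Commute.one_right G).sub_right hGX).mul_pow, ((Commute.one_right s).add_right hsX).mul_pow,
    sub_pow_char_pow_of_commute p _ (Commute.one_left X),
    add_pow_char_pow_of_commute p _ (Commute.one_left X), pow_eq_zero_of_le hle hN, one_pow,
    sub_zero, add_zero, mul_one, mul_one, pow_char_pow_eq_self hp hm hs] at key

/-- Every element `G` of finite order is `s (1 + X) (1 - X)⁻¹` with `s` a power of `G` whose order
is prime to the characteristic and `X` nilpotent. -/
theorem exists_pow_cayley {A : Type*} [Ring A] {p : ℕ} [CharP A p] [Fact p.Prime]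
    (h2 : IsUnit (2 : A)) {G : A} {N : ℕ} (hN : N ≠ 0) (hG : G ^ N = 1) :
    ∃ e m X, ¬ p ∣ m ∧ (G ^ e) ^ m = 1 ∧ IsNilpotent X ∧ Commute G X ∧ IsUnit (G + G ^ e) ∧
      (G + G ^ e) * X = G - G ^ e := by
  have hp : p.Prime := Fact.out
  obtain ⟨a, m, hm, rfl⟩ := Nat.exists_eq_pow_mul_and_not_dvd hN p hp.ne_one
  have hm0 : m.totient ≠ 0 := by
    rw [Ne, Nat.totient_eq_zero]
    rintro rfl
    exact hm (dvd_zero p)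
  let e := p ^ (m.totient * a)
  have hem : (G ^ e) ^ m = 1 := by
    obtain ⟨c, hc⟩ := pow_dvd_pow p (Nat.le_mul_of_pos_left a (Nat.pos_of_ne_zero hm0))
    rw [← pow_mul, show e = _ from hc, mul_right_comm, pow_mul, hG, one_pow]
  have hGe : Commute G (G ^ e) := (Commute.refl G).pow_right e
  have hnil : IsNilpotent (G - G ^ e) :=
    ⟨e, by rw [sub_pow_char_pow_of_commute p _ hGe, pow_char_pow_eq_self hp hm hem, sub_self]⟩
  have hunit : IsUnit (G + G ^ e) := by
    have h1 : G + G ^ e = 2 * G ^ e + (G - G ^ e) := by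
      rw [two_mul]
      abel
    rw [h1]
    refine hnil.isUnit_add_left_of_commute (h2.mul ?_) ?_
    · exact IsUnit.of_pow_eq_one hem fun h => hm (h ▸ dvd_zero p)
    · have := hGe.sub_left (Commute.refl (G ^ e))
      exact ((Commute.ofNat_right _ 2)).mul_right this
  obtain ⟨w, hw⟩ := hunit
  have hGw : Commute G (w⁻¹ : Aˣ) := by
    apply Commute.units_inv_right
    rw [hw]
    exact (Commute.refl G).add_right hGe
  have hew : Commute (G ^ e) (w⁻¹ : Aˣ) := hGw.pow_left e
  refine ⟨e, m, (w⁻¹ : Aˣ) * (G - G ^ e), hm, hem, ?_, ?_, hw ▸ w.isUnit, ?_⟩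
  · exact ((hGw.sub_left hew).symm).isNilpotent_mul_left hnil
  · exact hGw.mul_right ((Commute.refl G).sub_right hGe)
  · rw [← hw, Units.mul_inv_cancel_left]

namespace FormSpace

variable {F : Type u} [Field F] {ε : F}

/-- `G` is the product of `P.s` and the Cayley transform of `P.X`. -/
def IsCayley (P : FormSpace F ε) (G : Module.End F P.V) : Prop :=
  G * (1 - P.X) = P.s * (1 + P.X)

theorem exists_isCayley (P : FormSpace F ε) : ∃ G, P.IsCayley G := by
  obtain ⟨w, hw⟩ := P.X_nil.isUnit_one_sub
  exact ⟨P.s * (1 + P.X) * (w⁻¹ : (Module.End F P.V)ˣ), by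
    rw [IsCayley, ← hw, Units.inv_mul_cancel_right]⟩

namespace IsCayley

theorem isometry {P : FormSpace F ε} {G : Module.End F P.V} (hG : P.IsCayley G) (u v : P.V) :
    P.b (G u) (G v) = P.b u v := by
  have hsurj : Function.Surjective ⇑(1 - P.X : Module.End F P.V) :=
    ((Module.End.isUnit_iff _).1 P.X_nil.isUnit_one_sub).2
  have hG' : ∀ u, G (u - P.X u) = P.s (u + P.X u) := fun u => congrArg (fun g => g u) hG
  obtain ⟨u, rfl⟩ := hsurj u
  obtain ⟨v, rfl⟩ := hsurj v
  change P.b (G (u - P.X u)) (G (v - P.X v)) = P.b (u - P.X u) (v - P.X v)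
  rw [hG', hG', P.b_s]
  simp only [map_add, map_sub, LinearMap.add_apply, LinearMap.sub_apply]
  linear_combination 2 * P.b_X u v

theorem exists_pow_eq {p : ℕ} [CharP F p] [Fact p.Prime] {P : FormSpace F ε} {G : Module.End F P.V}
    (hG : P.IsCayley G) : ∃ a ≠ 0, ∀ k ≠ 0, G ^ p ^ (a * k) = P.s := by
  rcases subsingleton_or_nontrivial P.V with _ | _
  · exact ⟨1, one_ne_zero, fun _ _ => Subsingleton.elim _ _⟩
  have := charP_of_injective_algebraMap
    (FaithfulSMul.algebraMap_injective F (Module.End F P.V)) p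
  obtain ⟨m, hm, hs⟩ := P.s_order
  exact exists_pow_eq_semisimple (LinearMap.ext P.s_X) P.X_nil hs
    (fun h => hm ((CharP.cast_eq_zero_iff F p m).2 h)) hG

theorem isHom [Finite F] (h2 : (2 : F) ≠ 0) {P Q : FormSpace F ε} {G : Module.End F P.V}
    {H : Module.End F Q.V} (hG : P.IsCayley G) (hH : Q.IsCayley H) {f : P.V →ₗ[F] Q.V}
    (hb : ∀ u v, Q.b (f u) (f v) = P.b u v) (hf : ∀ u, f (G u) = H (f u)) : IsHom f := by
  obtain ⟨p, hp⟩ := CharP.exists F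
  have : Fact p.Prime := ⟨CharP.char_is_prime F p⟩
  obtain ⟨a, ha, hGa⟩ := hG.exists_pow_eq (p := p)
  obtain ⟨c, hc, hHc⟩ := hH.exists_pow_eq (p := p)
  have hpow : ∀ n u, f ((G ^ n) u) = (H ^ n) (f u) := by
    intro n u
    induction n with
    | zero => rfl
    | succ n ih => rw [pow_succ', pow_succ', Module.End.mul_apply, Module.End.mul_apply, hf, ih]
  have hs : ∀ u, f (P.s u) = Q.s (f u) := fun u => by
    rw [← hGa c hc, hpow, mul_comm, hHc a ha]
  refine ⟨hb, hs, fun u => ?_⟩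
  have hG' : ∀ u, G (u - P.X u) = P.s (u + P.X u) := fun u => congrArg (fun g => g u) hG
  have hH' : ∀ u, H (u - Q.X u) = Q.s (u + Q.X u) := fun u => congrArg (fun g => g u) hH
  have h1 := congrArg f (hG' u)
  have h3 := hH' (f u)
  simp only [map_sub, map_add, hf, hs] at h1 h3
  have hinj : ∀ v, H v + Q.s v = 0 → v = 0 := by
    intro v hv
    obtain ⟨v, rfl⟩ := ((Module.End.isUnit_iff _).1 Q.X_nil.isUnit_one_sub).2 v
    have h5 := hH' v
    change H (v - Q.X v) + Q.s (v - Q.X v) = 0 at hv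
    rw [h5, ← map_add, map_eq_zero_iff _ Q.s_bijective.1, add_add_sub_cancel, ← two_smul F,
      smul_eq_zero] at hv
    rw [hv.resolve_left h2, map_zero]
  rw [← sub_eq_zero]
  refine hinj _ ?_
  rw [map_sub, map_sub]
  linear_combination (norm := module) h3 - h1

end IsCayley

theorem IsHom.isCayley {P Q : FormSpace F ε} {G : Module.End F P.V}
    {H : Module.End F Q.V} (hG : P.IsCayley G) (hH : Q.IsCayley H) {f : P.V →ₗ[F] Q.V}
    (hf : IsHom f) (u : P.V) : f (G u) = H (f u) := by
  obtain ⟨u, rfl⟩ := ((Module.End.isUnit_iff _).1 P.X_nil.isUnit_one_sub).2 u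
  have hG' : ∀ u, G (u - P.X u) = P.s (u + P.X u) := fun u => congrArg (fun g => g u) hG
  have hH' : ∀ u, H (u - Q.X u) = Q.s (u + Q.X u) := fun u => congrArg (fun g => g u) hH
  change f (G (u - P.X u)) = H (f (u - P.X u))
  rw [hG', map_sub, hf.X, hH', hf.s, map_add, hf.X]

/-- Every isometry of a nondegenerate form over a finite field of odd characteristic is of the form
`s (1 + X) (1 - X)⁻¹`. -/
theorem exists_isCayley_of_isometry [Finite F] (h2 : (2 : F) ≠ 0) {V : Type u} [AddCommGroup V]
    [Module F V] [FiniteDimensional F V] {b : V →ₗ[F] V →ₗ[F] F} (hb : ∀ u v, b u v = ε * b v u)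
    {G : Module.End F V} (hG : ∀ u v, b (G u) (G v) = b u v) {N : ℕ} (hN : N ≠ 0)
    (hGN : G ^ N = 1) : ∃ s X h₁ h₂ h₃ h₄ h₅, IsCayley ⟨V, b, s, X, hb, h₁, h₂, h₃, h₄, h₅⟩ G := by
  obtain ⟨p, hp⟩ := CharP.exists F
  have : Fact p.Prime := ⟨CharP.char_is_prime F p⟩
  rcases subsingleton_or_nontrivial V with _ | _
  · exact ⟨1, 0, fun _ _ => rfl, fun u v => by simp, fun u => by simp, ⟨1, by simp⟩,
      IsNilpotent.zero, Subsingleton.elim _ _⟩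
  have := charP_of_injective_algebraMap
    (FaithfulSMul.algebraMap_injective F (Module.End F V)) p
  have h2' : IsUnit (2 : Module.End F V) := by
    rw [← map_ofNat (algebraMap F (Module.End F V)) 2]
    exact (IsUnit.mk0 _ h2).map _
  obtain ⟨e, m, X, hm, hem, hX, hGX, hunit, h⟩ := exists_pow_cayley (p := p) h2' hN hGN
  have hpow : ∀ n u v, b ((G ^ n) u) ((G ^ n) v) = b u v := by
    intro n u v
    induction n with
    | zero => rfl
    | succ n ih => rw [pow_succ', Module.End.mul_apply, Module.End.mul_apply, hG, ih]
  have hsX : Commute (G ^ e) X := hGX.pow_left e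
  refine ⟨G ^ e, X, hpow e, fun u v => ?_, fun u => congrArg (fun g => g u) hsX.eq,
    ⟨m, fun hm' => hm ((CharP.cast_eq_zero_iff F p m).1 hm'), hem⟩, hX, ?_⟩
  · have hsurj := ((Module.End.isUnit_iff _).1 hunit).2
    have hXG : ∀ w, X ((G + G ^ e) w) = G w - (G ^ e) w := fun w => by
      rw [← LinearMap.sub_apply, ← h]
      exact congrArg (fun g => g w) (hGX.add_left hsX).symm.eq
    obtain ⟨u, rfl⟩ := hsurj u
    obtain ⟨v, rfl⟩ := hsurj v
    rw [hXG, hXG]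
    simp only [LinearMap.add_apply, map_add, map_sub, LinearMap.sub_apply, hG, hpow]
    ring
  · change G * (1 - X) = G ^ e * (1 + X)
    rw [add_mul] at h
    rw [mul_sub, mul_add, mul_one, mul_one, sub_eq_iff_eq_add, add_assoc, add_comm _ (G * X), h]
    abel

end FormSpace

end

/-! ### Conjugacy classes of the symplectic group -/

section

open scoped ENNReal Matrix

namespace FormSpace

variable {F : Type u} [Field F]

theorem exists_mulVec_eq {n : ℕ} (φ : Module.End F (Fin n ⊕ Fin n → F))
    (hφ : ∀ u v, sympForm n (φ u) (φ v) = sympForm n u v) :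
    ∃ g : Sp n F, ∀ v, g.1.1 *ᵥ v = φ v := by
  have hmul : ∀ v, LinearMap.toMatrix' φ *ᵥ v = φ v := fun v => by
    rw [← Matrix.toLin'_apply, Matrix.toLin'_toMatrix']
  have hM : (LinearMap.toMatrix' φ)ᵀ * sympJ n F * LinearMap.toMatrix' φ = sympJ n F := by
    rw [sympForm_preserved_iff]
    intro u v
    rw [hmul, hmul, hφ]
  have hinv : -sympJ n F * ((LinearMap.toMatrix' φ)ᵀ * sympJ n F) * LinearMap.toMatrix' φ = 1 := by
    rw [mul_assoc, hM, neg_mul, sympJ_mul_self, neg_neg]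
  exact ⟨⟨⟨_, _, mul_eq_one_comm.1 hinv, hinv⟩, hM⟩, hmul⟩

/-- Coordinates identifying the isometry attached to `P` with the symplectic matrix `g`. -/
def IsModel {n : ℕ} (g : Sp n F) (P : FormSpace F (-1)) (G : Module.End F P.V)
    (f : P.V ≃ₗ[F] (Fin n ⊕ Fin n → F)) : Prop :=
  P.IsCayley G ∧ (∀ u v, sympForm n (f u) (f v) = P.b u v) ∧ ∀ u, f (G u) = g.1.1 *ᵥ f u

theorem exists_isModel [Finite F] (h2 : (2 : F) ≠ 0) {n : ℕ} (g : Sp n F) :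
    ∃ P : FormSpace F (-1), P.Nondeg ∧ Module.finrank F P.V = 2 * n ∧ ∃ G f, IsModel g P G f := by
  have hpow : ∀ k, Matrix.toLin' g.1.1 ^ k = Matrix.toLin' (g ^ k).1.1 := fun k => by
    simp [← Matrix.toLin'_pow]
  obtain ⟨s, X, h₁, h₂, h₃, h₄, h₅, h⟩ := exists_isCayley_of_isometry h2 (sympForm_symm n)
    (G := Matrix.toLin' g.1.1) ((sympForm_preserved_iff n _).1 g.2) (Nat.card_pos (α := Sp n F)).ne'
    (by rw [hpow, pow_card_eq_one']; exact Matrix.toLin'_one)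
  let P : FormSpace F (-1) := ⟨_, sympForm n, s, X, sympForm_symm n, h₁, h₂, h₃, h₄, h₅⟩
  refine ⟨P, sympForm_nondeg n, ?_, Matrix.toLin' g.1.1, LinearEquiv.refl F _, h, fun _ _ => rfl,
    fun _ => rfl⟩
  change Module.finrank F (Fin n ⊕ Fin n → F) = 2 * n
  simp [two_mul]

theorem exists_isModel_of_nondeg (h2 : (2 : F) ≠ 0) {P : FormSpace F (-1)} (hP : P.Nondeg) {n : ℕ}
    (hn : Module.finrank F P.V = 2 * n) : ∃ (g : Sp n F) (G : _) (f : _), IsModel g P G f := by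
  obtain ⟨f, hf⟩ := exists_symplectic_coordinates h2 hP hn
  obtain ⟨G, hG⟩ := P.exists_isCayley
  have hf' : ∀ u v, P.b (f.symm u) (f.symm v) = sympForm n u v := fun u v => by
    rw [← hf, f.apply_symm_apply, f.apply_symm_apply]
  obtain ⟨g, hg⟩ := exists_mulVec_eq (n := n) (f.conj G) fun u v => by
    simp only [LinearEquiv.conj_apply_apply, hf, hG.isometry, hf']
  exact ⟨g, G, f, hG, hf, fun u => by simp [hg, LinearEquiv.conj_apply_apply]⟩

theorem IsModel.isConj_iff [Finite F] (h2 : (2 : F) ≠ 0) {n : ℕ} {g g' : Sp n F}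
    {P P' : FormSpace F (-1)} {G : Module.End F P.V} {G' : Module.End F P'.V}
    {f : P.V ≃ₗ[F] (Fin n ⊕ Fin n → F)} {f' : P'.V ≃ₗ[F] (Fin n ⊕ Fin n → F)}
    (h : IsModel g P G f) (h' : IsModel g' P' G' f') : IsConj g g' ↔ Iso P P' := by
  obtain ⟨hG, hb, hg⟩ := h
  obtain ⟨hG', hb', hg'⟩ := h'
  rw [_root_.isConj_iff]
  constructor
  · rintro ⟨c, hc⟩
    have hc' : c * g = g' * c := by rw [← hc, inv_mul_cancel_right]
    have hcm : c.1.1 * g.1.1 = g'.1.1 * c.1.1 := congrArg (fun a : Sp n F => a.1.1) hc'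
    let φ : P.V →ₗ[F] P'.V := f'.symm.toLinearMap ∘ₗ Matrix.toLin' c.1.1 ∘ₗ f.toLinearMap
    have hφ : ∀ u, f' (φ u) = c.1.1 *ᵥ f u := fun u => f'.apply_symm_apply _
    have hbij : Function.Bijective φ := by
      have hc1 : Function.Bijective (Matrix.toLin' c.1.1) :=
        (Module.End.isUnit_iff _).1 (c.1.isUnit.map Matrix.toLinAlgEquiv')
      exact f'.symm.bijective.comp (hc1.comp f.bijective)
    refine ⟨LinearEquiv.ofBijective φ hbij, hG.isHom h2 hG' (f := φ) (fun u v => ?_) fun u => ?_⟩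
    · rw [← hb', hφ, hφ, (sympForm_preserved_iff n _).1 c.2, hb]
    · apply f'.injective
      rw [hφ, hg, hg', hφ, Matrix.mulVec_mulVec, Matrix.mulVec_mulVec, hcm]
  · rintro ⟨φ, hφ⟩
    obtain ⟨c, hc⟩ := exists_mulVec_eq (n := n)
      (f'.toLinearMap ∘ₗ φ.toLinearMap ∘ₗ f.symm.toLinearMap)
      fun u v => by
        change sympForm n (f' (φ (f.symm u))) (f' (φ (f.symm v))) = _
        rw [hb', show P'.b (φ _) (φ _) = _ from hφ.b (f.symm u) (f.symm v), ← hb,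
          f.apply_symm_apply, f.apply_symm_apply]
    have hc' : ∀ u, c.1.1 *ᵥ f u = f' (φ u) := fun u => by rw [hc]; simp
    refine ⟨c, mul_inv_eq_of_eq_mul ?_⟩
    refine Subtype.ext (Units.ext (Matrix.toLin'.injective (LinearMap.ext fun v => ?_)))
    obtain ⟨u, rfl⟩ := f.surjective v
    change (c.1.1 * g.1.1) *ᵥ f u = (g'.1.1 * c.1.1) *ᵥ f u
    rw [← Matrix.mulVec_mulVec, ← Matrix.mulVec_mulVec, ← hg, hc', hc', ← hg']
    exact congrArg f' (hφ.isCayley hG hG' u)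

theorem card_conjClasses_Sp [Finite F] (h2 : (2 : F) ≠ 0) (n : ℕ) :
    ENat.card {c : Cls (-1 : F) // c.dim = 2 * n} = Nat.card (ConjClasses (Sp n F)) := by
  obtain ⟨e, -⟩ := exists_equiv_of_rel (f := (ConjClasses.mk : Sp n F → _))
    (g := fun P : {P : FormSpace F (-1) // P.Nondeg ∧ Module.finrank F P.V = 2 * n} =>
      (⟨toCls P.1 P.2.1, P.2.2⟩ : {c : Cls (-1 : F) // c.dim = 2 * n}))
    (R := fun g P => ∃ G f, IsModel g P.1 G f) ConjClasses.mk_surjective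
    (by
      rintro ⟨c, hc⟩
      obtain ⟨P, hP, rfl⟩ := c.exists_rep
      exact ⟨⟨P, hP, hc⟩, rfl⟩)
    (fun g => by
      obtain ⟨P, hP, hn, h⟩ := exists_isModel h2 g
      exact ⟨⟨P, hP, hn⟩, h⟩)
    (fun P => exists_isModel_of_nondeg h2 P.2.1 P.2.2)
    (by
      rintro g P g' P' ⟨G, f, h⟩ ⟨G', f', h'⟩
      rw [ConjClasses.mk_eq_mk_iff_isConj, h.isConj_iff h2 h', Subtype.ext_iff]
      exact toCls_eq.symm)
  have : Finite (ConjClasses (Sp n F)) := Quotient.finite _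
  rw [← ENat.card_congr e, ENat.card_eq_coe_natCard]

end FormSpace

end

/-- Theorem 3.13(3): for fixed odd `q`,
`k(Sp(2n,q))/q^n → ∏_{i≥1} (1 + q^{-i})⁴/(1 - q^{-i})` as `n → ∞`. -/
theorem stmt_13 (q : ℕ) (hq : IsPrimePow q) (hodd : Odd q)
    (F : Type*) [Field F] [Fintype F] (hF : Fintype.card F = q) :
    Filter.Tendsto
      (fun n : ℕ => (Nat.card (ConjClasses (Sp n F)) : ℝ) / (q : ℝ) ^ n)
      Filter.atTop
      (nhds (∏' i : ℕ, (1 + ((q : ℝ) ^ (i + 1))⁻¹) ^ 4 / (1 - ((q : ℝ) ^ (i + 1))⁻¹))) := by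
  have h2 : (2 : F) ≠ 0 := by
    apply Ring.two_ne_zero
    rw [Ne, FiniteField.even_card_iff_char_two, hF]
    have := Nat.odd_iff.1 hodd
    omega
  refine FormSpace.tendsto_main hq.two_le h2 (fun n => ?_) (FormSpace.Cls.even_dim h2) (fun j => ?_)
    (FormSpace.genSS_one h2)
  · rw [tsum_ite_eq_card, FormSpace.card_conjClasses_Sp h2]
    rfl
  · rw [tsum_ite_eq_card, FormSpace.card_ssCls h2, hF]
    simp
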